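/- arXiv:2111.14410 — 3 statements merged into one kernel-verified Lean document; each statement's English description precedes it below -/
import Mathlib

section
/- Let n ≥ 2 and let h ∈ ℂ[X₀,…,Xₙ] be an irreducible homogeneous polynomial of degree d whose hypersurface X = {h = 0} ⊂ ℙⁿ(ℂ) has only isolated singularities (or is smooth), i.e. the Jacobian ring J(h) has Krull dimension ≤ 1. If X is totally invariant, then d = 1, i.e. X is a hyperplane. -/
open MvPolynomial

/-- `F` is an endomorphism of `ℙ^{N-1}(ℂ)` of algebraic degree `q`: a tuple of `N`
homogeneous polynomials of degree `q` in `N` variables whose only common zero in `ℂ^N`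
is the origin. -/
def IsEndo (N q : ℕ) (F : Fin N → MvPolynomial (Fin N) ℂ) : Prop :=
  (∀ i, (F i).IsHomogeneous q) ∧
    ∀ x : Fin N → ℂ, (∀ i, eval x (F i) = 0) → x = 0

/-- The hypersurface `{h = 0} ⊂ ℙ^{N-1}(ℂ)` is totally invariant: there is a non-trivial
endomorphism `F` (of algebraic degree `q ≥ 2`) and `λ ≠ 0` with `h(F₀,…,F_{N-1}) = λ·h^q`. -/
def IsTotallyInvariant (N : ℕ) (h : MvPolynomial (Fin N) ℂ) : Prop :=
  ∃ q, 2 ≤ q ∧ ∃ F : Fin N → MvPolynomial (Fin N) ℂ, IsEndo N q F ∧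
    ∃ lam : ℂ, lam ≠ 0 ∧ aeval F h = C lam * h ^ q

/-- The Jacobian ideal `(h, ∂h/∂X₀, …, ∂h/∂X_{N-1})`. -/
noncomputable def jacobianIdeal (N : ℕ) (h : MvPolynomial (Fin N) ℂ) : Ideal (MvPolynomial (Fin N) ℂ) :=
  Ideal.span (insert h (Set.range fun i => pderiv i h))


section

section LocalCM
open RingTheory.Sequence IsLocalRing Pointwise
universe u

lemma p1_depth_le {A : Type u} [CommRing A] [IsNoetherianRing A] [IsLocalRing A]
    (rs : List A) (hrs : ∀ r ∈ rs, r ∈ maximalIdeal A) (M : Type u) [AddCommGroup M] [Module A M]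
    [Module.Finite A M] (hreg : IsWeaklyRegular M rs) (U : Submodule A M) (hU : U ≠ ⊥) :
    (rs.length : WithBot ℕ∞) ≤ ringKrullDim (A ⧸ U.annihilator) := by
  induction rs generalizing M with
  | nil =>
    have : Nontrivial (A ⧸ U.annihilator) := by
      apply Ideal.Quotient.nontrivial_iff.mpr
      intro h
      exact hU (Submodule.annihilator_eq_top_iff.mp h)
    simpa using ringKrullDim_nonneg_of_nontrivial
  | cons z rs ih =>
    rw [isWeaklyRegular_cons_iff] at hreg
    obtain ⟨hz, hreg⟩ := hreg
    set J := U.annihilator with hJ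
    set U1 : Submodule A M := Submodule.torsionBySet A M (J : Set A) with hU1
    have memU1 : ∀ m : M, m ∈ U1 ↔ ∀ a ∈ J, a • m = 0 := by
      intro m
      rw [hU1, Submodule.mem_torsionBySet_iff]
      exact ⟨fun h a ha => h ⟨a, ha⟩, fun h a => h a.1 a.2⟩
    have hUU1 : U ≤ U1 := by
      intro m hm
      rw [memU1]
      intro a ha
      exact Submodule.mem_annihilator.mp ha m hm
    set V : Submodule A (QuotSMulTop z M) := U1.map (Submodule.mkQ _) with hV
    have hVne : V ≠ ⊥ := by
      intro hb
      have h1 : U1 ≤ (z • ⊤ : Submodule A M) := by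
        intro m hm
        have h0 : (Submodule.mkQ (z • ⊤ : Submodule A M)) m ∈ V := Submodule.mem_map_of_mem hm
        rw [hb, Submodule.mem_bot, Submodule.mkQ_apply, Submodule.Quotient.mk_eq_zero] at h0
        exact h0
      have h2 : U1 ≤ (Ideal.span {z} : Ideal A) • U1 := by
        intro m hm
        obtain ⟨m', -, rfl⟩ := (Submodule.mem_smul_pointwise_iff_exists _ _ _).mp (h1 hm)
        rw [Submodule.ideal_span_singleton_smul]
        apply Submodule.smul_mem_pointwise_smul
        rw [memU1] at hm ⊢
        intro a ha
        apply hz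
        simp only [smul_zero]
        rw [← hm a ha, smul_comm]
      have h3 : U1 = ⊥ := Submodule.eq_bot_of_le_smul_of_le_jacobson_bot _ _
        (IsNoetherian.noetherian _) h2 (by
          rw [IsLocalRing.jacobson_eq_maximalIdeal _ bot_ne_top, Ideal.span_singleton_le_iff_mem]
          exact hrs z (by simp))
      exact hU (le_bot_iff.mp (h3 ▸ hUU1))
    have h4 := ih (fun r hr => hrs r (by simp [hr])) (QuotSMulTop z M) hreg V hVne
    have hle : J ≤ V.annihilator := by
      intro a ha
      rw [Submodule.mem_annihilator]
      rintro _ ⟨m, hm, rfl⟩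
      rw [← map_smul, (memU1 m).mp hm a ha, map_zero]
    have hzV : z ∈ V.annihilator := by
      rw [Submodule.mem_annihilator]
      rintro _ ⟨m, hm, rfl⟩
      rw [← map_smul, Submodule.mkQ_apply, Submodule.Quotient.mk_eq_zero]
      exact Submodule.smul_mem_pointwise_smul _ _ _ trivial
    have h5 : ringKrullDim (A ⧸ V.annihilator) + 1 ≤ ringKrullDim (A ⧸ J) := by
      refine ringKrullDim_succ_le_of_surjective (Ideal.Quotient.factor hle)
        (Ideal.Quotient.factor_surjective hle) (r := Ideal.Quotient.mk J z) ?_ ?_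
      · rw [mem_nonZeroDivisors_iff_right]
        intro x hx
        obtain ⟨b, rfl⟩ := Ideal.Quotient.mk_surjective x
        rw [← map_mul, Ideal.Quotient.eq_zero_iff_mem] at hx
        rw [Ideal.Quotient.eq_zero_iff_mem, hJ, Submodule.mem_annihilator]
        intro m hm
        apply hz
        have := Submodule.mem_annihilator.mp hx m hm
        simp only [smul_zero]
        rw [← this, mul_comm, mul_smul]
      · rw [Ideal.Quotient.factor_mk, Ideal.Quotient.eq_zero_iff_mem]
        exact hzV
    refine le_trans ?_ h5
    simp only [List.length_cons, Nat.cast_add, Nat.cast_one]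
    gcongr

open CategoryTheory Abelian in
lemma p1_exchange {A : Type u} [CommRing A] [IsNoetherianRing A] [IsLocalRing A]
    (M : Type u) [AddCommGroup M] [Module A M] [Module.Finite A M] [Nontrivial M]
    (rs : List A) (hrs : ∀ r ∈ rs, r ∈ maximalIdeal A) (k : ℕ) (hk : rs.length = k + 1)
    (hreg : IsWeaklyRegular M rs) (f : A) (hf : f ∈ maximalIdeal A) (hfM : IsSMulRegular M f) :
    ∃ rs' : List A, rs'.length = k ∧ (∀ r ∈ rs', r ∈ maximalIdeal A) ∧
      IsWeaklyRegular (QuotSMulTop f M) rs' := by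
  have lt1 : ∀ (M : Type u) [AddCommGroup M] [Module A M] [Module.Finite A M] [Nontrivial M],
    maximalIdeal A • (⊤ : Submodule A M) < ⊤ := by
    intro M _ _ _ _
    exact (Submodule.top_ne_ideal_smul_of_le_jacobson_annihilator
      (maximalIdeal_le_jacobson _)).symm.lt_top
  have hnt : Nontrivial (QuotSMulTop f M) := nontrivial_quotSMulTop_of_mem_maximalIdeal _ hf
  have t1 := ModuleCat.exists_isRegular_tfae (maximalIdeal A) (k+1) (ModuleCat.of A M) (lt1 M)
  have t2 := ModuleCat.exists_isRegular_tfae (maximalIdeal A) k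
    (ModuleCat.of A (QuotSMulTop f M)) (lt1 _)
  have h12 := t1.out 3 1
  have h2 := h12.mp ⟨rs, hk, hrs,
    RingTheory.Sequence.IsRegular.of_isWeaklyRegular_of_mem_maximalIdeal _ hrs hreg⟩
  have h13 := t2.out 1 3
  obtain ⟨rs', h⟩ := h13.mp (by
      intro i hi
      have zero1 := AddCommGrpCat.isZero_of_iff_subsingleton.mpr (h2 i (by omega))
      have zero2 := AddCommGrpCat.isZero_of_iff_subsingleton.mpr (h2 (i + 1) (by omega))
      exact AddCommGrpCat.subsingleton_of_isZero <| ShortComplex.Exact.isZero_of_both_zeros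
        ((Ext.covariant_sequence_exact₃' _
          (IsSMulRegular.smulShortComplex_shortExact (M := ModuleCat.of A M) hfM)) i (i + 1) rfl)
        (zero1.eq_zero_of_src _) (zero2.eq_zero_of_tgt _))
  exact ⟨rs', h.1, h.2.1, h.2.2.toIsWeaklyRegular⟩

lemma p1_dim_le_of_le {A : Type u} [CommRing A] {I J : Ideal A} (h : I ≤ J) :
    ringKrullDim (A ⧸ J) ≤ ringKrullDim (A ⧸ I) :=
  ringKrullDim_le_of_surjective _ (Ideal.Quotient.factor_surjective h)

lemma p1_sop_regular {A : Type u} [CommRing A] [IsNoetherianRing A] [IsLocalRing A]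
    (fs : List A) (hfs : ∀ r ∈ fs, r ∈ maximalIdeal A)
    (M : Type u) [AddCommGroup M] [Module A M] [Module.Finite A M] [Nontrivial M]
    (rs : List A) (hrs : ∀ r ∈ rs, r ∈ maximalIdeal A) (hk : rs.length = fs.length)
    (hreg : IsWeaklyRegular M rs)
    (hdim : ringKrullDim (A ⧸ (Module.annihilator A M ⊔ Ideal.ofList fs)) ≤ 0) :
    IsWeaklyRegular M fs := by
  induction fs generalizing M rs with
  | nil => exact IsWeaklyRegular.nil _ _
  | cons f fs ih =>
    have hf : f ∈ maximalIdeal A := hfs f (by simp)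
    have hfM : IsSMulRegular M f := by
      rw [isSMulRegular_iff_right_eq_zero_of_smul]
      intro m hm
      by_contra hm0
      have h1 := p1_depth_le rs hrs M hreg (Submodule.span A {m}) (by simpa using hm0)
      set J := (Submodule.span A {m}).annihilator with hJ
      have hfJ : f ∈ J := by
        rw [hJ, Submodule.mem_annihilator_span_singleton]; exact hm
      have hAJ : Module.annihilator A M ≤ J := by
        intro a ha
        rw [hJ, Submodule.mem_annihilator_span_singleton]
        exact Module.mem_annihilator.mp ha m
      have hJtop : J ≠ ⊤ := by
        intro h
        have := Submodule.annihilator_eq_top_iff.mp h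
        simp at this
        exact hm0 this
      have : Nontrivial (A ⧸ J) := Ideal.Quotient.nontrivial_iff.mpr hJtop
      have : IsLocalRing (A ⧸ J) :=
        IsLocalRing.of_surjective' (Ideal.Quotient.mk J) Ideal.Quotient.mk_surjective
      classical
      set s : Finset (A ⧸ J) := (fs.map (Ideal.Quotient.mk J)).toFinset with hs
      have hsj : (s : Set (A ⧸ J)) ⊆ Ring.jacobson (A ⧸ J) := by
        intro x hx
        rw [hs] at hx
        simp only [List.coe_toFinset, List.mem_map, Set.mem_ofPred_eq] at hx
        obtain ⟨a, ha, rfl⟩ := hx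
        rw [IsLocalRing.ringJacobson_eq_maximalIdeal]
        have := hfs a (by simp [ha])
        have hl : IsLocalHom (Ideal.Quotient.mk J) :=
          IsLocalHom.of_surjective _ Ideal.Quotient.mk_surjective
        exact map_nonunit _ _ this
      have h2 := ringKrullDim_le_ringKrullDim_quotient_add_card (R := A ⧸ J) s hsj
      have h3 : ringKrullDim ((A ⧸ J) ⧸ Ideal.span (s : Set (A ⧸ J))) ≤ 0 := by
        refine le_trans ?_ hdim
        have hle : Module.annihilator A M ⊔ Ideal.ofList (f :: fs) ≤ RingHom.ker
            ((Ideal.Quotient.mk (Ideal.span (s : Set (A ⧸ J)))).comp (Ideal.Quotient.mk J)) := by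
          apply sup_le
          · intro a ha
            rw [RingHom.mem_ker, RingHom.comp_apply, Ideal.Quotient.eq_zero_iff_mem.mpr (hAJ ha),
              map_zero]
          · rw [Ideal.ofList, Ideal.span_le]
            intro a ha
            simp only [List.mem_cons, Set.mem_ofPred_eq] at ha
            rw [SetLike.mem_coe, RingHom.mem_ker, RingHom.comp_apply]
            rcases ha with rfl | ha
            · rw [Ideal.Quotient.eq_zero_iff_mem.mpr hfJ, map_zero]
            · rw [Ideal.Quotient.eq_zero_iff_mem]
              apply Ideal.subset_span
              simp only [hs, List.coe_toFinset, List.mem_map, Set.mem_ofPred_eq]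
              exact ⟨a, ha, rfl⟩
        apply ringKrullDim_le_of_surjective (Ideal.Quotient.lift _ _ (fun a ha => hle ha))
        apply Ideal.Quotient.lift_surjective_of_surjective
        exact Ideal.Quotient.mk_surjective.comp Ideal.Quotient.mk_surjective
      have h4 : s.card ≤ fs.length := by
        rw [hs]; refine (List.toFinset_card_le _).trans (by simp)
      have h5 : ((fs.length + 1 : ℕ) : WithBot ℕ∞) ≤ (fs.length : ℕ) := by
        calc ((fs.length + 1 : ℕ) : WithBot ℕ∞) = (rs.length : ℕ) := by rw [hk]; simp
          _ ≤ _ := h1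
          _ ≤ _ := h2
          _ ≤ 0 + (fs.length : ℕ) := by gcongr
          _ = _ := by simp
      have : fs.length + 1 ≤ fs.length := by exact_mod_cast h5
      omega
    obtain ⟨rs', h1, h2, h3⟩ := p1_exchange M rs hrs fs.length (by simpa using hk) hreg f hf hfM
    have hnt : Nontrivial (QuotSMulTop f M) := nontrivial_quotSMulTop_of_mem_maximalIdeal _ hf
    refine IsWeaklyRegular.cons hfM (ih (fun r hr => hfs r (by simp [hr])) _ rs' h2 h1 h3 ?_)
    refine le_trans (p1_dim_le_of_le ?_) hdim
    rw [Ideal.ofList_cons]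
    refine sup_le (le_sup_of_le_left ?_) (sup_le (le_sup_of_le_left ?_) le_sup_right)
    · intro a ha
      rw [Module.mem_annihilator]
      intro m
      obtain ⟨m, rfl⟩ := Submodule.mkQ_surjective _ m
      rw [← map_smul, Module.mem_annihilator.mp ha, map_zero]
    · rw [Ideal.span_singleton_le_iff_mem, Module.mem_annihilator]
      intro m
      obtain ⟨m, rfl⟩ := Submodule.mkQ_surjective _ m
      rw [← map_smul, Submodule.mkQ_apply, Submodule.Quotient.mk_eq_zero]
      exact Submodule.smul_mem_pointwise_smul _ _ _ trivial

end LocalCM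

end

section

section EndoReg
open RingTheory.Sequence IsLocalRing Pointwise

lemma p1_X_regular (N : ℕ) (l : List (Fin N)) (hl : l.Nodup) :
    IsWeaklyRegular (MvPolynomial (Fin N) ℂ) (l.map (X : Fin N → MvPolynomial (Fin N) ℂ)) := by
  rw [isWeaklyRegular_iff_Fin]
  rintro ⟨i, hi⟩
  have hi' : i < l.length := by simpa using hi
  rw [isSMulRegular_iff_right_eq_zero_of_smul]
  intro m hm
  obtain ⟨p, rfl⟩ := Submodule.mkQ_surjective _ m
  rw [← map_smul] at hm
  simp only [Submodule.mkQ_apply, Submodule.Quotient.mk_eq_zero, smul_eq_mul, Ideal.mul_top] at hm ⊢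
  have key : Ideal.ofList (List.take i (l.map (X : Fin N → MvPolynomial (Fin N) ℂ))) =
      Ideal.span (X '' {j | j ∈ l.take i}) := by
    rw [Ideal.ofList]
    congr 1
    ext p
    simp [← List.map_take]
  rw [key] at hm ⊢
  rw [mem_ideal_span_X_image] at hm ⊢
  intro a ha
  have hg : (l.map (X : Fin N → MvPolynomial (Fin N) ℂ))[i] = X l[i] := by simp
  replace hm : ∀ m ∈ (X l[i] * p : MvPolynomial (Fin N) ℂ).support,
    ∃ j ∈ {j | j ∈ l.take i}, m j ≠ 0 := hg ▸ hm
  obtain ⟨j, hj, hj2⟩ := hm (a + Finsupp.single l[i] 1) (by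
    rw [mem_support_iff] at ha ⊢
    rw [mul_comm, coeff_mul_X]; exact ha)
  refine ⟨j, hj, ?_⟩
  have hne : l[i] ≠ j := by
    intro h
    simp only [Set.mem_ofPred_eq] at hj
    rw [List.mem_take_iff_getElem] at hj
    obtain ⟨k, hk, hk2⟩ := hj
    have := (List.Nodup.getElem_inj_iff hl).mp (h.trans hk2.symm)
    omega
  simpa [Finsupp.single_apply, hne] using hj2

/-- The maximal ideal at the origin. -/
noncomputable abbrev p1_m0 (N : ℕ) : Ideal (MvPolynomial (Fin N) ℂ) :=
  RingHom.ker (constantCoeff : MvPolynomial (Fin N) ℂ →+* ℂ)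

instance p1_m0_prime (N : ℕ) : (p1_m0 N).IsPrime := RingHom.ker_isPrime _

/-- The local ring at the origin. -/
abbrev p1_A (N : ℕ) : Type := Localization.AtPrime (p1_m0 N)

lemma p1_m0_eq (N : ℕ) : p1_m0 N = Ideal.span (Set.range X) := by
  rw [← Set.image_univ]
  ext p
  rw [mem_ideal_span_X_image, RingHom.mem_ker, constantCoeff_eq]
  constructor
  · intro h m hm
    by_contra hc
    push Not at hc
    have : m = 0 := by ext i; simpa using hc i
    rw [mem_support_iff, this] at hm
    exact hm h
  · intro h
    by_contra hc
    obtain ⟨i, -, hi⟩ := h 0 (mem_support_iff.mpr hc)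
    exact hi rfl

lemma p1_nullst {N q : ℕ} {F : Fin N → MvPolynomial (Fin N) ℂ} (hF : IsEndo N q F) (i : Fin N) :
    ∃ k, (X i : MvPolynomial (Fin N) ℂ) ^ k ∈ Ideal.span (Set.range F) := by
  have h : (X i : MvPolynomial (Fin N) ℂ) ∈ (Ideal.span (Set.range F)).radical := by
    rw [← vanishingIdeal_zeroLocus_eq_radical (K := ℂ), mem_vanishingIdeal_iff]
    intro x hx
    rw [mem_zeroLocus_iff] at hx
    have := hF.2 x (fun j => by
      have := hx (F j) (Ideal.subset_span ⟨j, rfl⟩)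
      rwa [← aeval_eq_eval])
    simp [this]
  exact h

lemma p1_F_regular {N q : ℕ} (hq : 0 < q) {F : Fin N → MvPolynomial (Fin N) ℂ}
    (hF : IsEndo N q F) :
    IsWeaklyRegular (p1_A N) (List.ofFn fun i => algebraMap _ (p1_A N) (F i)) := by
  have hcF : ∀ i, F i ∈ p1_m0 N := by
    intro i
    rw [RingHom.mem_ker, constantCoeff_eq]
    apply (hF.1 i).coeff_eq_zero
    simp; omega
  have hm : ∀ p ∈ p1_m0 N, algebraMap _ (p1_A N) p ∈ maximalIdeal (p1_A N) := by
    intro p hp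
    exact (IsLocalization.AtPrime.to_map_mem_maximal_iff (p1_A N) (p1_m0 N) p).mpr hp
  have hX := (p1_X_regular N (List.finRange N) (List.nodup_finRange N)).of_isLocalization
    (S := p1_A N) (T := (p1_m0 N).primeCompl)
  refine p1_sop_regular _ ?_ (p1_A N) _ ?_ ?_ hX ?_
  · intro r hr
    rw [List.mem_ofFn] at hr
    obtain ⟨i, rfl⟩ := hr
    exact hm _ (hcF i)
  · intro r hr
    simp only [List.map_map, List.mem_map] at hr
    obtain ⟨i, -, rfl⟩ := hr
    apply hm
    simp [RingHom.mem_ker]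
  · simp
  · refine (Ring.krullDimLE_iff (n := 0)).mp (Ring.KrullDimLE.mk₀ ?_)
    intro I hI
    set π := Ideal.Quotient.mk (Module.annihilator (p1_A N) (p1_A N) ⊔
      Ideal.ofList (List.ofFn fun i => algebraMap _ (p1_A N) (F i)))
    have hp : (I.comap π).IsPrime := Ideal.comap_isPrime _ _
    have hle : maximalIdeal (p1_A N) ≤ I.comap π := by
      rw [← Localization.AtPrime.map_eq_maximalIdeal, Ideal.map_le_iff_le_comap]
      refine (p1_m0_eq N).le.trans ?_
      rw [Ideal.span_le]
      rintro _ ⟨i, rfl⟩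
      obtain ⟨k, hk⟩ := p1_nullst hF i
      rw [SetLike.mem_coe, Ideal.mem_comap]
      have h1 : algebraMap (MvPolynomial (Fin N) ℂ) (p1_A N) (X i) ^ k ∈ I.comap π := by
        rw [← map_pow]
        have : Ideal.span (Set.range F) ≤ (I.comap π).comap (algebraMap _ (p1_A N)) := by
          rw [Ideal.span_le]
          rintro _ ⟨j, rfl⟩
          rw [SetLike.mem_coe, Ideal.mem_comap, Ideal.mem_comap]
          have : π (algebraMap _ (p1_A N) (F j)) = 0 := by
            rw [Ideal.Quotient.eq_zero_iff_mem]
            apply Ideal.mem_sup_right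
            apply Ideal.subset_span
            simp [List.mem_ofFn]
          rw [this]
          exact zero_mem _
        exact this hk
      exact hp.mem_of_pow_mem k h1
    have heq : I.comap π = maximalIdeal (p1_A N) :=
      ((maximalIdeal.isMaximal _).eq_of_le hp.ne_top hle).symm
    have : (I.comap π).IsMaximal := heq ▸ maximalIdeal.isMaximal _
    have h2 := Ideal.map_eq_top_or_isMaximal_of_surjective π Ideal.Quotient.mk_surjective this
    rw [Ideal.map_comap_of_surjective π Ideal.Quotient.mk_surjective] at h2
    exact h2.resolve_left hI.ne_top
end EndoReg

end

section

section LI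
open RingTheory.Sequence Pointwise

lemma p2_LI {A : Type} [CommRing A] [Algebra ℂ A] {κ : Type} (l : ℕ) (rs : Fin l → A)
    (M : Type) [AddCommGroup M] [Module A M] (hreg : IsWeaklyRegular M (List.ofFn rs))
    (T : Finset κ) (c : κ → M)
    (hc : ∀ lam : κ → ℂ, ∑ t ∈ T, algebraMap ℂ A (lam t) • c t ∈
      (Ideal.ofList (List.ofFn rs) • ⊤ : Submodule A M) → ∀ t ∈ T, lam t = 0)
    (p : κ → MvPolynomial (Fin l) ℂ) (hp : ∑ t ∈ T, aeval rs (p t) • c t = 0) :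
    ∀ t ∈ T, p t = 0 := by
  induction l generalizing M with
  | zero =>
    have h1 := hc (fun t => coeff 0 (p t)) (by
      have h2 : ∀ t, aeval rs (p t) = algebraMap ℂ A (coeff 0 (p t)) := by
        intro t
        conv_lhs => rw [eq_C_of_isEmpty (p t)]
        rw [aeval_C]
      simp only [h2] at hp
      rw [hp]; exact zero_mem _)
    intro t ht
    rw [eq_C_of_isEmpty (p t), h1 t ht, C_0]
  | succ l ih =>
    rw [List.ofFn_succ] at hreg hc
    rw [isWeaklyRegular_cons_iff] at hreg
    obtain ⟨h0, hreg⟩ := hreg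
    set rs' : Fin l → A := fun i => rs i.succ with hrs'
    set Q := QuotSMulTop (rs 0) M
    set π : M →ₗ[A] Q := Submodule.mkQ _ with hπ
    have ih' := ih rs' Q hreg (fun t => π (c t)) (by
      intro lam hl
      apply hc lam
      simp only [← map_smul, ← map_sum] at hl
      have h3 : ∑ t ∈ T, algebraMap ℂ A (lam t) • c t ∈
          (Ideal.ofList (List.ofFn rs') • ⊤ : Submodule A Q).comap π := hl
      rw [Submodule.comap_smul_top_of_surjective _ _ (Submodule.mkQ_surjective _)] at h3
      rw [Ideal.ofList_cons_smul, sup_comm]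
      simpa [hπ, Submodule.ker_mkQ] using h3)
    set ψ : MvPolynomial (Fin l) ℂ →+* A := (aeval rs' : MvPolynomial (Fin l) ℂ →ₐ[ℂ] A).toRingHom with hψ
    have inner : ∀ (D : ℕ) (P : κ → Polynomial (MvPolynomial (Fin l) ℂ)),
        (∀ t ∈ T, ∀ k, D ≤ k → (P t).coeff k = 0) →
        ∑ t ∈ T, Polynomial.eval₂ ψ (rs 0) (P t) • c t = 0 → ∀ t ∈ T, P t = 0 := by
      intro D
      induction D with
      | zero =>
        intro P hP _ t ht
        ext1 k
        exact hP t ht k (Nat.zero_le _)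
      | succ D ihD =>
        intro P hP hs
        have he : ∀ t, Polynomial.eval₂ ψ (rs 0) (P t) =
            rs 0 * Polynomial.eval₂ ψ (rs 0) (P t).divX + aeval rs' ((P t).coeff 0) := by
          intro t
          conv_lhs => rw [← Polynomial.divX_mul_X_add (P t)]
          rw [Polynomial.eval₂_add, Polynomial.eval₂_mul_X, Polynomial.eval₂_C, mul_comm]
          rfl
        have h4 : ∀ t ∈ T, (P t).coeff 0 = 0 := by
          apply ih' (fun t => (P t).coeff 0)
          have h5 := congrArg π hs
          rw [map_sum, map_zero] at h5
          rw [← h5]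
          refine Finset.sum_congr rfl fun t _ => ?_
          rw [he t, add_smul, map_add, mul_smul, map_smul π (aeval rs' _)]
          have : π (rs 0 • Polynomial.eval₂ ψ (rs 0) (P t).divX • c t) = 0 := by
            rw [hπ, Submodule.mkQ_apply, Submodule.Quotient.mk_eq_zero]
            exact Submodule.smul_mem_pointwise_smul _ _ _ trivial
          rw [this, zero_add]
        have h6 : ∑ t ∈ T, Polynomial.eval₂ ψ (rs 0) (P t).divX • c t = 0 := by
          apply h0
          simp only [smul_zero]
          rw [Finset.smul_sum, ← hs]
          refine Finset.sum_congr rfl fun t ht => ?_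
          rw [he t, h4 t ht, map_zero, add_zero, mul_smul]
        have h7 := ihD (fun t => (P t).divX) (fun t ht k hk => by
          rw [Polynomial.coeff_divX]; exact hP t ht _ (by omega)) h6
        intro t ht
        rw [← Polynomial.divX_mul_X_add (P t), h7 t ht, h4 t ht]
        simp
    have hev : ∀ t, aeval rs (p t) = Polynomial.eval₂ ψ (rs 0) (finSuccEquiv ℂ l (p t)) := by
      intro t
      have : (aeval rs : MvPolynomial (Fin (l+1)) ℂ →ₐ[ℂ] A) =
          ({ Polynomial.eval₂RingHom ψ (rs 0) with
             commutes' := by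
              intro r
              simp [hψ, Polynomial.algebraMap_apply] } : Polynomial (MvPolynomial (Fin l) ℂ) →ₐ[ℂ] A).comp
            (finSuccEquiv ℂ l : _ →ₐ[ℂ] _) := by
        apply algHom_ext
        intro i
        refine Fin.cases ?_ (fun j => ?_) i
        · simp [MvPolynomial.finSuccEquiv_X_zero]
        · simp [hψ, hrs', MvPolynomial.finSuccEquiv_X_succ]
      rw [this]; rfl
    have h8 := inner (T.sup fun t => (finSuccEquiv ℂ l (p t)).natDegree + 1)
      (fun t => finSuccEquiv ℂ l (p t)) (by
        intro t ht k hk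
        apply Polynomial.coeff_eq_zero_of_natDegree_lt
        have := Finset.le_sup (f := fun t => (finSuccEquiv ℂ l (p t)).natDegree + 1) ht
        omega) (by simpa only [hev] using hp)
    intro t ht
    have := h8 t ht
    simpa using this
end LI

end

section

section Syz

lemma p2_hc_mul {N q : ℕ} (f g : MvPolynomial (Fin N) ℂ) (hf : f.IsHomogeneous q) (e : ℕ) :
    homogeneousComponent e (g * f) =
      if q ≤ e then homogeneousComponent (e - q) g * f else 0 := by
  let _ := MvPolynomial.gradedAlgebra (σ := Fin N) (R := ℂ)
  have hd : ∀ (k : ℕ) (φ : MvPolynomial (Fin N) ℂ),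
    (DirectSum.decompose (homogeneousSubmodule (Fin N) ℂ) φ k : MvPolynomial (Fin N) ℂ) =
      homogeneousComponent k φ := fun k φ => decomposition.decompose'_apply φ k
  rw [← hd, ← hd]
  exact DirectSum.coe_decompose_mul_of_right_mem _ e hf

lemma p2_descend {N q : ℕ} {F : Fin N → MvPolynomial (Fin N) ℂ} (hF : IsEndo N q F)
    (s : MvPolynomial (Fin N) ℂ)
    (hs : algebraMap _ (p1_A N) s ∈
      (Ideal.span (Set.range F)).map (algebraMap _ (p1_A N))) : s ∈ Ideal.span (Set.range F) := by
  rw [IsLocalization.algebraMap_mem_map_algebraMap_iff (p1_m0 N).primeCompl] at hs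
  obtain ⟨t, ht, hts⟩ := hs
  have htop : Ideal.span (Set.range F) ⊔ Ideal.span {t} = ⊤ := by
    by_contra hne
    obtain ⟨P, hP, hle⟩ := Ideal.exists_le_maximal _ hne
    have h1 : p1_m0 N ≤ P := by
      rw [p1_m0_eq, Ideal.span_le]
      rintro _ ⟨i, rfl⟩
      obtain ⟨k, hk⟩ := p1_nullst hF i
      exact hP.isPrime.mem_of_pow_mem k (hle (Ideal.mem_sup_left hk))
    have hm : (p1_m0 N).IsMaximal := RingHom.ker_isMaximal_of_surjective _
      (fun c => ⟨C c, by simp⟩)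
    have h2 : p1_m0 N = P := hm.eq_of_le hP.ne_top h1
    apply ht
    rw [h2]
    exact hle (Ideal.mem_sup_right (Ideal.mem_span_singleton_self t))
  have h1 : (1 : MvPolynomial (Fin N) ℂ) ∈ Ideal.span (Set.range F) ⊔ Ideal.span {t} := by
    rw [htop]; trivial
  obtain ⟨a, ha, b, hb, hab⟩ := Submodule.mem_sup.mp h1
  obtain ⟨c, rfl⟩ := Ideal.mem_span_singleton'.mp hb
  have : s = a * s + c * (t * s) := by
    calc s = (a + c * t) * s := by rw [hab, one_mul]
      _ = _ := by ring
  rw [this]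
  exact add_mem (Ideal.mul_mem_right _ _ ha) (Ideal.mul_mem_left _ _ hts)

/-- Monomial basis modulo (F). -/
lemma p2_basis {N q : ℕ} (hq : 0 < q) {F : Fin N → MvPolynomial (Fin N) ℂ} (hF : IsEndo N q F) :
    ∃ B : Set (Fin N →₀ ℕ),
      (∀ u : MvPolynomial (Fin N) ℂ, ∃ g : MvPolynomial (Fin N) ℂ,
        (↑g.support ⊆ B) ∧ u - g ∈ Ideal.span (Set.range F)) ∧
      (∀ (T : Finset (Fin N →₀ ℕ)) (p : (Fin N →₀ ℕ) → MvPolynomial (Fin N) ℂ), ↑T ⊆ B →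
        ∑ t ∈ T, monomial t 1 * aeval F (p t) = 0 → ∀ t ∈ T, p t = 0) := by
  set I := Ideal.span (Set.range F) with hI
  set π : MvPolynomial (Fin N) ℂ →ₗ[ℂ] (MvPolynomial (Fin N) ℂ ⧸ I) :=
    (Ideal.Quotient.mkₐ ℂ I).toLinearMap with hπ
  have hπ0 : ∀ u, π u = 0 ↔ u ∈ I := fun u => Ideal.Quotient.eq_zero_iff_mem
  obtain ⟨κ, a, ha, hsp, hli⟩ := exists_linearIndependent' ℂ
    (fun t : Fin N →₀ ℕ => π (monomial t 1))
  refine ⟨Set.range a, ?_, ?_⟩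
  · intro u
    have h1 : π u ∈ Submodule.span ℂ (Set.range ((fun t : Fin N →₀ ℕ => π (monomial t 1)) ∘ a)) := by
      rw [hsp]
      rw [u.as_sum, map_sum]
      apply Submodule.sum_mem
      intro m _
      have : (monomial m (coeff m u) : MvPolynomial (Fin N) ℂ) = coeff m u • monomial m 1 := by
        rw [smul_monomial, smul_eq_mul, mul_one]
      rw [this, map_smul]
      exact Submodule.smul_mem _ _ (Submodule.subset_span ⟨m, rfl⟩)
    have h2 : ∀ z ∈ Submodule.span ℂ
        (Set.range ((fun t : Fin N →₀ ℕ => π (monomial t 1)) ∘ a)),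
        ∃ g : MvPolynomial (Fin N) ℂ, (↑g.support ⊆ Set.range a) ∧ π g = z := by
      intro z hz
      induction hz using Submodule.span_induction with
      | mem z hz =>
        obtain ⟨k, rfl⟩ := hz
        refine ⟨monomial (a k) 1, ?_, rfl⟩
        intro m hm
        have := support_monomial_subset hm
        simp at this
        exact ⟨k, this.symm⟩
      | zero => exact ⟨0, by simp, by simp⟩
      | add x y _ _ hx hy =>
        obtain ⟨g1, h1, rfl⟩ := hx
        obtain ⟨g2, h2, rfl⟩ := hy
        classical
        refine ⟨g1 + g2, ?_, by simp⟩
        intro m hm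
        have := support_add hm
        rcases Finset.mem_union.mp this with h | h
        exacts [h1 h, h2 h]
      | smul c x _ hx =>
        obtain ⟨g1, h1, rfl⟩ := hx
        refine ⟨c • g1, ?_, by simp⟩
        exact fun m hm => h1 (support_smul hm)
    obtain ⟨g, hg, hg2⟩ := h2 _ h1
    refine ⟨g, hg, ?_⟩
    rw [← hπ0, map_sub, hg2, sub_self]
  · intro T p hT hs
    set ι := algebraMap (MvPolynomial (Fin N) ℂ) (p1_A N) with hι
    refine p2_LI N (fun i => ι (F i)) (p1_A N)
      (p1_F_regular hq hF) T (fun t => ι (monomial t 1)) ?_ p ?_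
    · intro lam hl
      have hmap : Ideal.ofList (List.ofFn fun i => ι (F i)) = I.map ι := by
        rw [Ideal.ofList, hI, Ideal.map_span]
        congr 1
        ext z
        simp [List.mem_ofFn]
      rw [hmap, smul_eq_mul, Ideal.mul_top] at hl
      have h3 : ∑ t ∈ T, algebraMap ℂ (p1_A N) (lam t) • ι (monomial t 1) =
          ι (∑ t ∈ T, lam t • monomial t 1) := by
        rw [map_sum]
        refine Finset.sum_congr rfl fun t _ => ?_
        rw [MvPolynomial.smul_eq_C_mul, map_mul, smul_eq_mul,
          IsScalarTower.algebraMap_apply ℂ (MvPolynomial (Fin N) ℂ) (p1_A N)]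
        rfl
      rw [h3] at hl
      have h4 := (hπ0 _).mpr (p2_descend hF _ hl)
      rw [map_sum] at h4
      simp only [map_smul] at h4
      have hli' := (linearIndepOn_range_iff ha (fun t : Fin N →₀ ℕ => π (monomial t 1))).mpr hli
      exact linearIndepOn_iff'.mp hli' T lam hT h4
    · have h5 := congrArg ι hs
      rw [map_sum, map_zero] at h5
      rw [← h5]
      refine Finset.sum_congr rfl fun t _ => ?_
      rw [map_mul, smul_eq_mul, mul_comm]
      congr 1
      exact (comp_aeval_apply (f := F) (IsScalarTower.toAlgHom ℂ (MvPolynomial (Fin N) ℂ) (p1_A N))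
        (p t)).symm
end Syz

end

section

section SyzLift

open Classical in
/-- Exponents in `B` allowed in degree `e`. -/
noncomputable def p2_T {N : ℕ} (B : Set (Fin N →₀ ℕ)) (q e : ℕ) : Finset (Fin N →₀ ℕ) :=
  (Finsupp.finite_of_degree_le (σ := Fin N) e).toFinset.filter
    (fun t => t ∈ B ∧ q ∣ e - t.degree)

lemma p2_mem_T {N : ℕ} (B : Set (Fin N →₀ ℕ)) (q e : ℕ) (t : Fin N →₀ ℕ) :
    t ∈ p2_T B q e ↔ t.degree ≤ e ∧ t ∈ B ∧ q ∣ e - t.degree := by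
  simp [p2_T]

/-- Normal form in degree `e`. -/
def p2_NF {N : ℕ} (F : Fin N → MvPolynomial (Fin N) ℂ) (B : Set (Fin N →₀ ℕ)) (q e : ℕ)
    (w : MvPolynomial (Fin N) ℂ) : Prop :=
  ∃ p : (Fin N →₀ ℕ) → MvPolynomial (Fin N) ℂ,
    (∀ t ∈ p2_T B q e, (p t).IsHomogeneous ((e - t.degree) / q)) ∧
    w = ∑ t ∈ p2_T B q e, monomial t 1 * aeval F (p t)

lemma p2_NF_zero {N : ℕ} (F : Fin N → MvPolynomial (Fin N) ℂ) (B : Set (Fin N →₀ ℕ)) (q e : ℕ) :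
    p2_NF F B q e 0 := ⟨fun _ => 0, fun _ _ => isHomogeneous_zero _ _ _, by simp⟩

lemma p2_NF_add {N : ℕ} {F : Fin N → MvPolynomial (Fin N) ℂ} {B : Set (Fin N →₀ ℕ)} {q e : ℕ}
    {w w' : MvPolynomial (Fin N) ℂ} (h : p2_NF F B q e w) (h' : p2_NF F B q e w') :
    p2_NF F B q e (w + w') := by
  obtain ⟨p, hp, rfl⟩ := h
  obtain ⟨p', hp', rfl⟩ := h'
  refine ⟨fun t => p t + p' t, fun t ht => (hp t ht).add (hp' t ht), ?_⟩
  rw [← Finset.sum_add_distrib]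
  refine Finset.sum_congr rfl fun t _ => ?_
  rw [map_add, mul_add]

lemma p2_NF_sum {N : ℕ} {F : Fin N → MvPolynomial (Fin N) ℂ} {B : Set (Fin N →₀ ℕ)} {q e : ℕ}
    {ι : Type*} (s : Finset ι) {w : ι → MvPolynomial (Fin N) ℂ}
    (h : ∀ i ∈ s, p2_NF F B q e (w i)) : p2_NF F B q e (∑ i ∈ s, w i) := by
  classical
  induction s using Finset.induction_on with
  | empty => simpa using p2_NF_zero F B q e
  | insert a s ha ih =>
    rw [Finset.sum_insert ha]
    exact p2_NF_add (h a (by simp)) (ih fun i hi => h i (by simp [hi]))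

lemma p2_NF_mulF {N : ℕ} {F : Fin N → MvPolynomial (Fin N) ℂ} {B : Set (Fin N →₀ ℕ)} {q e : ℕ}
    (hq : 0 < q) (hqe : q ≤ e) (i : Fin N)
    {w : MvPolynomial (Fin N) ℂ} (h : p2_NF F B q (e - q) w) :
    p2_NF F B q e (w * F i) := by
  obtain ⟨p, hp, rfl⟩ := h
  classical
  refine ⟨fun t => if t ∈ p2_T B q (e - q) then p t * X i else 0, ?_, ?_⟩
  · intro t _
    dsimp only
    split_ifs with h
    · have h1 := (hp t h).mul (isHomogeneous_X ℂ i)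
      have hm := (p2_mem_T _ _ _ _).mp h
      have : (e - q - t.degree) / q + 1 = (e - t.degree) / q := by
        rw [← Nat.add_div_right _ hq]
        congr 1; omega
      rwa [this] at h1
    · exact isHomogeneous_zero _ _ _
  · rw [Finset.sum_mul]
    have hsub : p2_T B q (e - q) ⊆ p2_T B q e := by
      intro t ht
      rw [p2_mem_T] at ht ⊢
      refine ⟨by omega, ht.2.1, ?_⟩
      have : e - t.degree = (e - q - t.degree) + q := by omega
      rw [this]
      exact dvd_add ht.2.2 dvd_rfl
    rw [← Finset.sum_subset hsub]
    · refine Finset.sum_congr rfl fun t ht => ?_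
      dsimp only
      rw [if_pos ht, map_mul, aeval_X, mul_assoc]
    · intro t _ ht
      dsimp only
      rw [if_neg ht, map_zero, mul_zero]

lemma p2_NF_B {N : ℕ} {F : Fin N → MvPolynomial (Fin N) ℂ} {B : Set (Fin N →₀ ℕ)} {q e : ℕ}
    {g : MvPolynomial (Fin N) ℂ} (hg : g.IsHomogeneous e) (hB : ↑g.support ⊆ B) :
    p2_NF F B q e g := by
  have hdeg : ∀ t, coeff t g ≠ 0 → t.degree = e := by
    intro t ht
    by_contra hne
    exact ht (hg.coeff_eq_zero hne)
  refine ⟨fun t => C (coeff t g), ?_, ?_⟩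
  · intro t _
    dsimp only
    by_cases h : coeff t g = 0
    · rw [h, C_0]; exact isHomogeneous_zero _ _ _
    · have := hdeg t h
      rw [this]; simpa using isHomogeneous_C (Fin N) (coeff t g)
  · conv_lhs => rw [g.as_sum]
    have hsub : g.support ⊆ p2_T B q e := by
      intro t ht
      rw [p2_mem_T]
      have := hdeg t (mem_support_iff.mp ht)
      refine ⟨this.le, hB ht, by simp [this]⟩
    rw [Finset.sum_subset hsub]
    · refine Finset.sum_congr rfl fun t ht => ?_
      rw [aeval_C, algebraMap_eq, mul_comm, C_mul_monomial, mul_one]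
    · intro t _ ht
      rw [notMem_support_iff.mp ht, monomial_zero]

lemma p2_NF_all {N q : ℕ} (hq : 0 < q) {F : Fin N → MvPolynomial (Fin N) ℂ} (hF : IsEndo N q F)
    (B : Set (Fin N →₀ ℕ)) (hB : ∀ u : MvPolynomial (Fin N) ℂ, ∃ g : MvPolynomial (Fin N) ℂ,
        (↑g.support ⊆ B) ∧ u - g ∈ Ideal.span (Set.range F))
    (e : ℕ) (u : MvPolynomial (Fin N) ℂ) (hu : u.IsHomogeneous e) : p2_NF F B q e u := by
  induction e using Nat.strong_induction_on generalizing u with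
  | _ e ih =>
    obtain ⟨g, hgB, hg⟩ := hB u
    obtain ⟨c, hc⟩ := (Ideal.mem_span_range_iff_exists_fun).mp hg
    have h1 := congrArg (homogeneousComponent e) hc
    rw [map_sum, map_sub, homogeneousComponent_eq_self hu] at h1
    have h2 : u = homogeneousComponent e g + ∑ i, homogeneousComponent e (c i * F i) := by
      rw [h1]; ring
    rw [h2]
    apply p2_NF_add
    · apply p2_NF_B (homogeneousComponent_isHomogeneous _ _)
      intro t ht
      apply hgB
      rw [Finset.mem_coe, mem_support_iff] at ht ⊢
      rw [coeff_homogeneousComponent] at ht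
      intro h0
      simp [h0] at ht
    · apply p2_NF_sum
      intro i _
      rw [p2_hc_mul _ _ (hF.1 i)]
      split_ifs with hqe
      · exact p2_NF_mulF hq hqe i (ih _ (by omega) _ (homogeneousComponent_isHomogeneous _ _))
      · exact p2_NF_zero _ _ _ _

theorem syz_lift {N q : ℕ} (hq : 0 < q) {F : Fin N → MvPolynomial (Fin N) ℂ} (hF : IsEndo N q F)
    {ι : Type*} [Fintype ι] (a w : ι → MvPolynomial (Fin N) ℂ) (e : ℕ)
    (hw : ∀ i, (w i).IsHomogeneous e) (hs : ∑ i, w i * aeval F (a i) = 0) :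
    ∃ (T : Finset (Fin N →₀ ℕ)) (u : (Fin N →₀ ℕ) → ι → MvPolynomial (Fin N) ℂ),
      (∀ t ∈ T, ∃ δ, q * δ + t.degree = e ∧ (∀ i, (u t i).IsHomogeneous δ) ∧
        ∑ i, u t i * a i = 0) ∧
      ∀ i, w i = ∑ t ∈ T, monomial t 1 * aeval F (u t i) := by
  obtain ⟨B, hB1, hB2⟩ := p2_basis hq hF
  choose p hp hp2 using fun i => p2_NF_all hq hF B hB1 e (w i) (hw i)
  have hz := hB2 (p2_T B q e) (fun t => ∑ i, p i t * a i)
    (fun t ht => ((p2_mem_T _ _ _ _).mp ht).2.1) (by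
      rw [← hs]
      simp only [map_sum, map_mul, Finset.mul_sum]
      rw [Finset.sum_comm]
      refine Finset.sum_congr rfl fun i _ => ?_
      conv_rhs => rw [hp2 i]
      rw [Finset.sum_mul]
      refine Finset.sum_congr rfl fun t _ => ?_
      ring)
  refine ⟨p2_T B q e, fun t i => p i t, ?_, hp2⟩
  intro t ht
  refine ⟨(e - t.degree) / q, ?_, fun i => hp i t ht, hz t ht⟩
  have := (p2_mem_T _ _ _ _).mp ht
  rw [Nat.mul_div_cancel' this.2.2]
  omega

end SyzLift

end

section

theorem p2_low {N q : ℕ} {F : Fin N → MvPolynomial (Fin N) ℂ} (hF : IsEndo N q F)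
    {ι : Type*} [Fintype ι] (a w : ι → MvPolynomial (Fin N) ℂ) (e : ℕ) (he : e < q)
    (hw : ∀ i, (w i).IsHomogeneous e) (hs : ∑ i, w i * aeval F (a i) = 0) :
    ∃ (T : Finset (Fin N →₀ ℕ)) (c : (Fin N →₀ ℕ) → ι → ℂ),
      (∀ t ∈ T, ∑ i, C (c t i) * a i = 0) ∧
      ∀ i, w i = ∑ t ∈ T, monomial t 1 * C (c t i) := by
  obtain ⟨T, u, h1, h2⟩ := syz_lift (by omega) hF a w e hw hs
  have h3 : ∀ t ∈ T, ∀ i, u t i = C (coeff 0 (u t i)) := by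
    intro t ht i
    obtain ⟨δ, hδ, hu, -⟩ := h1 t ht
    have : δ = 0 := by
      by_contra h
      have : q * 1 ≤ q * δ := Nat.mul_le_mul_left _ (by omega)
      omega
    subst this
    exact totalDegree_eq_zero_iff_eq_C.mp (Nat.le_zero.mp (hu i).totalDegree_le)
  refine ⟨T, fun t i => coeff 0 (u t i), ?_, ?_⟩
  · intro t ht
    obtain ⟨δ, hδ, hu, h4⟩ := h1 t ht
    rw [← h4]
    exact Finset.sum_congr rfl fun i _ => by rw [← h3 t ht i]
  · intro i
    rw [h2 i]
    refine Finset.sum_congr rfl fun t ht => ?_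
    conv_lhs => rw [h3 t ht i]
    simp

theorem p2_low_li {N q : ℕ} {F : Fin N → MvPolynomial (Fin N) ℂ} (hF : IsEndo N q F)
    {ι : Type*} [Fintype ι] (a w : ι → MvPolynomial (Fin N) ℂ) (e : ℕ) (he : e < q)
    (hw : ∀ i, (w i).IsHomogeneous e) (hs : ∑ i, w i * aeval F (a i) = 0)
    (ha : LinearIndependent ℂ a) : ∀ i, w i = 0 := by
  obtain ⟨T, c, h1, h2⟩ := p2_low hF a w e he hw hs
  intro i
  rw [h2 i]
  refine Finset.sum_eq_zero fun t ht => ?_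
  have := Fintype.linearIndependent_iff.mp ha (c t) (by
    rw [← h1 t ht]
    simp only [MvPolynomial.smul_eq_C_mul]) i
  simp [this]

theorem p2_inj {N q : ℕ} (hq : 0 < q) {F : Fin N → MvPolynomial (Fin N) ℂ} (hF : IsEndo N q F) :
    Function.Injective (aeval F : MvPolynomial (Fin N) ℂ →ₐ[ℂ] MvPolynomial (Fin N) ℂ) := by
  rw [injective_iff_map_eq_zero]
  intro p hp
  by_contra hne
  have := p2_low_li hF (fun _ : Unit => p) (fun _ => 1) 0 hq (fun _ => isHomogeneous_one _ _)
    (by simpa using hp) (by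
      rw [Fintype.linearIndependent_iff]
      intro g hg i
      simp only [Finset.univ_unique, Finset.sum_singleton, smul_eq_zero, hne, or_false] at hg
      exact hg) ()
  exact one_ne_zero this

end

section

theorem p3_dim_le {A : Type*} [CommRing A] {I : Ideal A} (k : ℕ)
    (H : ∀ l : LTSeries (PrimeSpectrum.zeroLocus (R := A) I), l.length ≤ k) :
    ringKrullDim (A ⧸ I) ≤ k := by
  rw [ringKrullDim_quotient]
  exact iSup_le fun l => by exact_mod_cast H l

theorem p3_step {A : Type*} [CommRing A] [Algebra ℂ A] [IsNoetherianRing A]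
    {ι : Type*} [Fintype ι] (g : ι → A) (J : Ideal A) (k : ℕ)
    (hJ : ringKrullDim (A ⧸ J) ≤ (k + 1 : ℕ))
    (hg : ringKrullDim (A ⧸ Ideal.span (Set.range g)) ≤ k) :
    ∃ c : ι → ℂ, ringKrullDim (A ⧸ (J ⊔ Ideal.span {∑ i, c i • g i})) ≤ k := by
  classical
  have hfin : J.minimalPrimes.Finite := Ideal.finite_minimalPrimes_of_isNoetherianRing A J
  let L : (ι → ℂ) →ₗ[ℂ] A := Fintype.linearCombination ℂ g
  let W : Ideal A → Submodule ℂ (ι → ℂ) := fun p => (p.restrictScalars ℂ).comap L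
  have hc : ∃ c : ι → ℂ, ∀ p ∈ J.minimalPrimes, c ∈ W p → Ideal.span (Set.range g) ≤ p := by
    by_contra hcon
    push Not at hcon
    let s : Finset (Submodule ℂ (ι → ℂ)) :=
      (hfin.toFinset.filter (fun p => ¬ Ideal.span (Set.range g) ≤ p)).image W
    have h1 : ⊤ ∈ s := by
      apply Subspace.top_mem_of_biUnion_eq_univ
      rw [Set.eq_univ_iff_forall]
      intro c
      obtain ⟨p, hp, hcp, hgp⟩ := hcon c
      simp only [Set.mem_iUnion]
      exact ⟨W p, Finset.mem_image_of_mem _ (by simp [hp, hgp]), hcp⟩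
    simp only [s, Finset.mem_image, Finset.mem_filter] at h1
    obtain ⟨p, ⟨-, hp⟩, hW⟩ := h1
    apply hp
    rw [Ideal.span_le]
    rintro _ ⟨i, rfl⟩
    have : (Pi.single i 1 : ι → ℂ) ∈ W p := by rw [hW]; trivial
    simpa [W, L] using this
  obtain ⟨c, hc⟩ := hc
  refine ⟨c, ?_⟩
  apply p3_dim_le
  intro l
  rw [ringKrullDim_quotient] at hJ hg
  have hl0 := (l.head).2
  have hmem : ∀ i, (J ⊔ Ideal.span {∑ i, c i • g i}) ≤ (l i).1.asIdeal := fun i => (l i).2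
  obtain ⟨p, hp, hpl⟩ := Ideal.exists_minimalPrimes_le (I := J) (J := l.head.1.asIdeal)
    (le_trans le_sup_left (hmem 0))
  by_cases hgp : Ideal.span (Set.range g) ≤ p
  · let f : ∀ i, PrimeSpectrum.zeroLocus (R := A) (Ideal.span (Set.range g)) := fun i : Fin (l.length + 1) =>
      ⟨(l i).1, (hgp.trans hpl).trans (l.monotone (Fin.zero_le i))⟩
    have := Order.LTSeries.length_le_krullDim (LTSeries.mk l.length f (fun a b hab => l.strictMono hab))
    have := this.trans hg
    exact_mod_cast this
  · have hcp : (∑ i, c i • g i) ∉ p := fun h => hgp (hc p hp (by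
      simpa [W, L, Fintype.linearCombination_apply] using h))
    have hpP : p.IsPrime := hp.1.1
    let f : LTSeries (PrimeSpectrum.zeroLocus (R := A) J) := LTSeries.mk l.length
      (fun i => ⟨(l i).1, le_trans le_sup_left (hmem i)⟩) (fun a b hab => l.strictMono hab)
    let f' := f.cons ⟨⟨p, hpP⟩, hp.1.2⟩ (by
      rw [Set.mem_ofPred_eq]; dsimp only
      refine lt_of_le_of_ne hpl ?_
      intro heq
      apply hcp
      have h2 : p = l.head.1.asIdeal := congrArg (fun z => z.1.asIdeal) heq
      rw [h2]
      exact hmem 0 (Ideal.mem_sup_right (Ideal.subset_span rfl)))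
    have := (Order.LTSeries.length_le_krullDim f').trans hJ
    have h3 : f'.length = l.length + 1 := by rw [RelSeries.cons_length]; rfl
    rw [h3] at this
    have : l.length + 1 ≤ k + 1 := by exact_mod_cast this
    omega

end

section

theorem p3_aeval_smul {N m : ℕ} {B : Type*} [CommRing B] [Algebra ℂ B]
    {p : MvPolynomial (Fin N) ℂ} (hp : p.IsHomogeneous m) (t : B) (y : Fin N → B) :
    aeval (fun i => t * y i) p = t ^ m * aeval y p := by
  rw [aeval_def, aeval_def, eval₂_eq', eval₂_eq', Finset.mul_sum]
  refine Finset.sum_congr rfl fun d hd => ?_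
  have h1 : d.degree = m := by
    have := hp (mem_support_iff.mp hd)
    rw [Finsupp.degree_eq_weight_one]; exact this
  rw [Finsupp.degree_eq_sum] at h1
  simp_rw [mul_pow]
  rw [Finset.prod_mul_distrib, Finset.prod_pow_eq_pow_sum, h1]
  ring

theorem p3_eval_smul {N m : ℕ} {p : MvPolynomial (Fin N) ℂ} (hp : p.IsHomogeneous m) (t : ℂ)
    (y : Fin N → ℂ) : eval (fun i => t * y i) p = t ^ m * eval y p := by
  have := p3_aeval_smul hp t y
  rwa [aeval_eq_eval, aeval_eq_eval] at this

theorem p3_dimS (N : ℕ) : ringKrullDim (MvPolynomial (Fin N) ℂ) = N := by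
  rw [MvPolynomial.ringKrullDim_of_isNoetherianRing]
  simp

theorem p3_iter {N : ℕ} (n : ℕ) (hN : N = n + 1) {ι : Type*} [Fintype ι]
    (g : ι → MvPolynomial (Fin N) ℂ)
    (hg : ringKrullDim (MvPolynomial (Fin N) ℂ ⧸ Ideal.span (Set.range g)) ≤ 1) (k : ℕ) :
    ∀ l, k + l = n → ∃ P : Fin k → ι → ℂ, ringKrullDim (MvPolynomial (Fin N) ℂ ⧸
      Ideal.span (Set.range fun j => ∑ i, P j i • g i)) ≤ (l + 1 : ℕ) := by
  induction k with
  | zero =>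
    intro l hl
    refine ⟨Fin.elim0, ?_⟩
    refine (ringKrullDim_quotient_le _).trans ?_
    rw [p3_dimS, hN]
    exact_mod_cast (by omega : n + 1 ≤ l + 1)
  | succ k ih =>
    intro l hl
    obtain ⟨P, hP⟩ := ih (l + 1) (by omega)
    obtain ⟨c, hc⟩ := p3_step g _ (l + 1) hP (hg.trans (by exact_mod_cast (by omega : 1 ≤ l + 1)))
    refine ⟨Fin.snoc P c, ?_⟩
    refine le_trans (p1_dim_le_of_le ?_) hc
    refine sup_le ?_ ?_
    · rw [Ideal.span_le]
      rintro _ ⟨j, rfl⟩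
      refine Ideal.subset_span ⟨j.castSucc, ?_⟩
      simp
    · rw [Ideal.span_le, Set.singleton_subset_iff]
      refine Ideal.subset_span ⟨Fin.last k, ?_⟩
      simp

/-- dimension zero plus homogeneous positive degree implies only the trivial zero -/
theorem p3_zero {N : ℕ} {ι : Type*} (G : ι → MvPolynomial (Fin N) ℂ) (m : ι → ℕ)
    (hG : ∀ i, (G i).IsHomogeneous (m i))
    (hd : ringKrullDim (MvPolynomial (Fin N) ℂ ⧸ Ideal.span (Set.range G)) ≤ 0)
    (x : Fin N → ℂ) (hx : ∀ i, eval x (G i) = 0) : x = 0 := by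
  by_contra hne
  obtain ⟨i0, hi0⟩ := Function.ne_iff.mp hne
  let f : MvPolynomial (Fin N) ℂ →ₐ[ℂ] Polynomial ℂ := aeval fun i => Polynomial.C (x i) * Polynomial.X
  have hf0 : ∀ p, p ∈ RingHom.ker f → eval x p = 0 := by
    intro p hp
    have h1 : (Polynomial.aeval (1:ℂ)).comp f = aeval x := by
      ext i; simp [f]
    have h2 : Polynomial.aeval (1:ℂ) (f p) = aeval x p := by rw [← h1]; rfl
    rw [RingHom.mem_ker.mp hp, map_zero] at h2
    rw [← coe_aeval_eq_eval]; exact h2.symm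
  have hfG : ∀ i, f (G i) = 0 := by
    intro i
    apply Polynomial.funext
    intro t
    have h1 : (Polynomial.aeval t).comp f = aeval (fun i => x i * t) := by
      ext i; simp [f]
    have h2 : Polynomial.aeval t (f (G i)) = aeval (fun i => x i * t) (G i) := by rw [← h1]; rfl
    rw [Polynomial.coe_aeval_eq_eval, MvPolynomial.aeval_eq_eval] at h2
    rw [h2]
    have h3 := p3_eval_smul (hG i) t x
    rw [hx i, mul_zero] at h3
    simp_rw [mul_comm t] at h3
    simpa using h3
  have hkp : (RingHom.ker f).IsPrime := RingHom.ker_isPrime _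
  have hep : (RingHom.ker (eval x)).IsPrime := RingHom.ker_isPrime _
  rw [ringKrullDim_quotient] at hd
  have : (1 : WithBot ℕ∞) ≤ Order.krullDim (PrimeSpectrum.zeroLocus
      (R := MvPolynomial (Fin N) ℂ) (Ideal.span (Set.range G))) := by
    rw [Order.one_le_krullDim_iff]
    refine ⟨⟨⟨_, hkp⟩, ?_⟩, ⟨⟨_, hep⟩, ?_⟩, ?_⟩
    · show Ideal.span _ ≤ _
      rw [Ideal.span_le]
      rintro _ ⟨i, rfl⟩
      exact hfG i
    · show Ideal.span _ ≤ _
      rw [Ideal.span_le]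
      rintro _ ⟨i, rfl⟩
      exact hx i
    · show RingHom.ker f < RingHom.ker (eval x)
      refine lt_of_le_of_ne (fun p hp => hf0 p hp) ?_
      intro heq
      have h1 : X i0 - C (x i0) ∈ RingHom.ker f := by
        rw [heq, RingHom.mem_ker]; simp
      rw [RingHom.mem_ker] at h1
      have h2 := congrArg (Polynomial.coeff · 0) h1
      simp [f, Polynomial.algebraMap_eq] at h2
      exact hi0 (by simpa using h2)
  exact absurd (this.trans hd) (by decide)

end

section

theorem p3_dimX (N : ℕ) : ringKrullDim (MvPolynomial (Fin N) ℂ ⧸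
    Ideal.span (Set.range (X : Fin N → MvPolynomial (Fin N) ℂ))) ≤ 0 := by
  rw [← p1_m0_eq N]
  have e := RingHom.quotientKerEquivOfSurjective
    (f := (constantCoeff : MvPolynomial (Fin N) ℂ →+* ℂ)) (fun c => ⟨C c, by simp⟩)
  have := ringKrullDim_eq_of_ringEquiv e
  rw [ringKrullDim_eq_zero_of_field] at this
  exact this.le

theorem p3_genpos {n m : ℕ} (hm : 0 < m) (a : Fin (n + 1) → MvPolynomial (Fin (n + 1)) ℂ)
    (ha : ∀ i, (a i).IsHomogeneous m)
    (hd : ringKrullDim (MvPolynomial (Fin (n + 1)) ℂ ⧸ Ideal.span (Set.range a)) ≤ 1) :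
    ∃ (P : Fin n → Fin (n + 1) → ℂ) (g0 : MvPolynomial (Fin (n + 1)) ℂ),
      IsEndo (n + 1) m (Fin.cons g0 fun j => ∑ i, C (P j i) * a i) := by
  obtain ⟨P, hP⟩ := p3_iter n rfl a hd n 0 rfl
  obtain ⟨c, hc⟩ := p3_step X _ 0 (by simpa using hP) (p3_dimX (n + 1))
  have ha' : ∀ j, (∑ i, C (P j i) * a i).IsHomogeneous m := fun j =>
    IsHomogeneous.sum _ _ _ fun i _ => by
      simpa using (isHomogeneous_C _ (P j i)).mul (ha i)
  have hl : (∑ i, C (c i) * X i : MvPolynomial (Fin (n + 1)) ℂ).IsHomogeneous 1 :=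
    IsHomogeneous.sum _ _ _ fun i _ => by
      simpa using (isHomogeneous_C _ (c i)).mul (isHomogeneous_X ℂ i)
  refine ⟨P, (∑ i, C (c i) * X i) ^ m, ?_, ?_⟩
  · intro i
    refine Fin.cases ?_ (fun j => ?_) i
    · simpa using hl.pow m
    · simpa using ha' j
  · intro x hx
    refine p3_zero (Fin.cons (∑ i, C (c i) * X i) fun j => ∑ i, C (P j i) * a i)
      (Fin.cons 1 fun _ => m) ?_ (le_trans (p1_dim_le_of_le ?_) hc) x ?_
    · intro i
      refine Fin.cases ?_ (fun j => ?_) i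
      · simpa using hl
      · simpa using ha' j
    · refine sup_le ?_ ?_
      · rw [Ideal.span_le]
        rintro _ ⟨j, rfl⟩
        exact Ideal.subset_span ⟨j.succ, by simp [MvPolynomial.smul_eq_C_mul]⟩
      · rw [Ideal.span_le, Set.singleton_subset_iff]
        exact Ideal.subset_span ⟨0, by simp [MvPolynomial.smul_eq_C_mul]⟩
    · intro i
      refine Fin.cases ?_ (fun j => ?_) i
      · have := hx 0
        rw [Fin.cons_zero, map_pow] at this
        exact pow_eq_zero_iff hm.ne' |>.mp this
      · simpa using hx j.succ

end

section

theorem p3_lin_repr {N : ℕ} {p : MvPolynomial (Fin N) ℂ} (hp : p.IsHomogeneous 1) :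
    p = ∑ k, C (coeff (Finsupp.single k 1) p) * X k := by
  classical
  ext d
  simp only [coeff_sum, coeff_C_mul, coeff_X]
  by_cases hd : d.degree = 1
  · obtain ⟨k, rfl⟩ : ∃ k, d = Finsupp.single k 1 := by
      have hne : d ≠ 0 := by rintro rfl; simp at hd
      obtain ⟨k, hk⟩ := Finsupp.ne_iff.mp hne
      refine ⟨k, ?_⟩
      rw [Finsupp.degree_eq_sum] at hd
      ext j
      rw [Finsupp.single_apply]
      have hk' : d k ≠ 0 := hk
      rw [← Finset.add_sum_erase _ _ (Finset.mem_univ k)] at hd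
      split_ifs with hj
      · subst hj; omega
      · have := Finset.single_le_sum (f := fun i => d i) (fun i _ => Nat.zero_le _)
          (Finset.mem_erase.mpr ⟨Ne.symm hj, Finset.mem_univ j⟩)
        omega
    rw [Finset.sum_eq_single k]
    · simp
    · intro b _ hb
      rw [if_neg, mul_zero]
      intro h
      exact hb ((Finsupp.single_left_inj one_ne_zero).mp h)
    · simp
  · rw [hp.coeff_eq_zero hd, Finset.sum_eq_zero]
    intro k _
    rw [if_neg, mul_zero]
    rintro rfl
    simp at hd

theorem p3_skew {N : ℕ} (M : Fin N → Fin N → ℂ) (h : ∀ x : Fin N → ℂ, ∑ k, ∑ l, M k l * x k * x l = 0)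
    (i j : Fin N) : M i j + M j i = 0 := by
  have h1 := h (Pi.single i 1 + Pi.single j 1)
  have h2 := h (Pi.single i 1)
  have h3 := h (Pi.single j 1)
  simp only [Pi.add_apply, mul_add, Finset.sum_add_distrib, Pi.single_apply, mul_ite,
    mul_one, mul_zero, Finset.sum_ite_eq', Finset.mem_univ, if_true] at h1 h2 h3
  linear_combination h1 - h2 - h3

theorem p3_X_li (N : ℕ) : LinearIndependent ℂ (X : Fin N → MvPolynomial (Fin N) ℂ) := by
  rw [Fintype.linearIndependent_iff]
  intro g hg i
  have := congrArg (eval (Pi.single i 1)) hg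
  simpa [Pi.single_apply, MvPolynomial.smul_eq_C_mul] using this

theorem p3_S1 {n m : ℕ} {g0 : MvPolynomial (Fin (n + 1)) ℂ}
    {a : Fin n → MvPolynomial (Fin (n + 1)) ℂ}
    (hG : IsEndo (n + 1) m (Fin.cons g0 a)) (w : Fin n → MvPolynomial (Fin (n + 1)) ℂ)
    (e : ℕ) (he : e < m) (hw : ∀ i, (w i).IsHomogeneous e) (hs : ∑ i, w i * a i = 0) :
    ∀ i, w i = 0 := by
  refine p2_low_li hG (fun j : Fin n => X j.succ) w e he hw ?_
    ((p3_X_li (n + 1)).comp _ (Fin.succ_injective n))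
  simpa using hs

theorem p3_S2 {n m : ℕ} (hm : 0 < m) {g0 : MvPolynomial (Fin (n + 1)) ℂ}
    {a : Fin n → MvPolynomial (Fin (n + 1)) ℂ}
    (hG : IsEndo (n + 1) m (Fin.cons g0 a)) (w : Fin n → MvPolynomial (Fin (n + 1)) ℂ)
    (hw : ∀ i, (w i).IsHomogeneous m) (hs : ∑ i, w i * a i = 0) :
    ∃ c : Fin n → Fin n → ℂ, (∀ i j, c i j + c j i = 0) ∧ ∀ i, w i = ∑ s, C (c i s) * a s := by
  obtain ⟨T, u, h1, h2⟩ := syz_lift hm hG (fun j : Fin n => X j.succ) w m hw (by simpa using hs)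
  have key : ∀ t ∈ T, ∃ c : Fin n → Fin n → ℂ, (∀ i j, c i j + c j i = 0) ∧
      ∀ i, monomial t (1:ℂ) * aeval (Fin.cons g0 a : Fin (n + 1) → MvPolynomial (Fin (n + 1)) ℂ)
        (u t i) = ∑ s, C (c i s) * a s := by
    intro t ht
    obtain ⟨δ, hδ, hu, hsum⟩ := h1 t ht
    rcases Nat.lt_or_ge 1 δ with hd | hd
    · have : m * 2 ≤ m * δ := Nat.mul_le_mul_left _ hd
      omega
    interval_cases δ
    · refine ⟨0, by simp, fun i => ?_⟩
      have hc : ∀ i, u t i = C (coeff 0 (u t i)) := fun i =>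
        totalDegree_eq_zero_iff_eq_C.mp (Nat.le_zero.mp (hu i).totalDegree_le)
      have := Fintype.linearIndependent_iff.mp
        ((p3_X_li (n + 1)).comp _ (Fin.succ_injective n)) (fun i => coeff 0 (u t i)) (by
          rw [← hsum]
          refine Finset.sum_congr rfl fun i _ => ?_
          rw [MvPolynomial.smul_eq_C_mul, ← hc i]; rfl) i
      rw [hc i, this]
      simp
    · have ht0 : t = 0 := by
        rw [← Finsupp.degree_eq_zero_iff]; omega
      let c : Fin n → Fin (n + 1) → ℂ := fun i k => coeff (Finsupp.single k 1) (u t i)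
      have hc : ∀ i, u t i = ∑ k, C (c i k) * X k := fun i => p3_lin_repr (hu i)
      have hM := p3_skew (Fin.cons 0 c : Fin (n + 1) → Fin (n + 1) → ℂ) (by
        intro x
        have h4 := congrArg (eval x) hsum
        rw [Fin.sum_univ_succ]
        simp only [hc] at h4
        simp only [map_sum, map_mul, eval_C, eval_X, map_zero, Finset.sum_mul] at h4
        simp only [Fin.cons_zero, Fin.cons_succ, Pi.zero_apply, zero_mul, Finset.sum_const_zero,
          zero_add]
        rw [← h4]
        refine Finset.sum_congr rfl fun i _ => Finset.sum_congr rfl fun k _ => ?_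
        ring)
      refine ⟨fun i s => c i s.succ, fun i j => by simpa using hM i.succ j.succ, fun i => ?_⟩
      rw [hc i, Fin.sum_univ_succ]
      have := hM i.succ 0
      simp only [Fin.cons_zero, Fin.cons_succ, Pi.zero_apply, add_zero] at this
      rw [this]
      simp [ht0, ← C_apply]
  choose! c hc1 hc2 using key
  refine ⟨fun i s => ∑ t ∈ T, c t i s, ?_, ?_⟩
  · intro i j
    dsimp only
    rw [← Finset.sum_add_distrib]
    exact Finset.sum_eq_zero fun t ht => hc1 t ht i j
  · intro i
    rw [h2 i, Finset.sum_congr rfl fun t ht => hc2 t ht i, Finset.sum_comm]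
    refine Finset.sum_congr rfl fun s _ => ?_
    rw [← Finset.sum_mul, map_sum]

end

section

theorem p4_chain {N : ℕ} (F : Fin N → MvPolynomial (Fin N) ℂ)
    (D : Derivation ℂ (MvPolynomial (Fin N) ℂ) (MvPolynomial (Fin N) ℂ))
    (p : MvPolynomial (Fin N) ℂ) :
    D (aeval F p) = ∑ i, aeval F (pderiv i p) * D (F i) := by
  classical
  induction p using MvPolynomial.induction_on with
  | C c => simp
  | add p q hp hq => simp only [map_add, hp, hq, add_mul, Finset.sum_add_distrib]
  | mul_X p k hp =>
    simp only [map_mul, aeval_X, Derivation.leibniz, hp, smul_eq_mul, map_add, add_mul,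
      Finset.sum_add_distrib, pderiv_X]
    congr 1
    · rw [Finset.sum_eq_single k]
      · simp
      · intro b _ hb; simp [Ne.symm hb]
      · simp
    · rw [Finset.mul_sum]
      exact Finset.sum_congr rfl fun i _ => by ring

theorem p4_der_aux {S : Type*} [CommRing S] [Algebra ℂ S] (D : Derivation ℂ S S)
    (A : Subalgebra ℂ S) (hA : ∀ a ∈ A, D a = 0) (x : S) (p : Polynomial A) :
    D (Polynomial.aeval x p) = Polynomial.aeval x (Polynomial.derivative p) * D x := by
  induction p using Polynomial.induction_on' with
  | add p q hp hq => simp only [map_add, hp, hq, add_mul]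
  | monomial n a =>
    rw [Polynomial.derivative_monomial, Polynomial.aeval_monomial, Polynomial.aeval_monomial]
    simp only [Derivation.leibniz, Derivation.leibniz_pow, smul_eq_mul, map_mul, map_natCast,
      nsmul_eq_mul]
    have : D (algebraMap A S a) = 0 := hA _ a.2
    rw [this]; ring

theorem p4_der_zero {N q : ℕ} (hq : 0 < q) {F : Fin N → MvPolynomial (Fin N) ℂ}
    (hF : IsEndo N q F)
    (D : Derivation ℂ (MvPolynomial (Fin N) ℂ) (MvPolynomial (Fin N) ℂ))
    (hD : ∀ i, D (F i) = 0) (x : MvPolynomial (Fin N) ℂ) : D x = 0 := by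
  have hai : AlgebraicIndependent ℂ F := p2_inj hq hF
  have htb : IsTranscendenceBasis ℂ F := by
    apply hai.isTranscendenceBasis_of_trdeg_le
    · rw [MvPolynomial.trdeg_of_isDomain]
      simp
    · simp
  have halg := htb.isAlgebraic
  set A := Algebra.adjoin ℂ (Set.range F)
  have hA : ∀ a ∈ A, D a = 0 := by
    intro a ha
    induction ha using Algebra.adjoin_induction with
    | mem y hy => obtain ⟨i, rfl⟩ := hy; exact hD i
    | algebraMap r => simp
    | add y z _ _ hy hz => simp [hy, hz]
    | mul y z _ _ hy hz => simp [hy, hz]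
  have hex : ∃ k, ∃ p : Polynomial A, p ≠ 0 ∧ Polynomial.aeval x p = 0 ∧ p.natDegree = k := by
    obtain ⟨p, hp, hp0⟩ := halg.isAlgebraic x
    exact ⟨_, p, hp, hp0, rfl⟩
  classical
  obtain ⟨p, hp, hp0, hk⟩ := Nat.find_spec hex
  have hmin := fun j (hj : j < Nat.find hex) => Nat.find_min hex hj
  have h1 := p4_der_aux D A hA x p
  rw [hp0, map_zero] at h1
  rcases mul_eq_zero.mp h1.symm with h2 | h2
  · exfalso
    by_cases hdeg : p.natDegree = 0
    · rw [Polynomial.eq_C_of_natDegree_eq_zero hdeg] at hp0 hp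
      simp at hp0 hp
      exact hp hp0
    · refine hmin (Polynomial.derivative p).natDegree ?_ ⟨_, ?_, h2, rfl⟩
      · rw [← hk]; exact Polynomial.natDegree_derivative_lt hdeg
      · intro h0
        exact hdeg (Polynomial.derivative_eq_zero.mp h0)
  · exact h2

theorem p4_mk {N : ℕ} (v : Fin N → MvPolynomial (Fin N) ℂ) (p : MvPolynomial (Fin N) ℂ) :
    mkDerivation ℂ v p = ∑ j, pderiv j p * v j := by
  have := p4_chain X (mkDerivation ℂ v) p
  simpa [aeval_X_left] using this

end

section

/-- homogeneous syzygy of degree `δ` -/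
def p4_K {N : ℕ} (a : Fin N → MvPolynomial (Fin N) ℂ) (δ : ℕ)
    (v : Fin N → MvPolynomial (Fin N) ℂ) : Prop :=
  (∀ i, (v i).IsHomogeneous δ) ∧ ∑ i, v i * a i = 0

def p4_R {N : ℕ} (a : Fin N → MvPolynomial (Fin N) ℂ) (r s : ℕ) : Prop :=
  ∃ v : Fin s → Fin N → MvPolynomial (Fin N) ℂ,
    LinearIndependent (MvPolynomial (Fin N) ℂ) v ∧ ∀ k, ∃ δ ≤ r, p4_K a δ (v k)

theorem p4_R_mono {N : ℕ} {a : Fin N → MvPolynomial (Fin N) ℂ} {r s : ℕ}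
    {U : Set (Fin N → MvPolynomial (Fin N) ℂ)}
    (φ : MvPolynomial (Fin N) ℂ →ₐ[ℂ] MvPolynomial (Fin N) ℂ) (hφ : Function.Injective φ)
    (w : Fin s → Fin N → MvPolynomial (Fin N) ℂ)
    (hw : LinearIndependent (MvPolynomial (Fin N) ℂ) w)
    (hU : ∀ u ∈ U, ∃ δ ≤ r, p4_K a δ u)
    (hwU : ∀ k, w k ∈ Submodule.span (MvPolynomial (Fin N) ℂ) ((fun u i => φ (u i)) '' U)) :
    p4_R a r s := by
  classical
  let S := MvPolynomial (Fin N) ℂ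
  let L := FractionRing S
  let ι : (Fin N → S) →ₗ[S] (Fin N → L) := (Algebra.linearMap S L).compLeft (Fin N)
  have hι : Function.Injective ι := by
    intro x y h
    ext1 i
    exact IsFractionRing.injective S L (congrFun h i)
  let Φ : L →+* L := IsLocalization.map (M := nonZeroDivisors S) (T := nonZeroDivisors S) L
    φ.toRingHom (nonZeroDivisors_le_comap_nonZeroDivisors_of_injective _ hφ)
  have hΦ : ∀ x : S, Φ (algebraMap S L x) = algebraMap S L (φ x) := fun x =>
    IsLocalization.map_eq _ x
  obtain ⟨κ, b, hb, hspan, hli⟩ := exists_linearIndependent' L (fun u : U => ι u.1)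
  have : Finite κ := hli.finite
  have := Fintype.ofFinite κ
  have hwL : LinearIndependent L (fun k => ι (w k)) := by
    rw [← LinearIndependent.iff_fractionRing S L]
    exact hw.map' ι (LinearMap.ker_eq_bot.mpr hι)
  let b' : κ → Fin N → L := fun k => ι (fun i => φ ((b k).1 i))
  have hU' : ∀ u ∈ U, ι (fun i => φ (u i)) ∈ Submodule.span L (Set.range b') := by
    intro u hu
    have h1 : ι u ∈ Submodule.span L (Set.range ((fun u : U => ι u.1) ∘ b)) := by
      rw [hspan]; exact Submodule.subset_span ⟨⟨u, hu⟩, rfl⟩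
    obtain ⟨l, hl⟩ := (Submodule.mem_span_range_iff_exists_fun L).mp h1
    rw [Submodule.mem_span_range_iff_exists_fun]
    refine ⟨fun k => Φ (l k), ?_⟩
    ext1 i
    have h2 := congrArg Φ (congrFun hl i)
    simp only [Finset.sum_apply, Pi.smul_apply, smul_eq_mul, map_sum, map_mul] at h2 ⊢
    have h3 : ∀ (u : Fin N → S), Φ (ι u i) = ι (fun i => φ (u i)) i := fun u => hΦ (u i)
    rw [h3] at h2
    rw [← h2]
    refine Finset.sum_congr rfl fun k _ => ?_
    congr 1
    exact (h3 _).symm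
  have hle : Set.range (fun k => ι (w k)) ≤ Submodule.span L (Set.range b') := by
    rintro _ ⟨k, rfl⟩
    have h1 := hwU k
    show ι (w k) ∈ _
    generalize w k = z at h1
    induction h1 using Submodule.span_induction with
    | mem x hx => obtain ⟨u, hu, rfl⟩ := hx; exact hU' u hu
    | zero => rw [map_zero]; exact Submodule.zero_mem _
    | add x y _ _ hx hy => rw [map_add]; exact Submodule.add_mem _ hx hy
    | smul c x _ hx =>
      rw [map_smul, ← algebraMap_smul L]; exact Submodule.smul_mem _ _ hx
  have hcard := linearIndependent_le_span_aux' _ hwL (Set.range b') hle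
  have hcard2 : s ≤ Fintype.card κ := by
    rw [Fintype.card_fin] at hcard
    exact hcard.trans (Fintype.card_range_le b')
  obtain ⟨f⟩ : Nonempty (Fin s ↪ κ) := Function.Embedding.nonempty_of_card_le (by simpa using hcard2)
  refine ⟨fun k => (b (f k)).1, ?_, fun k => hU _ (b (f k)).2⟩
  have h5 := hli.comp f f.injective
  rw [← LinearIndependent.iff_fractionRing S L] at h5
  exact LinearIndependent.of_comp ι h5

theorem p4_DF {N q d : ℕ} {F : Fin N → MvPolynomial (Fin N) ℂ} (hF : IsEndo N q F)
    {h : MvPolynomial (Fin N) ℂ} {lam : ℂ} (hinv : aeval F h = C lam * h ^ q)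
    {v : Fin N → MvPolynomial (Fin N) ℂ} (hv : p4_K (fun i => pderiv i h) d v) :
    (∀ i, (mkDerivation ℂ v (F i)).IsHomogeneous (q - 1 + d)) ∧
      ∑ i, mkDerivation ℂ v (F i) * aeval F (pderiv i h) = 0 := by
  constructor
  · intro i
    rw [p4_mk]
    exact IsHomogeneous.sum _ _ _ fun j _ => (hF.1 i).pderiv.mul (hv.1 j)
  · have h1 := p4_chain F (mkDerivation ℂ v) h
    have h0 : mkDerivation ℂ v h = 0 := by
      rw [p4_mk, ← hv.2]
      exact Finset.sum_congr rfl fun _ _ => mul_comm _ _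
    rw [hinv] at h1
    rw [Derivation.leibniz, Derivation.leibniz_pow, h0] at h1
    simp only [smul_zero, derivation_C, add_zero] at h1
    rw [h1]
    exact Finset.sum_congr rfl fun _ _ => mul_comm _ _

theorem p4_step {N q : ℕ} (hq : 2 ≤ q) {F : Fin N → MvPolynomial (Fin N) ℂ} (hF : IsEndo N q F)
    {h : MvPolynomial (Fin N) ℂ} {lam : ℂ} (hinv : aeval F h = C lam * h ^ q) (r s : ℕ)
    (hr : 1 ≤ r) (hR : p4_R (fun i => pderiv i h) (r + 1) s) :
    p4_R (fun i => pderiv i h) r s := by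
  obtain ⟨v, hv, hK⟩ := hR
  refine p4_R_mono (U := {u | ∃ δ ≤ r, p4_K (fun i => pderiv i h) δ u}) (aeval F)
    (p2_inj (by omega) hF) (fun k i => mkDerivation ℂ (v k) (F i)) ?_ (fun u hu => hu) ?_
  · rw [Fintype.linearIndependent_iff] at hv ⊢
    intro g hg
    apply hv
    have h0 := p4_der_zero (by omega) hF (mkDerivation ℂ (∑ i, g i • v i)) (by
      intro i
      have := congrFun hg i
      rw [p4_mk]
      simp only [p4_mk, Finset.sum_apply, Pi.smul_apply, Pi.zero_apply, smul_eq_mul] at this ⊢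
      rw [← this]
      simp only [Finset.mul_sum]
      rw [Finset.sum_comm]
      exact Finset.sum_congr rfl fun _ _ => Finset.sum_congr rfl fun _ _ => by ring)
    ext1 i
    have := h0 (X i)
    rwa [mkDerivation_X] at this
  · intro k
    obtain ⟨δ, hδ, hk⟩ := hK k
    obtain ⟨h1, h2⟩ := p4_DF hF hinv hk
    obtain ⟨T, u, h3, h4⟩ := syz_lift (by omega) hF _ _ _ h1 h2
    have : (fun i => mkDerivation ℂ (v k) (F i)) =
        ∑ t ∈ T, (monomial t (1:ℂ)) • (fun i => aeval F (u t i)) := by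
      ext1 i
      rw [h4 i]
      simp
    rw [this]
    refine Submodule.sum_mem _ fun t ht => Submodule.smul_mem _ _ (Submodule.subset_span ?_)
    obtain ⟨δ', h5, h6, h7⟩ := h3 t ht
    refine ⟨u t, ⟨δ', ?_, h6, h7⟩, rfl⟩
    by_contra hlt
    have : q * (r + 1) ≤ q * δ' := Nat.mul_le_mul_left _ (by omega)
    have h8 : 2 * r ≤ q * r := Nat.mul_le_mul_right _ hq
    have h9 : q * (r + 1) = q * r + q := by ring
    omega

theorem p4_koszul {n m : ℕ} {a : Fin (n + 1) → MvPolynomial (Fin (n + 1)) ℂ}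
    (ha : ∀ i, (a i).IsHomogeneous m) (hne : ∃ i, a i ≠ 0) : p4_R a m n := by
  classical
  obtain ⟨i0, hi0⟩ := hne
  refine ⟨fun k => Pi.single (i0.succAbove k) (a i0) - Pi.single i0 (a (i0.succAbove k)), ?_, ?_⟩
  · rw [Fintype.linearIndependent_iff]
    intro g hg k
    have h1 := congrFun hg (i0.succAbove k)
    simp only [Finset.sum_apply, Pi.smul_apply, Pi.sub_apply, smul_eq_mul, Pi.zero_apply,
      Pi.single_apply, Fin.succAbove_ne, if_false, sub_zero, Fin.succAbove_right_inj, mul_ite,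
      mul_zero, Finset.sum_ite_eq, Finset.mem_univ, if_true] at h1
    exact (mul_eq_zero.mp h1).resolve_right hi0
  · intro k
    refine ⟨m, le_rfl, ?_, ?_⟩
    · intro i
      dsimp only
      rw [Pi.sub_apply, Pi.single_apply, Pi.single_apply]
      apply IsHomogeneous.sub
      · split_ifs; exacts [ha _, isHomogeneous_zero _ _ _]
      · split_ifs; exacts [ha _, isHomogeneous_zero _ _ _]
    · simp only [Pi.sub_apply, sub_mul, Finset.sum_sub_distrib, Pi.single_apply, ite_mul, zero_mul,
        Finset.sum_ite_eq', Finset.mem_univ, if_true]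
      ring

theorem p4_main {n q m : ℕ} (hm : 1 ≤ m) (hq : 2 ≤ q)
    {F : Fin (n + 1) → MvPolynomial (Fin (n + 1)) ℂ} (hF : IsEndo (n + 1) q F)
    {h : MvPolynomial (Fin (n + 1)) ℂ} {lam : ℂ} (hinv : aeval F h = C lam * h ^ q)
    (ha : ∀ i, (pderiv i h).IsHomogeneous m) (hne : ∃ i, pderiv i h ≠ 0) :
    p4_R (fun i => pderiv i h) 1 n := by
  have key : ∀ k r, r + k = m → 1 ≤ r → p4_R (fun i => pderiv i h) r n := by
    intro k
    induction k with
    | zero => intro r hr _; obtain rfl : r = m := by omega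
              exact p4_koszul ha hne
    | succ k ih => intro r hr h1; exact p4_step hq hF hinv r n h1 (ih (r + 1) (by omega) (by omega))
  exact key (m - 1) 1 (by omega) le_rfl

end

section

noncomputable def p5_sub {N : ℕ} (M : Matrix (Fin N) (Fin N) ℂ) :
    MvPolynomial (Fin N) ℂ →ₐ[ℂ] MvPolynomial (Fin N) ℂ :=
  aeval fun i => ∑ j, C (M i j) * X j

theorem p5_sub_X {N : ℕ} (M : Matrix (Fin N) (Fin N) ℂ) (i : Fin N) :
    p5_sub M (X i) = ∑ j, C (M i j) * X j := by simp [p5_sub]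

theorem p5_sub_comp {N : ℕ} (M M' : Matrix (Fin N) (Fin N) ℂ) (h : M' * M = 1)
    (p : MvPolynomial (Fin N) ℂ) : p5_sub M (p5_sub M' p) = p := by
  have : (p5_sub M).comp (p5_sub M') = AlgHom.id ℂ _ := by
    ext1 i
    simp only [AlgHom.comp_apply, p5_sub_X, map_sum, map_mul, AlgHom.id_apply]
    simp only [algHom_C, algebraMap_eq, Finset.mul_sum]
    rw [Finset.sum_comm]
    have h2 : ∀ k, ∑ j, C (M' i j) * (C (M j k) * X k) =
        C ((1 : Matrix (Fin N) (Fin N) ℂ) i k) * (X k : MvPolynomial (Fin N) ℂ) := by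
      intro k
      rw [← h, Matrix.mul_apply, map_sum, Finset.sum_mul]
      exact Finset.sum_congr rfl fun _ _ => by rw [map_mul]; ring
    simp [h2, Matrix.one_apply]
  exact DFunLike.congr_fun this p

theorem p5_lin_hom {N e : ℕ} (c : Fin N → ℂ) (f : Fin N → MvPolynomial (Fin N) ℂ)
    (hf : ∀ i, (f i).IsHomogeneous e) : (∑ i, C (c i) * f i).IsHomogeneous e :=
  IsHomogeneous.sum _ _ _ fun i _ => by
    simpa using (isHomogeneous_C _ (c i)).mul (hf i)

theorem p5_sub_hom {N e : ℕ} (M : Matrix (Fin N) (Fin N) ℂ) {p : MvPolynomial (Fin N) ℂ}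
    (hp : p.IsHomogeneous e) : (p5_sub M p).IsHomogeneous e := by
  have := hp.aeval (fun i => ∑ j, C (M i j) * X j : Fin N → MvPolynomial (Fin N) ℂ) (n := 1)
    (fun i => p5_lin_hom _ _ fun j => isHomogeneous_X _ _)
  simpa [p5_sub] using this

theorem p5_sub_eval {N : ℕ} (M : Matrix (Fin N) (Fin N) ℂ) (p : MvPolynomial (Fin N) ℂ)
    (x : Fin N → ℂ) : eval x (p5_sub M p) = eval (M.mulVec x) p := by
  have : (aeval x).comp (p5_sub M) = (aeval (M.mulVec x) : MvPolynomial (Fin N) ℂ →ₐ[ℂ] ℂ) := by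
    ext1 i
    simp [p5_sub, Matrix.mulVec, dotProduct]
  have := DFunLike.congr_fun this p
  simpa [aeval_eq_eval] using this

theorem p5_sub_pderiv {N : ℕ} (M : Matrix (Fin N) (Fin N) ℂ) (p : MvPolynomial (Fin N) ℂ)
    (j : Fin N) : pderiv j (p5_sub M p) = p5_sub M (∑ i, C (M i j) * pderiv i p) := by
  unfold p5_sub
  rw [p4_chain, map_sum]
  refine Finset.sum_congr rfl fun i _ => ?_
  rw [map_mul, mul_comm]
  congr 1
  simp [pderiv_X, Pi.single_apply, algebraMap_eq]

theorem p5_complete {n : ℕ} (P : Fin n → Fin (n + 1) → ℂ) (hP : LinearIndependent ℂ P) :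
    ∃ M M' : Matrix (Fin (n + 1)) (Fin (n + 1)) ℂ, M * M' = 1 ∧ M' * M = 1 ∧
      ∀ j i, M i j.succ = P j i := by
  have h1 : ∃ v, v ∉ Submodule.span ℂ (Set.range P) := by
    by_contra hcon
    push Not at hcon
    have h2 : Submodule.span ℂ (Set.range P) = ⊤ := by
      rw [eq_top_iff]; exact fun v _ => hcon v
    have h3 := finrank_span_eq_card hP
    rw [h2, finrank_top] at h3
    simp at h3
  obtain ⟨v, hv⟩ := h1
  have h2 : LinearIndependent ℂ (Fin.cons v P : Fin (n + 1) → Fin (n + 1) → ℂ) :=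
    linearIndependent_finCons.mpr ⟨hP, hv⟩
  let A : Matrix (Fin (n + 1)) (Fin (n + 1)) ℂ := Matrix.of (Fin.cons v P)
  have h3 : IsUnit A := Matrix.linearIndependent_rows_iff_isUnit.mp h2
  obtain ⟨B, hAB, hBA⟩ := isUnit_iff_exists.mp h3
  refine ⟨A.transpose, B.transpose, ?_, ?_, ?_⟩
  · rw [← Matrix.transpose_mul, hBA, Matrix.transpose_one]
  · rw [← Matrix.transpose_mul, hAB, Matrix.transpose_one]
  · intro j i
    simp [A, Matrix.transpose_apply]

theorem p5_wlog {n d : ℕ} (hd : 2 ≤ d)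
    (h : MvPolynomial (Fin (n + 1)) ℂ) (hirr : Irreducible h) (hhom : h.IsHomogeneous d)
    (hdim : ringKrullDim (MvPolynomial (Fin (n + 1)) ℂ ⧸ jacobianIdeal (n + 1) h) ≤ 1)
    (hinv : IsTotallyInvariant (n + 1) h) :
    ∃ (h : MvPolynomial (Fin (n + 1)) ℂ) (q : ℕ) (F : Fin (n + 1) → MvPolynomial (Fin (n + 1)) ℂ)
      (lam : ℂ) (g0 : MvPolynomial (Fin (n + 1)) ℂ), Irreducible h ∧ h.IsHomogeneous d ∧
      2 ≤ q ∧ IsEndo (n + 1) q F ∧ lam ≠ 0 ∧ aeval F h = C lam * h ^ q ∧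
      IsEndo (n + 1) (d - 1) (Fin.cons g0 fun j => pderiv j.succ h) := by
  obtain ⟨q, hq, F, hF, lam, hlam, hFh⟩ := hinv
  have hle : jacobianIdeal (n + 1) h ≤ Ideal.span (Set.range fun i => pderiv i h) := by
    unfold jacobianIdeal
    rw [Ideal.span_le]
    intro y hy
    rcases hy with rfl | hy
    · have hE := hhom.sum_X_mul_pderiv
      have h1 : C ((d : ℂ)⁻¹) * (∑ i, X i * pderiv i y) = y := by
        rw [hE, nsmul_eq_mul, ← mul_assoc, ← map_natCast (C : ℂ →+* MvPolynomial (Fin (n + 1)) ℂ),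
          ← map_mul, inv_mul_cancel₀ (by norm_cast; omega), map_one, one_mul]
      rw [SetLike.mem_coe, ← h1]
      refine Ideal.mul_mem_left _ _ (Ideal.sum_mem _ fun i _ => Ideal.mul_mem_left _ _ ?_)
      exact Ideal.subset_span ⟨i, by rw [h1]⟩
    · exact Ideal.subset_span hy
  obtain ⟨P, g0, hG⟩ := p3_genpos (m := d - 1) (by omega) (fun i => pderiv i h)
    (fun i => hhom.pderiv) ((p1_dim_le_of_le hle).trans hdim)
  have hP : LinearIndependent ℂ P := by
    rw [Fintype.linearIndependent_iff]
    intro c hc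
    have := p3_S1 hG (fun j => C (c j)) 0 (by omega) (fun j => isHomogeneous_C _ _) (by
      simp only [Finset.mul_sum]
      rw [Finset.sum_comm]
      refine Finset.sum_eq_zero fun i _ => ?_
      have h2 := congrFun hc i
      simp only [Finset.sum_apply, Pi.smul_apply, smul_eq_mul, Pi.zero_apply] at h2
      simp only [← mul_assoc, ← map_mul, ← Finset.sum_mul, ← map_sum, h2, map_zero, zero_mul])
    intro i
    simpa using this i
  obtain ⟨M, M', hMM', hM'M, hM⟩ := p5_complete P hP
  let σ : MvPolynomial (Fin (n + 1)) ℂ ≃ₐ[ℂ] MvPolynomial (Fin (n + 1)) ℂ :=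
    AlgEquiv.ofAlgHom (p5_sub M) (p5_sub M')
      (AlgHom.ext fun p => p5_sub_comp M M' hM'M p) (AlgHom.ext fun p => p5_sub_comp M' M hMM' p)
  refine ⟨p5_sub M h, q, fun i => ∑ k, C (M' i k) * p5_sub M (F k), lam, p5_sub M g0, ?_, ?_, hq,
    ⟨?_, ?_⟩, hlam, ?_, ⟨?_, ?_⟩⟩
  · exact (MulEquiv.irreducible_iff σ).mpr hirr
  · exact p5_sub_hom M hhom
  · exact fun i => p5_lin_hom _ _ fun k => p5_sub_hom M (hF.1 k)
  · intro x hx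
    have h1 : M'.mulVec (fun k => eval (M.mulVec x) (F k)) = 0 := by
      ext1 i
      have := hx i
      simp only [map_sum, map_mul, eval_C, p5_sub_eval] at this
      exact this
    have h2 : (fun k => eval (M.mulVec x) (F k)) = 0 := by
      have := congrArg M.mulVec h1
      rwa [Matrix.mulVec_mulVec, hMM', Matrix.one_mulVec, Matrix.mulVec_zero] at this
    have h3 := hF.2 _ (fun i => congrFun h2 i)
    have := congrArg M'.mulVec h3
    rwa [Matrix.mulVec_mulVec, hM'M, Matrix.one_mulVec, Matrix.mulVec_zero] at this
  · have h1 : (aeval fun i => ∑ k, C (M' i k) * p5_sub M (F k)).comp (p5_sub M) =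
        (p5_sub M).comp (aeval F) := by
      ext1 i
      simp only [AlgHom.comp_apply, p5_sub_X, map_sum, map_mul, aeval_X]
      simp only [algHom_C, algebraMap_eq, Finset.mul_sum]
      rw [Finset.sum_comm]
      have h2 : ∀ k, ∑ j, C (M i j) * (C (M' j k) * p5_sub M (F k)) =
          C ((1 : Matrix (Fin (n + 1)) (Fin (n + 1)) ℂ) i k) * p5_sub M (F k) := by
        intro k
        rw [← hMM', Matrix.mul_apply, map_sum, Finset.sum_mul]
        exact Finset.sum_congr rfl fun _ _ => by rw [map_mul]; ring
      simp [h2, Matrix.one_apply]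
    have h2 := DFunLike.congr_fun h1 h
    simp only [AlgHom.comp_apply] at h2
    rw [h2, hFh, map_mul, map_pow]
    simp only [algHom_C, algebraMap_eq]
  · intro i
    refine Fin.cases ?_ (fun j => ?_) i
    · simpa using p5_sub_hom M (hG.1 0)
    · simpa using (p5_sub_hom M hhom).pderiv
  · intro x hx
    have h3 := hG.2 (M.mulVec x) (by
      intro i
      have hi := hx i
      revert hi
      refine Fin.cases ?_ (fun j => ?_) i
      · intro hi
        rwa [Fin.cons_zero, p5_sub_eval] at hi
      · intro hi
        rw [Fin.cons_succ, p5_sub_pderiv, p5_sub_eval] at hi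
        simpa only [Fin.cons_succ, hM] using hi)
    have := congrArg M'.mulVec h3
    rwa [Matrix.mulVec_mulVec, hM'M, Matrix.one_mulVec, Matrix.mulVec_zero] at this

end

section

section
variable {n m : ℕ} {a : Fin (n + 1) → MvPolynomial (Fin (n + 1)) ℂ}
  {g0 : MvPolynomial (Fin (n + 1)) ℂ}

theorem p5_zero0 (hG : IsEndo (n + 1) m (Fin.cons g0 fun j : Fin n => a j.succ)) {e : ℕ} (he : e < m)
    {v : Fin (n + 1) → MvPolynomial (Fin (n + 1)) ℂ} (hv : p4_K a e v) (h0 : v 0 = 0) : v = 0 := by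
  have h1 := hv.2
  rw [Fin.sum_univ_succ, h0, zero_mul, zero_add] at h1
  have h2 := p3_S1 hG (fun j => v j.succ) e he (fun j => hv.1 _) h1
  ext1 i
  refine Fin.cases h0 (fun j => h2 j) i

theorem p5_comb {e1 e2 δ1 δ2 : ℕ} {v1 v2 : Fin (n + 1) → MvPolynomial (Fin (n + 1)) ℂ}
    (h1 : p4_K a δ1 v1) (h2 : p4_K a δ2 v2) (h : e1 + δ1 = e2 + δ2)
    {c1 c2 : MvPolynomial (Fin (n + 1)) ℂ} (hc1 : c1.IsHomogeneous e1) (hc2 : c2.IsHomogeneous e2) :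
    p4_K a (e1 + δ1) (c1 • v1 + c2 • v2) := by
  refine ⟨fun i => ?_, ?_⟩
  · simp only [Pi.add_apply, Pi.smul_apply, smul_eq_mul]
    exact (hc1.mul (h1.1 i)).add (h ▸ hc2.mul (h2.1 i))
  · have e1 := h1.2
    have e2 := h2.2
    simp only [Pi.add_apply, Pi.smul_apply, smul_eq_mul, add_mul, Finset.sum_add_distrib, mul_assoc,
      ← Finset.mul_sum, e1, e2, mul_zero, add_zero]

/-- pairwise independence -/
def p5_ind (v1 v2 : Fin (n + 1) → MvPolynomial (Fin (n + 1)) ℂ) : Prop :=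
  ∀ s t : MvPolynomial (Fin (n + 1)) ℂ, s • v1 + t • v2 = 0 → s = 0 ∧ t = 0

theorem p5_two (hG : IsEndo (n + 1) m (Fin.cons g0 fun j : Fin n => a j.succ)) {δ1 δ2 : ℕ}
    (he : δ1 + δ2 < m) {v1 v2 : Fin (n + 1) → MvPolynomial (Fin (n + 1)) ℂ}
    (h1 : p4_K a δ1 v1) (h2 : p4_K a δ2 v2) (hi : p5_ind v1 v2) : False := by
  have h3 : p4_K a (δ2 + δ1) (v2 0 • v1 + (-v1 0) • v2) :=
    p5_comb h1 h2 (add_comm _ _) (h2.1 0) (h1.1 0).neg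
  have h4 := p5_zero0 hG (by omega) h3 (by
    simp only [Pi.add_apply, Pi.smul_apply, smul_eq_mul]; ring)
  obtain ⟨h5, h6⟩ := hi _ _ h4
  have h7 := p5_zero0 hG (by omega) h1 (neg_eq_zero.mp h6)
  have := hi 1 0 (by simp [h7])
  exact one_ne_zero this.1

theorem p5_pair (hm : m = 2) (hG : IsEndo (n + 1) m (Fin.cons g0 fun j : Fin n => a j.succ))
    {v1 v2 : Fin (n + 1) → MvPolynomial (Fin (n + 1)) ℂ}
    (h1 : p4_K a 1 v1) (h2 : p4_K a 1 v2) :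
    ∃ c : Fin n → Fin n → ℂ, (∀ i j, c i j + c j i = 0) ∧
      ∀ i, v2 0 * v1 i.succ - v1 0 * v2 i.succ = ∑ s, C (c i s) * a s.succ := by
  have h3 : p4_K a (1 + 1) (v2 0 • v1 + (-v1 0) • v2) :=
    p5_comb h1 h2 (add_comm _ _) (h2.1 0) (h1.1 0).neg
  have h4 := h3.2
  rw [Fin.sum_univ_succ] at h4
  have h5 : (v2 0 • v1 + (-v1 0) • v2) 0 = 0 := by
    simp only [Pi.add_apply, Pi.smul_apply, smul_eq_mul]; ring
  rw [h5, zero_mul, zero_add] at h4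
  obtain ⟨c, hc1, hc2⟩ := p3_S2 (by omega) hG _ (fun i => by rw [hm]; exact h3.1 i.succ) h4
  refine ⟨c, hc1, fun i => ?_⟩
  rw [← hc2 i]
  simp only [Pi.add_apply, Pi.smul_apply, smul_eq_mul]; ring

theorem p5_three (hm : m = 2) (hG : IsEndo (n + 1) m (Fin.cons g0 fun j : Fin n => a j.succ))
    {v1 v2 v3 : Fin (n + 1) → MvPolynomial (Fin (n + 1)) ℂ}
    (h1 : p4_K a 1 v1) (h2 : p4_K a 1 v2) (h3 : p4_K a 1 v3) (hi : p5_ind v1 v2) :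
    ∃ α β : ℂ, v3 = (C α : MvPolynomial (Fin (n + 1)) ℂ) • v1 + (C β : MvPolynomial (Fin (n + 1)) ℂ) • v2 := by
  by_cases hl : LinearIndependent ℂ ![v1 0, v2 0, v3 0]
  · exfalso
    obtain ⟨c12, -, hc12⟩ := p5_pair hm hG h1 h2
    obtain ⟨c23, -, hc23⟩ := p5_pair hm hG h2 h3
    obtain ⟨c31, -, hc31⟩ := p5_pair hm hG h3 h1
    have hz : ∀ i s, c12 i s = 0 := by
      intro i
      have h4 := p3_S1 hG (fun s => v3 0 * C (c12 i s) + v1 0 * C (c23 i s) + v2 0 * C (c31 i s)) 1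
        (by omega) (fun s => by
          refine IsHomogeneous.add (IsHomogeneous.add ?_ ?_) ?_
          · exact (h3.1 0).mul (isHomogeneous_C _ _)
          · exact (h1.1 0).mul (isHomogeneous_C _ _)
          · exact (h2.1 0).mul (isHomogeneous_C _ _)) (by
          simp only [add_mul, Finset.sum_add_distrib, mul_assoc, ← Finset.mul_sum, ← hc12, ← hc23,
            ← hc31]
          ring)
      intro s
      have h5 := Fintype.linearIndependent_iff.mp hl ![c23 i s, c31 i s, c12 i s] (by
        rw [Fin.sum_univ_three]
        simp only [Matrix.cons_val]
        rw [← h4 s]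
        simp only [MvPolynomial.smul_eq_C_mul]
        ring) 2
      simpa using h5
    have h6 : v2 0 • v1 + (-v1 0) • v2 = 0 := by
      ext1 i
      simp only [Pi.add_apply, Pi.smul_apply, smul_eq_mul, Pi.zero_apply]
      refine Fin.cases (by ring) (fun j => ?_) i
      have := hc12 j
      simp only [hz, map_zero, zero_mul, Finset.sum_const_zero] at this
      linear_combination this
    have h7 := (hi _ _ h6).1
    have := hl.ne_zero 1
    simp [h7] at this
  · rw [Fintype.not_linearIndependent_iff] at hl
    obtain ⟨c, hc, k, hk⟩ := hl
    simp only [Fin.sum_univ_three, Matrix.cons_val, MvPolynomial.smul_eq_C_mul] at hc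
    have h4 : p4_K a (0 + 1) ((C (c 0) : MvPolynomial (Fin (n + 1)) ℂ) • v1 + (C (c 1) : MvPolynomial (Fin (n + 1)) ℂ) • v2) :=
      p5_comb h1 h2 rfl (isHomogeneous_C _ _) (isHomogeneous_C _ _)
    have h5 : p4_K a (0 + (0 + 1)) ((1 : MvPolynomial (Fin (n + 1)) ℂ) • ((C (c 0) : MvPolynomial (Fin (n + 1)) ℂ) • v1 + (C (c 1) : MvPolynomial (Fin (n + 1)) ℂ) • v2) + (C (c 2) : MvPolynomial (Fin (n + 1)) ℂ) • v3) :=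
      p5_comb h4 h3 rfl (isHomogeneous_one _ _) (isHomogeneous_C _ _)
    rw [one_smul] at h5
    have h6 := p5_zero0 hG (by omega) h5 (by simpa using hc)
    have hc2 : c 2 ≠ 0 := by
      intro h0
      rw [h0, map_zero, zero_smul, add_zero] at h6
      obtain ⟨h7, h8⟩ := hi _ _ h6
      rw [C_eq_zero] at h7 h8
      apply hk
      fin_cases k <;> assumption
    refine ⟨-(c 2)⁻¹ * c 0, -(c 2)⁻¹ * c 1, ?_⟩
    have h9 : (C (c 2)⁻¹ : MvPolynomial (Fin (n + 1)) ℂ) * C (c 2) = 1 := by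
      rw [← map_mul, inv_mul_cancel₀ hc2, map_one]
    ext1 i
    have h10 := congrFun h6 i
    simp only [Pi.add_apply, Pi.smul_apply, smul_eq_mul, Pi.zero_apply, map_mul, map_neg] at h10 ⊢
    linear_combination (C (c 2)⁻¹) * h10 - v3 i * h9

theorem p5_main (hn : 2 ≤ n) (hm : 2 ≤ m)
    (hG : IsEndo (n + 1) m (Fin.cons g0 fun j : Fin n => a j.succ)) (hR : p4_R a 1 n) :
    m = 2 ∧ n = 2 ∧ ∃ v1 v2, p4_K a 1 v1 ∧ p4_K a 1 v2 ∧ p5_ind v1 v2 := by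
  obtain ⟨v, hv, hK⟩ := hR
  have hpair : ∀ i j, i ≠ j → p5_ind (v i) (v j) := by
    intro i j hij
    have := hv.comp ![i, j] (by
      intro x y hxy
      fin_cases x <;> fin_cases y <;> simp_all [eq_comm])
    intro s t hst
    have h2 := Fintype.linearIndependent_iff.mp this ![s, t] (by
      simpa [Fin.sum_univ_two] using hst)
    exact ⟨by simpa using h2 0, by simpa using h2 1⟩
  have hdeg : ∀ i j, i ≠ j → m = 2 ∧ p4_K a 1 (v i) ∧ p4_K a 1 (v j) := by
    intro i j hij
    obtain ⟨δ1, hδ1, h1⟩ := hK i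
    obtain ⟨δ2, hδ2, h2⟩ := hK j
    have h3 : ¬ (δ1 + δ2 < m) := fun h => p5_two hG h h1 h2 (hpair i j hij)
    obtain rfl : δ1 = 1 := by omega
    obtain rfl : δ2 = 1 := by omega
    exact ⟨by omega, h1, h2⟩
  have h01 : (⟨0, by omega⟩ : Fin n) ≠ ⟨1, by omega⟩ := by simp
  obtain ⟨hm2, hk0, hk1⟩ := hdeg _ _ h01
  refine ⟨hm2, ?_, _, _, hk0, hk1, hpair _ _ h01⟩
  by_contra hn2
  have h02 : (⟨0, by omega⟩ : Fin n) ≠ ⟨2, by omega⟩ := by simp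
  have h12 : (⟨1, by omega⟩ : Fin n) ≠ ⟨2, by omega⟩ := by simp
  obtain ⟨-, -, hk2⟩ := hdeg _ _ h02
  obtain ⟨α, β, h⟩ := p5_three hm2 hG hk0 hk1 hk2 (hpair _ _ h01)
  have := hv.comp ![⟨0, by omega⟩, ⟨1, by omega⟩, ⟨2, by omega⟩] (by
      intro x y hxy
      fin_cases x <;> fin_cases y <;> simp_all [eq_comm])
  have h2 := Fintype.linearIndependent_iff.mp this ![C α, C β, -1] (by
    rw [Fin.sum_univ_three]
    simp only [Matrix.cons_val, Function.comp]
    rw [h]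
    module) 2
  simp at h2

end

end

section

theorem p6_eig {V : Type*} [AddCommGroup V] [Module ℂ V] [FiniteDimensional ℂ V] [Nontrivial V]
    (A B : Module.End ℂ V) (γ : ℂ) (h : A * B - B * A = γ • B) :
    ∃ v : V, v ≠ 0 ∧ ∃ x y : ℂ, A v = x • v ∧ B v = y • v := by
  have hb : ∃ b, B.HasEigenvalue b ∧ γ * b = 0 := by
    by_cases hγ : γ = 0
    · obtain ⟨b, hb⟩ := Module.End.exists_eigenvalue B
      exact ⟨b, hb, by simp [hγ]⟩
    · refine ⟨0, ?_, by simp⟩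
      by_contra hcon
      have hu : IsUnit B := by
        by_contra hnu
        apply hcon
        rw [Module.End.hasEigenvalue_iff_mem_spectrum, spectrum.zero_mem_iff]
        exact hnu
      obtain ⟨B', h1, h2⟩ := isUnit_iff_exists.mp hu
      have h3 : A - B * (A * B') = γ • 1 := by
        have := congrArg (· * B') h
        simpa only [sub_mul, mul_assoc, h1, mul_one, smul_mul_assoc] using this
      have h4 := congrArg (LinearMap.trace ℂ V) h3
      rw [map_sub, LinearMap.trace_mul_comm, mul_assoc, h2, mul_one, sub_self, map_smul,
        LinearMap.trace_one, smul_eq_mul] at h4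
      have := Module.finrank_pos (R := ℂ) (M := V)
      rcases mul_eq_zero.mp h4.symm with h5 | h5
      · exact hγ h5
      · have : Module.finrank ℂ V = 0 := by exact_mod_cast h5
        omega
  obtain ⟨b, hb, hγb⟩ := hb
  have hinv : ∀ w ∈ B.eigenspace b, A w ∈ B.eigenspace b := by
    intro w hw
    rw [Module.End.mem_eigenspace_iff] at hw ⊢
    have := LinearMap.congr_fun h w
    simp only [LinearMap.sub_apply, Module.End.mul_apply, LinearMap.smul_apply, hw, map_smul,
      smul_smul, hγb, zero_smul] at this
    exact (sub_eq_zero.mp this).symm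
  have hnt : Nontrivial (B.eigenspace b) := Submodule.nontrivial_iff_ne_bot.mpr hb
  obtain ⟨x, hx⟩ := Module.End.exists_eigenvalue (A.restrict hinv)
  obtain ⟨w, hw⟩ := hx.exists_hasEigenvector
  refine ⟨w.1, fun h0 => hw.2 (Subtype.ext h0), x, b, ?_, Module.End.mem_eigenspace_iff.mp w.2⟩
  have := congrArg Subtype.val hw.apply_eq_smul
  simpa using this

theorem p6_eig2 {V : Type*} [AddCommGroup V] [Module ℂ V] [FiniteDimensional ℂ V] [Nontrivial V]
    (A B : Module.End ℂ V) (α β : ℂ) (h : A * B - B * A = α • A + β • B) :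
    ∃ v : V, v ≠ 0 ∧ ∃ x y : ℂ, A v = x • v ∧ B v = y • v := by
  by_cases hα : α = 0
  · exact p6_eig A B β (by simpa [hα] using h)
  · obtain ⟨v, hv, x, y, h1, h2⟩ := p6_eig B (α • A + β • B) (-α) (by
      have : B * (α • A + β • B) - (α • A + β • B) * B = - (α • (A * B - B * A)) := by
        simp only [mul_add, add_mul, mul_smul_comm, smul_mul_assoc, smul_sub]; abel
      rw [this, h]; module)
    refine ⟨v, hv, α⁻¹ * (y - β * x), x, ?_, h1⟩
    simp only [LinearMap.add_apply, LinearMap.smul_apply, h1] at h2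
    have h3 : α • A v = (y - β * x) • v := by
      rw [sub_smul, ← h2, mul_smul]; abel
    rw [mul_smul, ← h3, smul_smul, inv_mul_cancel₀ hα, one_smul]

/-- linear form with coefficient vector `c` -/
noncomputable def p6_lf {N : ℕ} : (Fin N → ℂ) →ₗ[ℂ] MvPolynomial (Fin N) ℂ :=
  Fintype.linearCombination ℂ X

theorem p6_lf_apply {N : ℕ} (c : Fin N → ℂ) : p6_lf c = ∑ i, C (c i) * X i := by
  simp [p6_lf, Fintype.linearCombination_apply, MvPolynomial.smul_eq_C_mul]

theorem p6_lf_inj {N : ℕ} : Function.Injective (p6_lf (N := N)) := by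
  have := p3_X_li N
  exact this.fintypeLinearCombination_injective

theorem p6_lf_hom {N : ℕ} (c : Fin N → ℂ) : (p6_lf c).IsHomogeneous 1 := by
  rw [p6_lf_apply]; exact p5_lin_hom _ _ fun i => isHomogeneous_X _ _

theorem p6_end {N : ℕ} (v : Fin N → MvPolynomial (Fin N) ℂ) (hv : ∀ i, (v i).IsHomogeneous 1) :
    ∃ T : Module.End ℂ (Fin N → ℂ), ∀ c, p6_lf (T c) = mkDerivation ℂ v (p6_lf c) := by
  have h1 : ∀ i, v i = p6_lf (fun k => coeff (Finsupp.single k 1) (v i)) := by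
    intro i
    rw [p6_lf_apply]; exact p3_lin_repr (hv i)
  refine ⟨Fintype.linearCombination ℂ (fun i k => coeff (Finsupp.single k 1) (v i)), fun c => ?_⟩
  rw [Fintype.linearCombination_apply, map_sum, p6_lf_apply c, map_sum]
  refine Finset.sum_congr rfl fun i _ => ?_
  rw [map_smul, ← h1, ← MvPolynomial.smul_eq_C_mul, Derivation.map_smul, mkDerivation_X]

theorem p6_main {d : ℕ} {h : MvPolynomial (Fin 3) ℂ} (hd : d = 3) (hirr : Irreducible h)
    (hhom : h.IsHomogeneous d) {g0 : MvPolynomial (Fin 3) ℂ}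
    (hG : IsEndo (2 + 1) 2 (Fin.cons g0 fun j : Fin 2 => pderiv j.succ h))
    {v1 v2 : Fin (2 + 1) → MvPolynomial (Fin (2 + 1)) ℂ}
    (h1 : p4_K (fun i => pderiv i h) 1 v1) (h2 : p4_K (fun i => pderiv i h) 1 v2)
    (hi : p5_ind v1 v2) : False := by
  have hkill : ∀ {v : Fin 3 → MvPolynomial (Fin 3) ℂ}, p4_K (fun i => pderiv i h) 1 v →
      mkDerivation ℂ v h = 0 := by
    intro v hv
    rw [p4_mk, ← hv.2]
    exact Finset.sum_congr rfl fun _ _ => mul_comm _ _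
  -- bracket
  let D3 : Derivation ℂ (MvPolynomial (Fin 3) ℂ) (MvPolynomial (Fin 3) ℂ) :=
    ⁅mkDerivation ℂ v1, mkDerivation ℂ v2⁆
  let v3 : Fin 3 → MvPolynomial (Fin 3) ℂ := fun i => D3 (X i)
  have hD3 : mkDerivation ℂ v3 = D3 := derivation_ext fun i => by rw [mkDerivation_X]
  have hd1 : ∀ (v w : Fin 3 → MvPolynomial (Fin 3) ℂ), (∀ i, (v i).IsHomogeneous 1) →
      (∀ i, (w i).IsHomogeneous 1) → ∀ i, (mkDerivation ℂ v (w i)).IsHomogeneous 1 := by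
    intro v w hv hw i
    rw [p4_mk]
    exact IsHomogeneous.sum _ _ _ fun j _ => by simpa using (hw i).pderiv.mul (hv j)
  have h3 : p4_K (fun i => pderiv i h) 1 v3 := by
    refine ⟨fun i => ?_, ?_⟩
    · show (D3 (X i)).IsHomogeneous 1
      rw [Derivation.commutator_apply, mkDerivation_X, mkDerivation_X]
      exact (hd1 _ _ h1.1 h2.1 i).sub (hd1 _ _ h2.1 h1.1 i)
    · have h4 : mkDerivation ℂ v3 h = 0 := by
        rw [hD3, Derivation.commutator_apply, hkill h1, hkill h2, map_zero, map_zero, sub_zero]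
      rw [p4_mk] at h4
      rw [← h4]
      exact Finset.sum_congr rfl fun _ _ => mul_comm _ _
  obtain ⟨α, β, hαβ⟩ := p5_three (a := fun i => pderiv i h) rfl hG h1 h2 h3 hi
  obtain ⟨T1, hT1⟩ := p6_end v1 h1.1
  obtain ⟨T2, hT2⟩ := p6_end v2 h2.1
  obtain ⟨c, hc, x, y, hx, hy⟩ := p6_eig2 T1 T2 α β (by
    ext1 i
    ext1
    apply p6_lf_inj
    simp only [LinearMap.comp_apply, LinearMap.sub_apply, Module.End.mul_apply, map_sub,
      LinearMap.add_apply, LinearMap.smul_apply, map_add, map_smul, hT1, hT2]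
    generalize p6_lf (LinearMap.single ℂ (fun _ : Fin 3 => ℂ) i 1) = z
    have h5 : mkDerivation ℂ v3 z = mkDerivation ℂ v1 (mkDerivation ℂ v2 z) -
        mkDerivation ℂ v2 (mkDerivation ℂ v1 z) := by rw [hD3, Derivation.commutator_apply]
    rw [← h5]
    simp only [p4_mk, hαβ, MvPolynomial.smul_eq_C_mul, Finset.mul_sum, ← Finset.sum_add_distrib]
    refine Finset.sum_congr rfl fun j _ => ?_
    simp only [Pi.add_apply, Pi.smul_apply, smul_eq_mul]
    ring)
  -- cross product
  obtain ⟨k, hk1, hk2⟩ := p5_pair (a := fun i => pderiv i h) rfl hG h1 h2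
  have hk00 : k 0 0 = 0 := by have := hk1 0 0; linear_combination this / 2
  have hk11 : k 1 1 = 0 := by have := hk1 1 1; linear_combination this / 2
  have hk10 : k 1 0 = - k 0 1 := by linear_combination hk1 0 1
  have e1 := hk2 0
  have e2 := hk2 1
  simp only [Fin.sum_univ_two, hk00, hk11, hk10, map_zero, zero_mul, zero_add, add_zero,
    map_neg] at e1 e2
  have s01 : (Fin.succ 0 : Fin 3) = 1 := rfl
  have s12 : (Fin.succ 1 : Fin 3) = 2 := rfl
  rw [s01, s12] at e1
  rw [s01, s12] at e2
  have f1 := h1.2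
  have f2 := h2.2
  rw [Fin.sum_univ_three] at f1 f2
  set κ := k 0 1
  have hne : v1 0 ≠ 0 ∨ v2 0 ≠ 0 := by
    by_contra hcon
    push Not at hcon
    have := p5_zero0 (a := fun i => pderiv i h) hG (by omega) h1 hcon.1
    have := hi 1 0 (by simp [this])
    exact one_ne_zero this.1
  have hκ : κ ≠ 0 := by
    intro h0
    rw [h0] at e1 e2
    simp only [map_zero, zero_mul, neg_zero] at e1 e2
    have h6 := hi (v2 0) (-v1 0) (by
      ext1 i
      simp only [Pi.add_apply, Pi.smul_apply, smul_eq_mul, Pi.zero_apply]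
      fin_cases i
      · simp; ring
      · show v2 0 * v1 1 + -v1 0 * v2 1 = 0
        linear_combination e1
      · show v2 0 * v1 2 + -v1 0 * v2 2 = 0
        linear_combination e2)
    rcases hne with h7 | h7
    · exact h7 (neg_eq_zero.mp h6.2)
    · exact h7 h6.1
  have e0 : v1 1 * v2 2 - v1 2 * v2 1 = - (C κ * pderiv 0 h) := by
    rcases hne with h7 | h7
    · apply mul_left_cancel₀ h7
      linear_combination (C κ) * f1 - v1 1 * e2 + v1 2 * e1
    · apply mul_left_cancel₀ h7
      linear_combination (C κ) * f2 - v2 1 * e2 + v2 2 * e1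
  have hE := hhom.sum_X_mul_pderiv
  rw [Fin.sum_univ_three, nsmul_eq_mul, hd] at hE
  -- eigen linear form
  have g1 := hT1 c
  have g2 := hT2 c
  rw [hx, map_smul, MvPolynomial.smul_eq_C_mul] at g1
  rw [hy, map_smul, MvPolynomial.smul_eq_C_mul] at g2
  have hlf : p6_lf c = C (c 0) * X 0 + C (c 1) * X 1 + C (c 2) * X 2 := by
    rw [p6_lf_apply, Fin.sum_univ_three]
  have hD : ∀ v : Fin 3 → MvPolynomial (Fin 3) ℂ, mkDerivation ℂ v (p6_lf c) =
      C (c 0) * v 0 + C (c 1) * v 1 + C (c 2) * v 2 := by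
    intro v
    rw [hlf]
    simp only [← MvPolynomial.smul_eq_C_mul, map_add, Derivation.map_smul, mkDerivation_X]
  rw [hD] at g1 g2
  set l := p6_lf c
  have hdvd : ∀ i, l ∣ C (c i * κ * 3) * h := by
    intro i
    have hE' : C (c i * κ * 3) * h = C (c i) * C κ * (X 0 * pderiv 0 h + X 1 * pderiv 1 h
        + X 2 * pderiv 2 h) := by
      rw [hE]; simp only [map_mul]; push_cast
      have : (C (3:ℂ) : MvPolynomial (Fin 3) ℂ) = 3 := map_ofNat C 3
      rw [this]; ring
    rw [hE']
    fin_cases i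
    · refine ⟨-((v1 1 * v2 2 - v1 2 * v2 1) + C x * (X 2 * v2 1 - X 1 * v2 2) + C y * (X 1 * v1 2 - X 2 * v1 1)), ?_⟩
      show C (c 0) * C κ * _ = _
      linear_combination C (c 0) * (X 0 * e0 + X 1 * e2 - X 2 * e1) + (v1 1 * v2 2 - v1 2 * v2 1) * hlf + (X 2 * v2 1 - X 1 * v2 2) * g1 + (X 1 * v1 2 - X 2 * v1 1) * g2
    · refine ⟨-((v1 2 * v2 0 - v1 0 * v2 2) + C x * (X 0 * v2 2 - X 2 * v2 0) + C y * (X 2 * v1 0 - X 0 * v1 2)), ?_⟩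
      show C (c 1) * C κ * _ = _
      linear_combination C (c 1) * (X 0 * e0 + X 1 * e2 - X 2 * e1) + (v1 2 * v2 0 - v1 0 * v2 2) * hlf + (X 0 * v2 2 - X 2 * v2 0) * g1 + (X 2 * v1 0 - X 0 * v1 2) * g2
    · refine ⟨-((v1 0 * v2 1 - v1 1 * v2 0) + C x * (X 1 * v2 0 - X 0 * v2 1) + C y * (X 0 * v1 1 - X 1 * v1 0)), ?_⟩
      show C (c 2) * C κ * _ = _
      linear_combination C (c 2) * (X 0 * e0 + X 1 * e2 - X 2 * e1) + (v1 0 * v2 1 - v1 1 * v2 0) * hlf + (X 1 * v2 0 - X 0 * v2 1) * g1 + (X 0 * v1 1 - X 1 * v1 0) * g2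
  obtain ⟨i, hi0⟩ := Function.ne_iff.mp hc
  have hdvdh : l ∣ h := by
    have h8 : (C (c i * κ * 3)⁻¹ : MvPolynomial (Fin 3) ℂ) * (C (c i * κ * 3) * h) = h := by
      rw [← mul_assoc, ← map_mul, inv_mul_cancel₀, map_one, one_mul]
      exact mul_ne_zero (mul_ne_zero hi0 hκ) (by norm_num)
    rw [← h8]
    exact (hdvd i).mul_left _
  obtain ⟨p, hp⟩ := hdvdh
  have hl0 : l ≠ 0 := fun h0 => hc (p6_lf_inj (h0.trans (map_zero _).symm))
  have hld : l.totalDegree = 1 := (p6_lf_hom c).totalDegree hl0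
  have hp0 : p ≠ 0 := by rintro rfl; exact hirr.ne_zero (by simpa using hp)
  have hhd : h.totalDegree = 3 := hd ▸ hhom.totalDegree hirr.ne_zero
  rw [hp, totalDegree_mul_of_isDomain hl0 hp0, hld] at hhd
  rcases hirr.isUnit_or_isUnit hp with hu | hu
  · rw [MvPolynomial.isUnit_iff_totalDegree_of_isReduced] at hu
    omega
  · rw [MvPolynomial.isUnit_iff_totalDegree_of_isReduced] at hu
    omega

end

section

theorem p7_B {N : ℕ} {h : MvPolynomial (Fin N) ℂ} (hhom : h.IsHomogeneous 2) :
    ∃ B : LinearMap.BilinForm ℂ (Fin N → ℂ), (∀ x y, B x y = B y x) ∧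
      (∀ x p, B x p = ∑ i, x i * eval p (pderiv i h)) ∧ ∀ x, B x x = 2 * eval x h := by
  let H : Matrix (Fin N) (Fin N) ℂ := fun i j => coeff (Finsupp.single j 1) (pderiv i h)
  have ha : ∀ i, (pderiv i h).IsHomogeneous 1 := fun i => hhom.pderiv
  have hH : ∀ i, pderiv i h = ∑ j, C (H i j) * X j := fun i => p3_lin_repr (ha i)
  have hHs : ∀ i j, H i j = H j i := by
    intro i j
    have h1 : ∀ i j, pderiv j (pderiv i h) = C (H i j) := by
      intro i j
      rw [hH i, map_sum, Finset.sum_eq_single j]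
      · simp
      · intro k _ hk; simp [pderiv_X_of_ne hk]
      · simp
    apply C_injective (Fin N) ℂ
    rw [← h1, ← h1]
    have h2 : ⁅(pderiv j : Derivation ℂ (MvPolynomial (Fin N) ℂ) (MvPolynomial (Fin N) ℂ)),
        pderiv i⁆ = 0 := derivation_ext fun k => by
      rw [Derivation.commutator_apply, pderiv_X, pderiv_X]
      simp [Pi.single_apply, apply_ite]
    have h3 := congrArg (fun D => D h) h2
    simp only [Derivation.commutator_apply, Derivation.coe_zero, Pi.zero_apply] at h3
    exact sub_eq_zero.mp h3
  have hB : ∀ x p, Matrix.toBilin' H x p = ∑ i, x i * eval p (pderiv i h) := by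
    intro x p
    rw [Matrix.toBilin'_apply]
    refine Finset.sum_congr rfl fun i _ => ?_
    rw [hH i]
    simp only [map_sum, map_mul, eval_C, eval_X, Finset.mul_sum, mul_assoc]
  refine ⟨Matrix.toBilin' H, fun x y => ?_, hB, fun x => ?_⟩
  · rw [Matrix.toBilin'_apply, Matrix.toBilin'_apply, Finset.sum_comm]
    refine Finset.sum_congr rfl fun i _ => Finset.sum_congr rfl fun j _ => ?_
    rw [hHs]; ring
  · rw [hB]
    have := congrArg (eval x) hhom.sum_X_mul_pderiv
    simpa using this

/-- linear form attached to `x` -/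
noncomputable def p7_L {N : ℕ} (h : MvPolynomial (Fin N) ℂ) (x : Fin N → ℂ) :
    MvPolynomial (Fin N) ℂ := ∑ i, C (x i) * pderiv i h

theorem p7_L_eval {N : ℕ} {h : MvPolynomial (Fin N) ℂ} {B : LinearMap.BilinForm ℂ (Fin N → ℂ)}
    (hB : ∀ x p, B x p = ∑ i, x i * eval p (pderiv i h)) (x p : Fin N → ℂ) :
    eval p (p7_L h x) = B x p := by
  rw [hB, p7_L]; simp

theorem p7_L_hom {N : ℕ} {h : MvPolynomial (Fin N) ℂ} (hhom : h.IsHomogeneous 2) (x : Fin N → ℂ) :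
    (p7_L h x).IsHomogeneous 1 := p5_lin_hom _ _ fun _ => hhom.pderiv

theorem p7_nonunit {N : ℕ} {p : MvPolynomial (Fin N) ℂ} (hp : p.IsHomogeneous 1) : ¬ IsUnit p := by
  intro hu
  have h0 : p ≠ 0 := hu.ne_zero
  have h1 := hp.totalDegree h0
  rw [MvPolynomial.isUnit_iff_totalDegree_of_isReduced] at hu
  omega

theorem p7_nofactor {N : ℕ} {h l m : MvPolynomial (Fin N) ℂ} (hirr : Irreducible h)
    (hl : l.IsHomogeneous 1) (hm : m.IsHomogeneous 1) (hf : ∀ p, 2 * eval p h = eval p l * eval p m) :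
    False := by
  have h1 : h = (C (1/2) * l) * m := by
    apply MvPolynomial.funext
    intro p
    simp only [map_mul, eval_C]
    linear_combination (1/2) * hf p
  rcases hirr.isUnit_or_isUnit h1 with hu | hu
  · exact p7_nonunit hl (isUnit_of_mul_isUnit_right hu)
  · exact p7_nonunit hm hu

theorem p7_norm {N : ℕ} (B : LinearMap.BilinForm ℂ (Fin N → ℂ)) {x : Fin N → ℂ} (hx : B x x ≠ 0) :
    ∃ t : ℂ, B (t • x) (t • x) = 1 := by
  obtain ⟨r, hr⟩ := IsAlgClosed.exists_pow_nat_eq (B x x) (n := 2) (by norm_num)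
  have hr0 : r ≠ 0 := by rintro rfl; exact hx (by rw [← hr]; simp)
  refine ⟨r⁻¹, ?_⟩
  simp only [map_smul, LinearMap.smul_apply, smul_eq_mul, ← hr]
  field_simp

theorem p7_hyp {N : ℕ} {h : MvPolynomial (Fin N) ℂ} (hirr : Irreducible h)
    (hhom : h.IsHomogeneous 2) {B : LinearMap.BilinForm ℂ (Fin N → ℂ)} (hs : ∀ x y, B x y = B y x)
    (hB : ∀ x p, B x p = ∑ i, x i * eval p (pderiv i h)) (hB2 : ∀ x, B x x = 2 * eval x h) :
    ∃ e f g, B e e = 0 ∧ B f f = 0 ∧ B e f = 1 ∧ B g e = 0 ∧ B g f = 0 ∧ B g g = 1 := by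
  have s1 : ∃ x, B x x = 1 := by
    by_contra hcon
    apply hirr.ne_zero
    apply MvPolynomial.funext
    intro p
    by_contra hp
    obtain ⟨t, ht⟩ := p7_norm B (x := p) (by rw [hB2]; simpa using hp)
    exact hcon ⟨_, ht⟩
  obtain ⟨x, hx⟩ := s1
  have s2 : ∃ y, B x y = 0 ∧ B y y = 1 := by
    by_contra hcon
    refine p7_nofactor hirr (p7_L_hom hhom x) (p7_L_hom hhom x) fun p => ?_
    rw [p7_L_eval hB, ← hB2]
    by_contra hp
    have h1 : B (p - B x p • x) (p - B x p • x) ≠ 0 := by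
      simp only [map_sub, map_smul, LinearMap.sub_apply, LinearMap.smul_apply, smul_eq_mul, hx,
        hs p x]
      intro h0; apply hp; linear_combination h0
    obtain ⟨t, ht⟩ := p7_norm B h1
    refine hcon ⟨_, ?_, ht⟩
    simp only [map_sub, map_smul, smul_eq_mul, hx]; ring
  obtain ⟨y, hxy, hy⟩ := s2
  have hyx : B y x = 0 := by rw [hs, hxy]
  have s3 : ∃ z, B x z = 0 ∧ B y z = 0 ∧ B z z = 1 := by
    by_contra hcon
    have hl : ∀ c : ℂ, (p7_L h x + C c * p7_L h y).IsHomogeneous 1 := fun c =>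
      (p7_L_hom hhom x).add (by simpa using (isHomogeneous_C (Fin N) c).mul (p7_L_hom hhom y))
    refine p7_nofactor hirr (hl Complex.I) (hl (-Complex.I)) fun p => ?_
    simp only [map_add, map_mul, eval_C, p7_L_eval hB, ← hB2]
    by_contra hp
    have h1 : B (p - B x p • x - B y p • y) (p - B x p • x - B y p • y) ≠ 0 := by
      simp only [map_sub, map_smul, LinearMap.sub_apply, LinearMap.smul_apply, smul_eq_mul, hx,
        hs p x, hs p y, hy, hxy, hyx]
      intro h0; apply hp; linear_combination h0 + (B y p)^2 * Complex.I_mul_I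
    obtain ⟨t, ht⟩ := p7_norm B h1
    refine hcon ⟨_, ?_, ?_, ht⟩
    · simp only [map_sub, map_smul, smul_eq_mul, hx, hxy]; ring
    · simp only [map_sub, map_smul, smul_eq_mul, hyx, hy]; ring
  obtain ⟨z, hxz, hyz, hz⟩ := s3
  refine ⟨x + Complex.I • y, (1/2 : ℂ) • (x - Complex.I • y), z, ?_, ?_, ?_, ?_, ?_, hz⟩ <;>
  simp only [map_add, map_sub, map_smul, LinearMap.add_apply, LinearMap.sub_apply,
    LinearMap.smul_apply, smul_eq_mul, hx, hy, hxy, hyx, hs z x, hs z y, hxz, hyz]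
  · linear_combination Complex.I_mul_I
  · linear_combination (1/4) * Complex.I_mul_I
  · linear_combination (-1/2) * Complex.I_mul_I
  · ring
  · ring

end

section

theorem p7_chain {N : ℕ} (φ : Fin N → Polynomial ℂ) (p : MvPolynomial (Fin N) ℂ) :
    Polynomial.derivative (aeval φ p) =
      ∑ i, aeval φ (pderiv i p) * Polynomial.derivative (φ i) := by
  classical
  induction p using MvPolynomial.induction_on with
  | C c => simp
  | add p q hp hq => simp only [map_add, hp, hq, add_mul, Finset.sum_add_distrib]
  | mul_X p k hp =>
    simp only [map_mul, aeval_X, Polynomial.derivative_mul, Derivation.leibniz, hp, smul_eq_mul,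
      map_add, add_mul, Finset.sum_add_distrib, pderiv_X]
    rw [add_comm]
    congr 1
    · rw [Finset.sum_eq_single k]
      · simp
      · intro b _ hb; simp [Ne.symm hb]
      · simp
    · rw [Finset.sum_mul]
      exact Finset.sum_congr rfl fun i _ => by ring

theorem p7_evala {N : ℕ} (φ : Fin N → Polynomial ℂ) (p : MvPolynomial (Fin N) ℂ) (μ : ℂ) :
    Polynomial.eval μ (aeval φ p) = eval (fun i => Polynomial.eval μ (φ i)) p := by
  induction p using MvPolynomial.induction_on with
  | C c => simp
  | add p q hp hq => simp only [map_add, Polynomial.eval_add, hp, hq]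
  | mul_X p k hp => simp only [map_mul, aeval_X, Polynomial.eval_mul, hp, eval_X]

theorem p7_flow {N q : ℕ} {h f0 : MvPolynomial (Fin N) ℂ} (hf0 : f0.IsHomogeneous q)
    {B : LinearMap.BilinForm ℂ (Fin N → ℂ)} (hs : ∀ x y, B x y = B y x)
    (hB : ∀ x p, B x p = ∑ i, x i * eval p (pderiv i h)) {e f : Fin N → ℂ}
    (hee : B e e = 0) (hff : B f f = 0) (hef : B e f = 1)
    (hD : mkDerivation ℂ (fun i => p7_L h f * C (e i) - p7_L h e * C (f i)) f0 = - C (q : ℂ) * f0) :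
    f0 = C (eval f f0) * (p7_L h e) ^ q := by
  apply MvPolynomial.funext
  intro y
  rw [map_mul, map_pow, eval_C, p7_L_eval hB]
  have hfe : B f e = 1 := by rw [hs, hef]
  set u := B f y with hu
  set w := B e y with hw
  let z : Fin N → ℂ := y - u • e - w • f
  have hez : B e z = 0 := by simp [z, hee, hef, ← hw]
  have hfz : B f z = 0 := by simp [z, hfe, hff, ← hu]
  let φ : Fin N → Polynomial ℂ := fun i => Polynomial.C (w * f i) + Polynomial.C (z i) * Polynomial.X
    + Polynomial.C (u * e i) * Polynomial.X ^ 2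
  have hφ : ∀ μ, (fun i => Polynomial.eval μ (φ i)) = w • f + μ • z + (μ ^ 2 * u) • e := by
    intro μ; ext i
    simp [φ]; ring
  have h1 : Polynomial.X * Polynomial.derivative (aeval φ f0) = 0 := by
    apply Polynomial.funext
    intro μ
    rw [p7_chain]
    simp only [Polynomial.eval_mul, Polynomial.eval_X, Polynomial.eval_finsetSum, p7_evala, hφ,
      Polynomial.eval_zero]
    set pt := w • f + μ • z + (μ ^ 2 * u) • e with hpt
    have d1 := congrArg (eval pt) hD
    have d2 := congrArg (eval pt) hf0.sum_X_mul_pderiv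
    rw [p4_mk] at d1
    have b1 : B f pt = μ ^ 2 * u := by simp [hpt, hff, hfz, hfe]
    have b2 : B e pt = w := by simp [hpt, hee, hez, hef]
    simp only [map_sum, map_mul, map_sub, p7_L_eval hB, eval_C, b1, b2, map_neg, eval_X,
      nsmul_eq_mul, map_natCast] at d1 d2
    have d3 : ∑ i, eval pt (pderiv i f0) * (μ ^ 2 * u * e i - w * f i) + ∑ i, pt i * eval pt (pderiv i f0) = 0 := by
      rw [d1, d2]; ring
    rw [← d3, Finset.mul_sum, ← Finset.sum_add_distrib]
    refine Finset.sum_congr rfl fun i _ => ?_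
    simp [φ, hpt]
    ring
  have h2 : Polynomial.derivative (aeval φ f0) = 0 := by
    rcases mul_eq_zero.mp h1 with h3 | h3
    · exact absurd h3 Polynomial.X_ne_zero
    · exact h3
  have h3 := Polynomial.derivative_eq_zero.mp h2
  obtain ⟨c, hc⟩ := Polynomial.natDegree_eq_zero.mp h3
  have h4 : ∀ μ, eval (w • f + μ • z + (μ ^ 2 * u) • e) f0 = c := by
    intro μ
    rw [← hφ, ← p7_evala, ← hc, Polynomial.eval_C]
  have h5 := h4 0
  have h6 := h4 1
  have h7 : w • f + (1:ℂ) • z + ((1:ℂ) ^ 2 * u) • e = y := by simp [z]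
  have h8 : w • f + (0:ℂ) • z + ((0:ℂ) ^ 2 * u) • e = fun i => w * f i := by ext i; simp
  rw [h7] at h6
  rw [h8, p3_eval_smul hf0] at h5
  rw [h6, ← h5]; ring

end

section

theorem p7_lin_add {N : ℕ} {p : MvPolynomial (Fin N) ℂ} (hp : p.IsHomogeneous 1)
    (y z : Fin N → ℂ) : eval (y + z) p = eval y p + eval z p := by
  rw [p3_lin_repr hp]
  simp [mul_add, Finset.sum_add_distrib]

theorem p7_pol {N : ℕ} {u a : Fin N → MvPolynomial (Fin N) ℂ} (hu : ∀ i, (u i).IsHomogeneous 1)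
    (ha : ∀ i, (a i).IsHomogeneous 1) (h : ∑ i, u i * a i = 0) (y z : Fin N → ℂ) :
    ∑ i, eval y (a i) * eval z (u i) = - ∑ i, eval z (a i) * eval y (u i) := by
  have h1 := congrArg (eval (y + z)) h
  have h2 := congrArg (eval y) h
  have h3 := congrArg (eval z) h
  simp only [map_sum, map_mul, p7_lin_add (hu _), p7_lin_add (ha _), map_zero, add_mul, mul_add,
    Finset.sum_add_distrib] at h1 h2 h3
  have e1 : ∑ i, eval y (a i) * eval z (u i) = ∑ i, eval z (u i) * eval y (a i) :=
    Finset.sum_congr rfl fun _ _ => mul_comm _ _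
  have e2 : ∑ i, eval z (a i) * eval y (u i) = ∑ i, eval y (u i) * eval z (a i) :=
    Finset.sum_congr rfl fun _ _ => mul_comm _ _
  rw [e1, e2]
  linear_combination h1 - h2 - h3

theorem p7_evF {N : ℕ} (F : Fin N → MvPolynomial (Fin N) ℂ) (p : MvPolynomial (Fin N) ℂ)
    (x : Fin N → ℂ) : eval x (aeval F p) = eval (fun i => eval x (F i)) p := by
  induction p using MvPolynomial.induction_on with
  | C c => simp
  | add p q hp hq => simp only [map_add, hp, hq]
  | mul_X p k hp => simp only [map_mul, aeval_X, hp, eval_X]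

theorem p7_step {N q : ℕ} (hq : 2 ≤ q) {h : MvPolynomial (Fin N) ℂ} (hhom : h.IsHomogeneous 2)
    {F : Fin N → MvPolynomial (Fin N) ℂ} (hF : IsEndo N q F) {lam : ℂ}
    (hinv : aeval F h = C lam * h ^ q)
    {B : LinearMap.BilinForm ℂ (Fin N → ℂ)} (hs : ∀ x y, B x y = B y x)
    (hB : ∀ x p, B x p = ∑ i, x i * eval p (pderiv i h)) {e f : Fin N → ℂ}
    (hee : B e e = 0) (hff : B f f = 0) (hef : B e f = 1)
    (hne : ∃ j, eval (fun i => eval e (F i)) (pderiv j h) ≠ 0) :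
    ∃ c, (p7_L h e) ^ q = aeval F (p6_lf c) := by
  have ha : ∀ i, (pderiv i h).IsHomogeneous 1 := fun i => hhom.pderiv
  have hfe : B f e = 1 := by rw [hs, hef]
  set P : Fin N → ℂ := fun i => eval e (F i) with hP
  let c : Fin N → ℂ := fun j => eval P (pderiv j h)
  let f0 := aeval F (p6_lf c)
  have hf0e : f0 = ∑ j, C (c j) * F j := by
    simp [f0, p6_lf_apply, algebraMap_eq]
  have hf0h : f0.IsHomogeneous q := by rw [hf0e]; exact p5_lin_hom _ _ fun i => hF.1 i
  let v : Fin N → MvPolynomial (Fin N) ℂ := fun i => p7_L h f * C (e i) - p7_L h e * C (f i)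
  have hv : p4_K (fun i => pderiv i h) 1 v := by
    constructor
    · intro i
      exact ((p7_L_hom hhom f).mul (isHomogeneous_C _ _)).sub
        ((p7_L_hom hhom e).mul (isHomogeneous_C _ _))
    · have : ∑ i, v i * pderiv i h = p7_L h f * p7_L h e - p7_L h e * p7_L h f := by
        conv_rhs => rw [p7_L.eq_1 h e, Finset.mul_sum, ← p7_L.eq_1 h e, p7_L.eq_1 h f, Finset.mul_sum, ← p7_L.eq_1 h f]
        rw [← Finset.sum_sub_distrib]
        refine Finset.sum_congr rfl fun i _ => ?_
        simp only [v]; ring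
      rw [this]; ring
  obtain ⟨hw, hsz⟩ := p4_DF hF hinv hv
  have hq1 : q - 1 + 1 = q := by omega
  rw [hq1] at hw
  obtain ⟨T, u, hT, hu⟩ := syz_lift (by omega) hF (fun i => pderiv i h)
    (fun i => mkDerivation ℂ v (F i)) q hw hsz
  have hwe : ∀ j, eval e (mkDerivation ℂ v (F j)) = q * P j := by
    intro j
    have d2 := congrArg (eval e) (hF.1 j).sum_X_mul_pderiv
    rw [p4_mk]
    simp only [map_sum, map_mul, eval_X, nsmul_eq_mul, map_natCast] at d2 ⊢
    rw [← d2]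
    refine Finset.sum_congr rfl fun i _ => ?_
    simp only [v, map_sub, map_mul, p7_L_eval hB, eval_C, hfe, hee]; ring
  have hD : mkDerivation ℂ v f0 = - C (q : ℂ) * f0 := by
    apply MvPolynomial.funext
    intro x
    set Q : Fin N → ℂ := fun i => eval x (F i) with hQ
    have k1 : eval x f0 = ∑ j, P j * eval Q (pderiv j h) := by
      rw [← hB, hs, hB, hf0e]
      simp only [map_sum, map_mul, eval_C, c]
      exact Finset.sum_congr rfl fun _ _ => mul_comm _ _
    have k2 : eval x (mkDerivation ℂ v f0) = ∑ j, c j * eval x (mkDerivation ℂ v (F j)) := by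
      rw [hf0e]
      simp only [← MvPolynomial.smul_eq_C_mul, map_sum, Derivation.map_smul, smul_eval]
    have k3 : ∀ t ∈ T, eval x (monomial t 1) * ∑ j, eval P (pderiv j h) * eval Q (u t j) =
        - (eval e (monomial t 1) * ∑ j, eval Q (pderiv j h) * eval P (u t j)) := by
      intro t ht
      obtain ⟨δ, hδ, hut, hsum⟩ := hT t ht
      have hδ1 : δ = 0 ∨ (δ = 1 ∧ t.degree = 0) := by
        rcases Nat.lt_or_ge δ 2 with h2 | h2
        · interval_cases δ
          · left; rfl
          · right; exact ⟨rfl, by omega⟩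
        · exfalso; nlinarith
      rcases hδ1 with rfl | ⟨rfl, ht0⟩
      · have hz : ∀ y z, ∑ j, eval y (pderiv j h) * eval z (u t j) = 0 := by
          intro y z
          have := congrArg (eval y) hsum
          simp only [map_sum, map_mul, map_zero] at this
          rw [← this]
          refine Finset.sum_congr rfl fun j _ => ?_
          rw [mul_comm]
          congr 1
          rw [totalDegree_eq_zero_iff_eq_C.mp (Nat.le_zero.mp (hut j).totalDegree_le)]
          simp
        rw [hz, hz]; simp
      · have : t = 0 := (Finsupp.degree_eq_zero_iff t).mp ht0
        subst this
        rw [p7_pol hut ha hsum]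
        simp
    rw [k2]
    have k4 : ∀ y, ∀ j, eval y (mkDerivation ℂ v (F j)) =
        ∑ t ∈ T, eval y (monomial t 1) * eval (fun i => eval y (F i)) (u t j) := by
      intro y j
      rw [show mkDerivation ℂ v (F j) = _ from hu j]
      simp only [map_sum, map_mul, p7_evF]
    have k5 : ∑ j, c j * eval x (mkDerivation ℂ v (F j)) =
        ∑ t ∈ T, eval x (monomial t 1) * ∑ j, eval P (pderiv j h) * eval Q (u t j) := by
      simp only [k4, Finset.mul_sum]
      rw [Finset.sum_comm]
      refine Finset.sum_congr rfl fun t _ => Finset.sum_congr rfl fun j _ => ?_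
      simp only [c]; ring
    have k6 : ∑ j, eval Q (pderiv j h) * eval e (mkDerivation ℂ v (F j)) =
        ∑ t ∈ T, eval e (monomial t 1) * ∑ j, eval Q (pderiv j h) * eval P (u t j) := by
      simp only [k4, Finset.mul_sum]
      rw [Finset.sum_comm]
      refine Finset.sum_congr rfl fun t _ => Finset.sum_congr rfl fun j _ => ?_
      simp only [hP]; ring
    rw [k5, Finset.sum_congr rfl k3, Finset.sum_neg_distrib, ← k6]
    simp only [map_neg, map_mul, eval_C, k1, hwe, neg_mul, Finset.mul_sum]
    congr 1
    exact Finset.sum_congr rfl fun j _ => by ring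
  have hfl := p7_flow hf0h hs hB hee hff hef hD
  have hc0 : c ≠ 0 := by
    obtain ⟨j, hj⟩ := hne
    intro h0
    exact hj (congrFun h0 j)
  have hf00 : f0 ≠ 0 := by
    intro h0
    apply hc0
    apply p6_lf_inj
    apply p2_inj (by omega) hF
    rw [map_zero, map_zero]; exact h0
  have hk0 : eval f f0 ≠ 0 := by
    intro h0; rw [h0] at hfl; exact hf00 (by simpa using hfl)
  refine ⟨(eval f f0)⁻¹ • c, ?_⟩
  rw [map_smul, map_smul]
  show _ = (eval f f0)⁻¹ • f0
  conv_rhs => rw [hfl]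
  rw [MvPolynomial.smul_eq_C_mul, ← mul_assoc, ← map_mul, ← hfl, inv_mul_cancel₀ hk0, map_one, one_mul]

end

section

theorem p7_coeff {S : Type*} [CommRing S] [Algebra ℂ S] (T : Submodule ℂ S) (Q : Polynomial S)
    {A : Polynomial ℂ} (hA : A ≠ 0)
    (h : ∀ s : ℂ, A.eval s ≠ 0 → Q.eval (algebraMap ℂ S s) ∈ T) (k : ℕ) : Q.coeff k ∈ T := by
  by_contra hk
  obtain ⟨φ, hφ1, hφ2⟩ := Submodule.exists_le_ker_of_notMem hk
  let R : Polynomial ℂ := ∑ i ∈ Finset.range (Q.natDegree + 1), Polynomial.monomial i (φ (Q.coeff i))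
  have hR : ∀ s, R.eval s = φ (Q.eval (algebraMap ℂ S s)) := by
    intro s
    rw [Polynomial.eval_eq_sum_range (p := Q), map_sum, Polynomial.eval_finsetSum]
    refine Finset.sum_congr rfl fun i _ => ?_
    rw [Polynomial.eval_monomial, ← map_pow, mul_comm (Q.coeff i), ← Algebra.smul_def, map_smul,
      smul_eq_mul, mul_comm]
  have h0 : A * R = 0 := by
    apply Polynomial.funext
    intro s
    rw [Polynomial.eval_mul, Polynomial.eval_zero, hR]
    by_cases hs : A.eval s = 0
    · rw [hs, zero_mul]
    · have : φ (Q.eval (algebraMap ℂ S s)) = 0 := hφ2 (h s hs)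
      rw [this, mul_zero]
  have hR0 : R = 0 := (mul_eq_zero.mp h0).resolve_left hA
  have hc : R.coeff k = φ (Q.coeff k) := by
    simp only [R, Polynomial.finsetSum_coeff, Polynomial.coeff_monomial]
    rw [Finset.sum_ite_eq']
    split_ifs with h1
    · rfl
    · rw [Polynomial.coeff_eq_zero_of_natDegree_lt (by simpa using h1), map_zero]
  rw [hR0, Polynomial.coeff_zero] at hc
  exact hφ1 hc.symm

/-- the conic family -/
noncomputable def p7_es {N : ℕ} (e f g : Fin N → ℂ) (s : ℂ) : Fin N → ℂ :=
  e + s • g - (s ^ 2 / 2) • f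

theorem p7_lim {N q : ℕ} (hq : 1 ≤ q) {F : Fin N → MvPolynomial (Fin N) ℂ}
    (hF : ∀ i, (F i).IsHomogeneous q) {p : MvPolynomial (Fin N) ℂ} (hp : p.IsHomogeneous 1)
    (e f g : Fin N → ℂ) (k : ℂ) (hk : ∀ s, eval (p7_es e f g s) (aeval F p) = k) :
    eval (fun i => eval (fun i => (-1/2) * f i) (F i)) p = 0 := by
  let φ : Fin N → Polynomial ℂ := fun i => Polynomial.C (-1/2 * f i) +
    Polynomial.C (g i) * Polynomial.X + Polynomial.C (e i) * Polynomial.X ^ 2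
  have hpt : ∀ t : ℂ, t ≠ 0 → (fun i => Polynomial.eval t (φ i)) =
      fun i => t ^ 2 * p7_es e f g t⁻¹ i := by
    intro t ht
    ext i
    simp [φ, p7_es]; field_simp; ring
  have hhom : (aeval F p).IsHomogeneous q := by
    simpa using hp.aeval F hF
  have h1 : Polynomial.X * (aeval φ (aeval F p) - Polynomial.C k * Polynomial.X ^ (2 * q)) = 0 := by
    apply Polynomial.funext
    intro t
    simp only [Polynomial.eval_mul, Polynomial.eval_X, Polynomial.eval_sub, Polynomial.eval_C,
      Polynomial.eval_pow, Polynomial.eval_zero, p7_evala]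
    by_cases ht : t = 0
    · simp [ht]
    · rw [hpt t ht, p3_eval_smul hhom, hk]; ring
  have h2 := (mul_eq_zero.mp h1).resolve_left Polynomial.X_ne_zero
  have h3 := congrArg (Polynomial.eval 0) h2
  simp only [Polynomial.eval_mul, Polynomial.eval_X, Polynomial.eval_sub, Polynomial.eval_C,
      Polynomial.eval_pow, Polynomial.eval_zero, p7_evala, zero_pow (show 2 * q ≠ 0 by omega),
      mul_zero, sub_zero] at h3
  rw [p7_evF] at h3
  rw [← h3]
  simp [φ]

theorem p7_nonv {n q : ℕ} (hq : 1 ≤ q) {h g0 : MvPolynomial (Fin (n + 1)) ℂ}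
    (hhom : h.IsHomogeneous 2)
    {F : Fin (n + 1) → MvPolynomial (Fin (n + 1)) ℂ} (hF : IsEndo (n + 1) q F)
    (hG : IsEndo (n + 1) 1 (Fin.cons g0 fun j : Fin n => pderiv j.succ h))
    {B : LinearMap.BilinForm ℂ (Fin (n + 1) → ℂ)} {e f g : Fin (n + 1) → ℂ}
    (hff : B f f = 0) (hef : B e f = 1) (hgf : B g f = 0) :
    ∃ A : Polynomial ℂ, A ≠ 0 ∧ ∀ s, A.eval s ≠ 0 →
      ∃ j, eval (fun i => eval (p7_es e f g s) (F i)) (pderiv j h) ≠ 0 := by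
  let φ : Fin (n + 1) → Polynomial ℂ := fun i => Polynomial.C (e i) +
    Polynomial.C (g i) * Polynomial.X - Polynomial.C (f i / 2) * Polynomial.X ^ 2
  have hpt : ∀ s : ℂ, (fun i => Polynomial.eval s (φ i)) = p7_es e f g s := by
    intro s
    ext i
    simp [φ, p7_es]; ring
  by_contra hcon
  push Not at hcon
  have hz : ∀ j s, eval (p7_es e f g s) (aeval F (pderiv j h)) = 0 := by
    intro j s
    by_contra hne
    have hA : aeval φ (aeval F (pderiv j h)) ≠ 0 := by
      intro h0
      have := congrArg (Polynomial.eval s) h0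
      rw [p7_evala, hpt, Polynomial.eval_zero] at this
      exact hne this
    obtain ⟨s', hs1, hs2⟩ := hcon _ hA
    rw [p7_evala, hpt, p7_evF] at hs1
    exact hs1 (hs2 j)
  have hes : ∀ s, p7_es e f g s ≠ 0 := by
    intro s h0
    have : B (p7_es e f g s) f = 1 := by
      simp [p7_es, hff, hef, hgf]
    rw [h0] at this
    simp at this
  have hf0 : f ≠ 0 := by rintro rfl; simp at hef
  have hnr : ∀ s, Polynomial.eval s (aeval φ (aeval F g0)) ≠ 0 := by
    intro s h0
    rw [p7_evala, hpt, p7_evF] at h0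
    apply hes s
    apply hF.2
    intro i
    have := hG.2 (fun i => eval (p7_es e f g s) (F i)) (by
      intro i
      refine Fin.cases ?_ (fun j => ?_) i
      · simpa using h0
      · rw [Fin.cons_succ, ← p7_evF]; exact hz _ _)
    exact congrFun this i
  have hdeg : (aeval φ (aeval F g0)).degree = 0 := by
    by_contra hd
    obtain ⟨s, hs⟩ := IsAlgClosed.exists_root _ hd
    exact hnr s hs
  have hC := Polynomial.eq_C_of_degree_eq_zero hdeg
  have hg1 : g0.IsHomogeneous 1 := by simpa using hG.1 0
  have z0 := p7_lim hq hF.1 hg1 e f g ((aeval φ (aeval F g0)).coeff 0) (by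
    intro s
    rw [← hpt, ← p7_evala, hC]; simp)
  have z1 : ∀ j, _ := fun j => p7_lim hq hF.1 (p := pderiv j h) hhom.pderiv e f g 0 (hz j)
  have := hG.2 _ (by
      intro i
      refine Fin.cases ?_ (fun j => ?_) i
      · simpa using z0
      · rw [Fin.cons_succ]; exact z1 _)
  have h5 := hF.2 _ (fun i => congrFun this i)
  apply hf0
  ext i
  have := congrFun h5 i
  simpa using this

theorem p7_main {n q : ℕ} (hq : 2 ≤ q) {h g0 : MvPolynomial (Fin (n + 1)) ℂ} (hirr : Irreducible h)
    (hhom : h.IsHomogeneous 2)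
    {F : Fin (n + 1) → MvPolynomial (Fin (n + 1)) ℂ} (hF : IsEndo (n + 1) q F) {lam : ℂ}
    (hinv : aeval F h = C lam * h ^ q)
    (hG : IsEndo (n + 1) 1 (Fin.cons g0 fun j : Fin n => pderiv j.succ h)) : False := by
  obtain ⟨B, hs, hB, hB2⟩ := p7_B hhom
  obtain ⟨e, f, g, hee, hff, hef, hge, hgf, hgg⟩ := p7_hyp hirr hhom hs hB hB2
  obtain ⟨A, hA, hA2⟩ := p7_nonv (by omega) hhom hF hG hff hef hgf
  let Λ : (Fin (n + 1) → ℂ) →ₗ[ℂ] MvPolynomial (Fin (n + 1)) ℂ := (aeval F).toLinearMap ∘ₗ p6_lf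
  let Q : Polynomial (MvPolynomial (Fin (n + 1)) ℂ) := (Polynomial.C (p7_L h e) +
    Polynomial.C (p7_L h g) * Polynomial.X - Polynomial.C (C (1/2) * p7_L h f) * Polynomial.X ^ 2) ^ q
  have hQ : ∀ s : ℂ, A.eval s ≠ 0 → Q.eval (algebraMap ℂ _ s) ∈ LinearMap.range Λ := by
    intro s hsA
    have hfe : B f e = 1 := by rw [hs, hef]
    have heg : B e g = 0 := by rw [hs, hge]
    have hfg : B f g = 0 := by rw [hs, hgf]
    obtain ⟨c, hc⟩ := p7_step hq hhom hF hinv hs hB (e := p7_es e f g s) (f := f) (by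
      simp [p7_es, hee, hff, hef, hge, hgf, hgg, hfe, heg, hfg]; ring) hff (by
      simp [p7_es, hee, hff, hef, hge, hgf, hgg, hfe]) (hA2 s hsA)
    refine ⟨c, ?_⟩
    show aeval F (p6_lf c) = _
    rw [← hc]
    apply MvPolynomial.funext
    intro p
    simp only [Q, Polynomial.eval_pow, Polynomial.eval_sub, Polynomial.eval_add, Polynomial.eval_mul,
      Polynomial.eval_C, Polynomial.eval_X, map_pow, map_sub, map_add, map_mul, p7_L_eval hB,
      algebraMap_eq, eval_C, p7_es, map_smul, LinearMap.sub_apply, LinearMap.add_apply,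
      LinearMap.smul_apply, smul_eq_mul]
    congr 1; ring
  have q0 := p7_coeff (LinearMap.range Λ) Q hA hQ 0
  have q1 := p7_coeff (LinearMap.range Λ) Q hA hQ 1
  have hq0 : Q.coeff 0 = p7_L h e ^ q := by
    rw [Polynomial.coeff_zero_eq_eval_zero]; simp [Q]
  have hq1 : Q.coeff 1 = (q : ℂ) • (p7_L h e ^ (q - 1) * p7_L h g) := by
    have : Q.coeff 1 = (Polynomial.derivative Q).coeff 0 := by
      rw [Polynomial.coeff_derivative]; simp
    rw [this, Polynomial.coeff_zero_eq_eval_zero]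
    simp only [Q, Polynomial.derivative_pow]
    simp [MvPolynomial.smul_eq_C_mul]; ring
  rw [hq0] at q0
  rw [hq1] at q1
  have q2 := (LinearMap.range Λ).smul_mem (q : ℂ)⁻¹ q1
  rw [smul_smul, inv_mul_cancel₀ (by exact_mod_cast (by omega : q ≠ 0)), one_smul] at q2
  obtain ⟨c1, hc1⟩ := q0
  obtain ⟨c2, hc2⟩ := q2
  have hc1 : aeval F (p6_lf c1) = p7_L h e ^ q := hc1
  have hc2 : aeval F (p6_lf c2) = p7_L h e ^ (q - 1) * p7_L h g := hc2
  have hLe : eval f (p7_L h e) = 1 := by rw [p7_L_eval hB, hef]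
  have hLe0 : p7_L h e ≠ 0 := by intro h0; rw [h0] at hLe; simp at hLe
  have hpow : p7_L h e ^ q = p7_L h e ^ (q - 1) * p7_L h e := by
    rw [← pow_succ]; congr 1; omega
  have hfin := p2_low_li hF ![p6_lf c2, - p6_lf c1] ![p7_L h e, p7_L h g] 1 (by omega) (by
    intro i; fin_cases i
    · exact p7_L_hom hhom e
    · exact p7_L_hom hhom g) (by
    rw [Fin.sum_univ_two]
    show p7_L h e * aeval F (p6_lf c2) + p7_L h g * aeval F (- p6_lf c1) = 0
    rw [map_neg, hc1, hc2, hpow]; ring) (by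
    rw [LinearIndependent.pair_iff]
    intro α β hαβ
    have h1 := congrArg (aeval F) hαβ
    simp only [map_add, map_smul, map_neg, hc1, hc2, hpow, map_zero] at h1
    have h2 : p7_L h e ^ (q - 1) * (C α * p7_L h g - C β * p7_L h e) = 0 := by
      rw [← h1]; simp only [MvPolynomial.smul_eq_C_mul]; ring
    have h3 := (mul_eq_zero.mp h2).resolve_left (pow_ne_zero _ hLe0)
    have h4 := congrArg (eval g) h3
    have h5 := congrArg (eval f) h3
    simp only [map_sub, map_mul, eval_C, p7_L_eval hB, hgg, hgf, hs e g, hge, hef, map_zero] at h4 h5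
    constructor
    · linear_combination h4
    · linear_combination -h5)
  exact hLe0 (hfin 0)

end

/-- A totally invariant irreducible hypersurface of `ℙⁿ` (`n ≥ 2`) with at most isolated
singularities (Jacobian ring of Krull dimension `≤ 1`) is a hyperplane. -/
theorem isolated_singularities_linear (n : ℕ) (hn : 2 ≤ n) (d : ℕ)
    (h : MvPolynomial (Fin (n + 1)) ℂ) (hirr : Irreducible h) (hhom : h.IsHomogeneous d)
    (hdim : ringKrullDim (MvPolynomial (Fin (n + 1)) ℂ ⧸ jacobianIdeal (n + 1) h) ≤ 1)
    (hinv : IsTotallyInvariant (n + 1) h) :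
    d = 1 := by
  by_contra hd1
  have hd0 : d ≠ 0 := by
    rintro rfl
    have := hhom.totalDegree hirr.ne_zero
    rw [totalDegree_eq_zero_iff_eq_C] at this
    apply hirr.not_isUnit
    have h0 : coeff 0 h ≠ 0 := by
      intro h0; rw [h0, map_zero] at this; exact hirr.ne_zero this
    rw [this]
    exact (IsUnit.mk0 _ h0).map C
  have hd : 2 ≤ d := by omega
  obtain ⟨h, q, F, lam, g0, hirr, hhom, hq, hF, hlam, hinv, hG⟩ :=
    p5_wlog hd h hirr hhom hdim hinv
  have hne : ∃ i, pderiv i h ≠ 0 := by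
    by_contra hcon
    push Not at hcon
    have h1 := hhom.sum_X_mul_pderiv
    simp only [hcon, mul_zero, Finset.sum_const_zero, nsmul_eq_mul] at h1
    rcases mul_eq_zero.mp h1.symm with h2 | h2
    · exact hd0 (by exact_mod_cast h2)
    · exact hirr.ne_zero h2
  rcases Nat.lt_or_ge d 3 with h3 | h3
  · obtain rfl : d = 2 := by omega
    exact p7_main hq hirr hhom hF hinv hG
  · have hR := p4_main (m := d - 1) (by omega) hq hF hinv (fun i => hhom.pderiv) hne
    obtain ⟨hm, rfl, v1, v2, k1, k2, hi⟩ := p5_main (a := fun i => pderiv i h) hn (by omega) hG hR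
    rw [hm] at hG
    exact p6_main (by omega) hirr hhom hG k1 k2 hi
end

section
/- Let n ≥ 3 and let h ∈ ℂ[X₀,…,Xₙ] be an irreducible homogeneous polynomial of degree 2. Then the quadric X = {h = 0} ⊂ ℙⁿ(ℂ) is not totally invariant: for every endomorphism (F₀,…,Fₙ) of ℙⁿ of algebraic degree q ≥ 2 and every λ ∈ ℂ∖{0}, one has h(F₀,…,Fₙ) ≠ λ·h^q. -/
open MvPolynomial

lemma mono_cancel {r N : ℕ} (i : Fin r) (d : MvPolynomial (Fin r) ℂ)
    (hd : X i * d ∈ Ideal.span ((fun l : Fin r => (X l : MvPolynomial (Fin r) ℂ) ^ N) '' {l | l ≠ i})) :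
    d ∈ Ideal.span ((fun l : Fin r => (X l : MvPolynomial (Fin r) ℂ) ^ N) '' {l | l ≠ i}) := by
  have key : ((fun l : Fin r => (X l : MvPolynomial (Fin r) ℂ) ^ N) '' {l | l ≠ i})
      = (fun s => monomial s (1:ℂ)) '' ((fun l => Finsupp.single l N) '' {l | l ≠ i}) := by
    rw [Set.image_image]
    simp [X_pow_eq_monomial]
  rw [key, mem_ideal_span_monomial_image] at hd ⊢
  intro xi hxi
  obtain ⟨s, ⟨l, hl, rfl⟩, hs⟩ := hd (Finsupp.single i 1 + xi) (by
    rw [mem_support_iff, coeff_X_mul]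
    exact mem_support_iff.1 hxi)
  refine ⟨_, ⟨l, hl, rfl⟩, ?_⟩
  rw [Finsupp.single_le_iff] at hs ⊢
  simpa [Finsupp.single_apply, Ne.symm hl] using hs

lemma mulVec_mem {r : ℕ} {R : Type*} [CommRing R] (I : Ideal R) (A : Matrix (Fin r) (Fin r) R)
    (v : Fin r → R) (hv : ∀ l, v l ∈ I) (k : Fin r) : A.mulVec v k ∈ I := by
  show ∑ l, A k l * v l ∈ I
  exact Ideal.sum_mem _ fun l _ => Ideal.mul_mem_left _ _ (hv l)

lemma row_change {r N : ℕ} (M : Matrix (Fin r) (Fin r) (MvPolynomial (Fin r) ℂ))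
    (i : Fin r) (u : Fin r → MvPolynomial (Fin r) ℂ)
    (hM : ∀ l, M.mulVec X l = X l ^ N) (hu : u ⬝ᵥ X = X i ^ N) :
    (M.updateRow i u).det - M.det ∈
      Ideal.span (Set.range (fun l : Fin r => (X l : MvPolynomial (Fin r) ℂ) ^ N)) := by
  have h1 : (M.updateRow i u).det - M.det = (M.updateRow i (u - M i)).det := by
    have := Matrix.det_updateRow_add M i (u - M i) (M i)
    rw [sub_add_cancel, Matrix.updateRow_eq_self] at this
    rw [this]; ring
  rw [h1]
  set M' := M.updateRow i (u - M i) with hM'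
  have h2 : ∀ l, M'.mulVec X l = if l = i then 0 else X l ^ N := by
    intro l
    by_cases hl : l = i
    · subst hl
      have : M l ⬝ᵥ X = X l ^ N := hM l
      have e : M' l = u - M l := by rw [hM', Matrix.updateRow_self]
      show M' l ⬝ᵥ X = _
      rw [e, sub_dotProduct, hu, this]; simp
    · have : M l ⬝ᵥ X = X l ^ N := hM l
      simp [hM', Matrix.mulVec, hl, this]
  refine Ideal.span_mono (Set.image_subset_range _ {l | l ≠ i}) (mono_cancel i _ ?_)
  have h3 : M'.adjugate.mulVec (M'.mulVec X) i = X i * M'.det := by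
    rw [Matrix.mulVec_mulVec, Matrix.adjugate_mul, Matrix.smul_mulVec, Matrix.one_mulVec]
    simp [mul_comm]
  rw [← h3]
  refine mulVec_mem _ _ _ (fun l => ?_) _
  rw [h2]
  split_ifs with hl
  · exact Ideal.zero_mem _
  · exact Ideal.subset_span ⟨l, hl, rfl⟩

lemma det_sub_prod {r N : ℕ} (M : Matrix (Fin r) (Fin r) (MvPolynomial (Fin r) ℂ))
    (hM : ∀ l, M.mulVec X l = X l ^ (N+1)) :
    (∏ l : Fin r, (X l : MvPolynomial (Fin r) ℂ) ^ N) - M.det ∈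
      Ideal.span (Set.range (fun l : Fin r => (X l : MvPolynomial (Fin r) ℂ) ^ (N+1))) := by
  classical
  set D : Matrix (Fin r) (Fin r) (MvPolynomial (Fin r) ℂ) := Matrix.diagonal fun l => X l ^ N with hD
  have hDx : ∀ l, D.mulVec X l = X l ^ (N+1) := by
    intro l; simp [hD, Matrix.mulVec_diagonal, pow_succ]
  let P : Finset (Fin r) → Matrix (Fin r) (Fin r) (MvPolynomial (Fin r) ℂ) :=
    fun T => Matrix.of fun i => if i ∈ T then D i else M i
  have hP : ∀ T l, (P T).mulVec X l = X l ^ (N+1) := by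
    intro T l
    by_cases hl : l ∈ T
    · have := hDx l
      simpa [P, Matrix.mulVec, hl] using this
    · have := hM l
      simpa [P, Matrix.mulVec, hl] using this
  have key : ∀ T, (P T).det - M.det ∈
      Ideal.span (Set.range (fun l : Fin r => (X l : MvPolynomial (Fin r) ℂ) ^ (N+1))) := by
    intro T
    induction T using Finset.induction_on with
    | empty => simp [P]; exact (sub_self M.det) ▸ Ideal.zero_mem _
    | insert i T hi ih =>
      have e : P (insert i T) = (P T).updateRow i (D i) := by
        ext a b
        by_cases ha : a = i
        · subst ha; simp [P]
        · simp [P, ha]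
      have := row_change (P T) i (D i) (hP T) (hDx i)
      rw [e]
      have := Ideal.add_mem _ this ih
      simpa using this
  have := key Finset.univ
  have e : P Finset.univ = D := by ext a b; simp [P]
  rw [e, hD, Matrix.det_diagonal] at this
  exact this

lemma det_notMem {r N : ℕ} (A : Matrix (Fin r) (Fin r) (MvPolynomial (Fin r) ℂ))
    (hN : ∀ i, (X i : MvPolynomial (Fin r) ℂ) ^ (N+1) ∈ Ideal.span (Set.range (A.mulVec X))) :
    A.det ∉ Ideal.span (Set.range (A.mulVec X)) := by
  intro hdet
  have : ∀ i, ∃ c : Fin r → MvPolynomial (Fin r) ℂ, ∑ k, c k * A.mulVec X k = X i ^ (N+1) := by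
    intro i
    exact (Ideal.mem_span_range_iff_exists_fun).1 (hN i)
  choose c hc using this
  let Cm : Matrix (Fin r) (Fin r) (MvPolynomial (Fin r) ℂ) := Matrix.of c
  have h1 : ∀ l, (Cm * A).mulVec X l = X l ^ (N+1) := by
    intro l
    rw [← Matrix.mulVec_mulVec, ← hc l]; rfl
  have h2 := det_sub_prod _ h1
  have h3 : (Cm * A).det ∈
      Ideal.span (Set.range (fun l : Fin r => (X l : MvPolynomial (Fin r) ℂ) ^ (N+1))) := by
    rw [Matrix.det_mul]
    obtain ⟨d, hd⟩ := (Ideal.mem_span_range_iff_exists_fun).1 hdet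
    rw [← hd, Finset.mul_sum]
    refine Ideal.sum_mem _ fun k _ => ?_
    have : Cm.adjugate.mulVec ((Cm * A).mulVec X) k = Cm.det * A.mulVec X k := by
      rw [← Matrix.mulVec_mulVec, Matrix.mulVec_mulVec, Matrix.adjugate_mul, Matrix.smul_mulVec,
        Matrix.one_mulVec]
      simp
    rw [show Cm.det * (d k * A.mulVec X k) = d k * (Cm.det * A.mulVec X k) by ring, ← this]
    refine Ideal.mul_mem_left _ _ (mulVec_mem _ _ _ (fun l => ?_) _)
    rw [h1]
    exact Ideal.subset_span ⟨l, rfl⟩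
  have h4 := Ideal.add_mem _ h2 h3
  rw [sub_add_cancel] at h4
  have key : (Set.range (fun l : Fin r => (X l : MvPolynomial (Fin r) ℂ) ^ (N+1)))
      = (fun s => monomial s (1:ℂ)) '' (Set.range (fun l => Finsupp.single l (N+1))) := by
    rw [← Set.range_comp]
    congr 1; ext1 l
    simp [X_pow_eq_monomial]
  have e : (∏ l : Fin r, (X l : MvPolynomial (Fin r) ℂ) ^ N)
      = monomial (∑ l : Fin r, Finsupp.single l N) (1:ℂ) := by
    simp [X_pow_eq_monomial, monomial_sum_one]
  rw [key, mem_ideal_span_monomial_image, e] at h4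
  obtain ⟨s, ⟨l, rfl⟩, hs⟩ := h4 (∑ l : Fin r, Finsupp.single l N) (by
    classical
    rw [mem_support_iff, coeff_monomial]; simp)
  rw [Finsupp.single_le_iff] at hs
  simp [Finsupp.finsetSum_apply, Finsupp.single_apply] at hs

lemma chain_rule {m n : ℕ} (G : Fin m → MvPolynomial (Fin n) ℂ) (h : MvPolynomial (Fin m) ℂ)
    (i : Fin n) :
    pderiv i (aeval G h) = ∑ k, aeval G (pderiv k h) * pderiv i (G k) := by
  classical
  induction h using MvPolynomial.induction_on with
  | C a => simp
  | add p q hp hq => simp only [map_add, hp, hq, add_mul, Finset.sum_add_distrib]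
  | mul_X p j hp =>
    simp only [map_mul, Derivation.leibniz, map_add, smul_eq_mul, aeval_X, hp, pderiv_X,
      add_mul, Finset.sum_add_distrib, Finset.mul_sum]
    congr 1
    · simp [Pi.single_apply]
    · refine Finset.sum_congr rfl fun k _ => by ring

lemma nullst {r : ℕ} (G : Fin r → MvPolynomial (Fin r) ℂ)
    (hG : ∀ x : Fin r → ℂ, (∀ i, eval x (G i) = 0) → x = 0) :
    ∃ N : ℕ, ∀ i, (X i : MvPolynomial (Fin r) ℂ) ^ (N+1) ∈ Ideal.span (Set.range G) := by
  have : ∀ i, ∃ N : ℕ, (X i : MvPolynomial (Fin r) ℂ) ^ N ∈ Ideal.span (Set.range G) := by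
    intro i
    have : (X i : MvPolynomial (Fin r) ℂ) ∈ (Ideal.span (Set.range G)).radical := by
      rw [← vanishingIdeal_zeroLocus_eq_radical (K := ℂ)]
      rw [mem_vanishingIdeal_iff]
      intro x hx
      have : x = 0 := hG x fun i => by
        have := (mem_zeroLocus_iff).1 hx (G i) (Ideal.subset_span ⟨i, rfl⟩)
        simpa [aeval_eq_eval] using this
      simp [this]
    exact this
  choose N hN using this
  refine ⟨∑ i, N i, fun i => ?_⟩
  have : N i ≤ ∑ i, N i + 1 := le_trans (Finset.single_le_sum (f := N) (fun _ _ => Nat.zero_le _) (Finset.mem_univ i)) (Nat.le_succ _)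
  exact Ideal.pow_mem_of_pow_mem _ (hN i) this

lemma hom_eval_smul {r m : ℕ} {p : MvPolynomial (Fin r) ℂ} (hp : p.IsHomogeneous m) (t : ℂ)
    (x : Fin r → ℂ) : eval (t • x) p = t ^ m * eval x p := by
  rw [eval_eq, eval_eq, Finset.mul_sum]
  refine Finset.sum_congr rfl fun d hd => ?_
  have : ∑ i ∈ d.support, d i = m := by
    have := hp (mem_support_iff.1 hd)
    simpa [Finsupp.weight_apply, Finsupp.sum] using this
  simp only [Pi.smul_apply, smul_eq_mul, mul_pow, Finset.prod_mul_distrib]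
  rw [Finset.prod_pow_eq_pow_sum, this]
  ring

lemma mem_vars_of_eval_zero {r : ℕ} (p : MvPolynomial (Fin r) ℂ) (hp : eval 0 p = 0) :
    p ∈ Ideal.span (Set.range (X : Fin r → MvPolynomial (Fin r) ℂ)) := by
  rw [← Set.image_univ, mem_ideal_span_X_image]
  intro m hm
  by_contra hcon
  push Not at hcon
  have : m = 0 := by ext i; simpa using hcon i (Set.mem_univ i)
  subst this
  rw [mem_support_iff, ← constantCoeff_eq] at hm
  apply hm
  rw [← hp]
  simp [constantCoeff_eq]

theorem core {r q : ℕ} (hr : 3 ≤ r) (hq : 2 ≤ q) (h : MvPolynomial (Fin r) ℂ)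
    (hirr : Irreducible h) (hhom : h.IsHomogeneous 2)
    (H : Matrix (Fin r) (Fin r) ℂ) (hH : IsUnit H.det)
    (hd : ∀ i, pderiv i h = ∑ j, C (H i j) * X j)
    (G : Fin r → MvPolynomial (Fin r) ℂ) (hG : ∀ i, (G i).IsHomogeneous q)
    (hz : ∀ x : Fin r → ℂ, (∀ i, eval x (G i) = 0) → x = 0)
    (lam : ℂ) (hlam : lam ≠ 0) (heq : aeval G h = C lam * h ^ q) : False := by
  classical
  obtain ⟨N, hN⟩ := nullst G hz
  set I := Ideal.span (Set.range G) with hI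
  let J : Matrix (Fin r) (Fin r) (MvPolynomial (Fin r) ℂ) := Matrix.of fun k i => pderiv i (G k)
  let H' : Matrix (Fin r) (Fin r) (MvPolynomial (Fin r) ℂ) := H.map C
  let K : Matrix (Fin r) (Fin r) (MvPolynomial (Fin r) ℂ) := H⁻¹.map C
  have hKH : K * H' = 1 := by
    show (H⁻¹).map C * H.map C = 1
    rw [← Matrix.map_mul, Matrix.nonsing_inv_mul _ hH]
    exact Matrix.map_one _ (map_zero _) (map_one _)
  have hGI : ∀ l, G l ∈ I := fun l => Ideal.subset_span ⟨l, rfl⟩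
  have hprime : Prime h := hirr.prime
  have hq0 : (q : ℂ) ≠ 0 := by exact_mod_cast (by omega : q ≠ 0)
  -- the basic identity
  have hid : ∀ i, (J.transpose).mulVec (H'.mulVec G) i
      = C (lam * q) * h ^ (q-1) * H'.mulVec X i := by
    intro i
    have h1 : pderiv i (aeval G h) = (J.transpose).mulVec (H'.mulVec G) i := by
      rw [chain_rule]
      refine Finset.sum_congr rfl fun k _ => ?_
      rw [hd, mul_comm]
      simp [J, H', Matrix.mulVec, dotProduct]
    rw [← h1, heq, pderiv_C_mul, pderiv_pow, hd]
    simp only [H', Matrix.mulVec, dotProduct, Matrix.map_apply, C_mul, map_natCast]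
    ring
  -- h^{q-1} X_i in I
  have hXi : ∀ i, h ^ (q-1) * X i ∈ I := by
    intro i
    have h1 : ∀ l, (C (lam * q) * h ^ (q-1)) * H'.mulVec X l ∈ I := by
      intro l
      rw [← hid]
      refine mulVec_mem _ _ _ (fun l => mulVec_mem _ _ _ (fun l => hGI l) _) _
    have h2 : K.mulVec ((C (lam * q) * h ^ (q-1)) • H'.mulVec X) i
        = (C (lam * q) * h ^ (q-1)) * X i := by
      rw [Matrix.mulVec_smul, Matrix.mulVec_mulVec, hKH, Matrix.one_mulVec]; rfl
    have h3 := mulVec_mem I K _ h1 i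
    have h4 : (C (lam * q) * h ^ (q-1)) * X i ∈ I := h2 ▸ h3
    have h5 := Ideal.mul_mem_left I (C (lam * q)⁻¹) h4
    rwa [← mul_assoc, ← mul_assoc, ← C_mul, inv_mul_cancel₀ (mul_ne_zero hlam hq0), C_1, one_mul] at h5
  -- some component not divisible
  have hnd : ∃ k, ¬ h ∣ H'.mulVec G k := by
    by_contra hcon
    push Not at hcon
    have h1 : ∀ k, G k ∈ Ideal.span {h} := by
      intro k
      have : K.mulVec (H'.mulVec G) k = G k := by
        rw [Matrix.mulVec_mulVec, hKH, Matrix.one_mulVec]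
      rw [← this]
      exact mulVec_mem _ _ _ (fun l => Ideal.mem_span_singleton.2 (hcon l)) _
    have h2 : I ≤ Ideal.span {h} := by
      rw [hI, Ideal.span_le]; rintro _ ⟨k, rfl⟩; exact h1 k
    have h3 := h2 (hN ⟨0, by omega⟩)
    have h4 := hprime.dvd_of_dvd_pow (Ideal.mem_span_singleton.1 h3)
    obtain ⟨c, hc⟩ := h4
    have hc0 : c ≠ 0 := by rintro rfl; simp at hc
    have := congrArg totalDegree hc
    rw [totalDegree_mul_of_isDomain hprime.ne_zero hc0, totalDegree_X, hhom.totalDegree hprime.ne_zero] at this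
    omega
  obtain ⟨k, hk⟩ := hnd
  have hdvd : h ^ (q-1) ∣ J.det := by
    refine hprime.pow_dvd_of_dvd_mul_left _ hk ?_
    have h1 : J.transpose.adjugate.mulVec (J.transpose.mulVec (H'.mulVec G)) k
        = H'.mulVec G k * J.det := by
      rw [Matrix.mulVec_mulVec, Matrix.adjugate_mul, Matrix.smul_mulVec, Matrix.one_mulVec,
        Matrix.det_transpose]
      simp [mul_comm]
    rw [← h1, ← Ideal.mem_span_singleton]
    refine mulVec_mem _ _ _ (fun l => ?_) _
    rw [hid, Ideal.mem_span_singleton]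
    exact ⟨C (lam * q) * H'.mulVec X l, by ring⟩
  obtain ⟨Q, hQ⟩ := hdvd
  have hQ0 : eval 0 Q = 0 := by
    obtain ⟨x, hx⟩ : ∃ x, eval x h ≠ 0 := by
      by_contra hcon
      push Not at hcon
      exact hprime.ne_zero (MvPolynomial.funext fun x => by simpa using hcon x)
    have hJt : ∀ t : ℂ, eval (t • x) J.det = t ^ ((q-1) * r) * eval x J.det := by
      intro t
      rw [RingHom.map_det, RingHom.map_det]
      have : (eval (t • x)).mapMatrix J = (t ^ (q-1)) • (eval x).mapMatrix J := by
        ext a b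
        simp only [RingHom.mapMatrix_apply, Matrix.map_apply, Matrix.smul_apply, smul_eq_mul, J,
          Matrix.of_apply]
        exact hom_eval_smul ((hG a).pderiv) t x
      rw [this, Matrix.det_smul, Fintype.card_fin, ← pow_mul]
    have key : (fun t : ℂ => t ^ ((q-1) * (r-2)) * eval x J.det)
        = fun t : ℂ => eval x h ^ (q-1) * eval (t • x) Q := by
      refine Continuous.ext_on (dense_compl_singleton (0:ℂ)) (by fun_prop) ?_ ?_
      · exact continuous_const.mul ((MvPolynomial.continuous_eval Q).comp (by fun_prop))
      · intro t ht
        have ht : t ≠ 0 := ht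
        have e := hJt t
        rw [hQ, map_mul, map_pow, hom_eval_smul hhom] at e
        have e2 : (q-1) * r = 2 * (q-1) + (q-1) * (r-2) := by
          obtain ⟨r, rfl⟩ := Nat.exists_eq_add_of_le hr
          rw [show 3 + r - 2 = 1 + r by omega]; ring
        rw [e2, pow_add, mul_pow, ← pow_mul, mul_assoc, mul_assoc] at e
        have := mul_left_cancel₀ (pow_ne_zero _ ht) e
        rw [← hQ] at this
        exact this.symm
    have := congrFun key 0
    have hne : (q-1) * (r-2) ≠ 0 := Nat.mul_ne_zero (by omega) (by omega)
    simp only [zero_pow hne, zero_mul, zero_smul] at this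
    exact (mul_eq_zero.1 this.symm).resolve_left (pow_ne_zero _ hx)
  have hdet : J.det ∈ I := by
    rw [hQ]
    obtain ⟨c, hc⟩ := (Ideal.mem_span_range_iff_exists_fun).1 (mem_vars_of_eval_zero Q hQ0)
    rw [← hc, Finset.mul_sum]
    refine Ideal.sum_mem _ fun i _ => ?_
    rw [show h ^ (q-1) * (c i * X i) = c i * (h ^ (q-1) * X i) by ring]
    exact Ideal.mul_mem_left _ _ (hXi i)
  have hJX : J.mulVec X = fun k => C (q : ℂ) * G k := by
    ext1 k
    have := (hG k).sum_X_mul_pderiv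
    rw [nsmul_eq_mul] at this
    rw [map_natCast, ← this]
    show ∑ i, J k i * X i = _
    refine Finset.sum_congr rfl fun i _ => by rw [mul_comm]; rfl
  have hspan : Ideal.span (Set.range (J.mulVec X)) = I := by
    rw [hJX]
    apply le_antisymm
    · rw [Ideal.span_le]; rintro _ ⟨k, rfl⟩
      exact Ideal.mul_mem_left _ _ (Ideal.subset_span ⟨k, rfl⟩)
    · rw [hI, Ideal.span_le]; rintro _ ⟨k, rfl⟩
      have : C ((q:ℂ)⁻¹) * (C (q : ℂ) * G k) ∈ Ideal.span (Set.range fun k => C (q : ℂ) * G k) :=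
        Ideal.mul_mem_left _ _ (Ideal.subset_span ⟨k, rfl⟩)
      rwa [← mul_assoc, ← C_mul, inv_mul_cancel₀ hq0, C_1, one_mul] at this
  exact det_notMem (N := N) J (by rw [hspan]; exact hN) (by rw [hspan]; exact hdet)

lemma comp_mul {r q d : ℕ} (a F : MvPolynomial (Fin r) ℂ) (hF : F.IsHomogeneous q) (hqd : q ≤ d) :
    ∃ b : MvPolynomial (Fin r) ℂ, b.IsHomogeneous (d - q) ∧
      homogeneousComponent d (a * F) = b * F := by
  refine ⟨∑ i ∈ Finset.range (a.totalDegree + 1),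
    if i + q = d then homogeneousComponent i a else 0, ?_, ?_⟩
  · refine IsHomogeneous.sum _ _ _ fun i _ => ?_
    split_ifs with hi
    · have : i = d - q := by omega
      subst this
      exact homogeneousComponent_isHomogeneous _ _
    · exact isHomogeneous_zero _ _ _
  · conv_lhs => rw [← sum_homogeneousComponent a]
    rw [Finset.sum_mul, map_sum, Finset.sum_mul]
    refine Finset.sum_congr rfl fun i _ => ?_
    have := (homogeneousComponent_isHomogeneous i a).mul hF
    rw [homogeneousComponent_of_mem (m := d) this]
    split_ifs <;> first | rfl | omega

lemma integral {r q : ℕ} (hq : 1 ≤ q) (F : Fin r → MvPolynomial (Fin r) ℂ)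
    (hF : ∀ i, (F i).IsHomogeneous q)
    (hz : ∀ x : Fin r → ℂ, (∀ i, eval x (F i) = 0) → x = 0) :
    Algebra.IsIntegral (Algebra.adjoin ℂ (Set.range F)) (MvPolynomial (Fin r) ℂ) := by
  obtain ⟨N, hN⟩ := nullst F hz
  set A := Algebra.adjoin ℂ (Set.range F) with hA
  let D := r * N + q
  let S : Set (MvPolynomial (Fin r) ℂ) := (fun m => monomial m (1:ℂ)) '' {m : Fin r →₀ ℕ | m.degree ≤ D}
  have hSfin : S.Finite := (Finsupp.finite_of_degree_le D).image _
  let T : Submodule A (MvPolynomial (Fin r) ℂ) := Submodule.span A S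
  have hC : ∀ (c : ℂ) p, p ∈ T → C c * p ∈ T := by
    intro c p hp
    have := T.smul_mem (algebraMap ℂ A c) hp
    exact this
  have hbig : ∀ p : MvPolynomial (Fin r) ℂ, ∀ d, D < d → p.IsHomogeneous d →
      p ∈ Ideal.span (Set.range F) := by
    intro p d hd hp
    rw [p.as_sum]
    refine Ideal.sum_mem _ fun m hm => ?_
    have hdeg : ∑ i, m i = d := by
      have := hp (mem_support_iff.1 hm)
      rw [← this, Finsupp.weight_apply, Finsupp.sum_fintype _ _ (by simp)]
      simp
    obtain ⟨i, hi⟩ : ∃ i, N + 1 ≤ m i := by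
      by_contra hcon
      push Not at hcon
      have : ∑ i, m i ≤ ∑ _i : Fin r, N := Finset.sum_le_sum fun i _ => by have := hcon i; omega
      simp at this
      omega
    have : monomial m (coeff m p) = monomial (m - Finsupp.single i (N+1)) (coeff m p) * X i ^ (N+1) := by
      rw [X_pow_eq_monomial, monomial_mul, mul_one, tsub_add_cancel_of_le]
      rwa [Finsupp.single_le_iff]
    rw [this]
    exact Ideal.mul_mem_left _ _ (hN i)
  have hall : ∀ d, ∀ p : MvPolynomial (Fin r) ℂ, p.IsHomogeneous d → p ∈ T := by
    intro d
    induction d using Nat.strong_induction_on with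
    | _ d ih =>
      intro p hp
      by_cases hd : d ≤ D
      · rw [p.as_sum]
        refine Submodule.sum_mem _ fun m hm => ?_
        have e : monomial m (coeff m p) = C (coeff m p) * monomial m 1 := by
          rw [C_mul_monomial, mul_one]
        rw [e]
        refine hC _ _ (Submodule.subset_span ⟨m, ?_, rfl⟩)
        have := hp (mem_support_iff.1 hm)
        have h2 : m.degree = d := by rw [Finsupp.degree_eq_weight_one]; exact this
        show m.degree ≤ D
        omega
      · obtain ⟨a, ha⟩ := (Ideal.mem_span_range_iff_exists_fun).1 (hbig p d (by omega) hp)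
        have hqd : q ≤ d := by omega
        choose b hb1 hb2 using fun k => comp_mul (a k) (F k) (hF k) hqd
        have : p = ∑ k, b k * F k := by
          rw [← homogeneousComponent_eq_self hp, ← ha, map_sum]
          exact Finset.sum_congr rfl fun k _ => hb2 k
        rw [this]
        refine Submodule.sum_mem _ fun k _ => ?_
        have hk := ih (d - q) (by omega) (b k) (hb1 k)
        have := T.smul_mem (⟨F k, Algebra.subset_adjoin ⟨k, rfl⟩⟩ : A) hk
        rw [mul_comm]
        exact this
  have hT : T = ⊤ := by
    rw [eq_top_iff]
    intro p _
    rw [← sum_homogeneousComponent p]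
    exact Submodule.sum_mem _ fun i _ => hall i _ (homogeneousComponent_isHomogeneous _ _)
  have : Module.Finite A (MvPolynomial (Fin r) ℂ) := ⟨⟨hSfin.toFinset, by simpa using hT⟩⟩
  infer_instance

lemma exists_rel {r q s k : ℕ} (hq : 1 ≤ q) (F : Fin r → MvPolynomial (Fin r) ℂ)
    (hF : ∀ i, (F i).IsHomogeneous q)
    (hz : ∀ x : Fin r → ℂ, (∀ i, eval x (F i) = 0) → x = 0)
    (B : Matrix (Fin r) (Fin s) ℂ) (Cm : Matrix (Fin s) (Fin r) ℂ)
    (hsk : s < k) (z : Fin k → MvPolynomial (Fin r) ℂ) :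
    ∃ P : MvPolynomial (Fin k) ℂ, P ≠ 0 ∧ ∀ x : Fin r → ℂ,
      (B.mulVec (Cm.mulVec (fun i => eval x (F i))) = fun i => eval x (F i)) →
      eval (fun j => eval x (z j)) P = 0 := by
  by_contra hcon
  push Not at hcon
  let g' : Fin s → MvPolynomial (Fin r) ℂ := fun j => ∑ i, C (Cm j i) * F i
  let u : Fin r → MvPolynomial (Fin r) ℂ := fun i => F i - ∑ j, C (B i j) * g' j
  let I := Ideal.span (Set.range u)
  let M : Submonoid (MvPolynomial (Fin r) ℂ) :=
    (nonZeroDivisors (MvPolynomial (Fin k) ℂ)).map (aeval z : MvPolynomial (Fin k) ℂ →ₐ[ℂ] _)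
  have hev : ∀ (P : MvPolynomial (Fin k) ℂ) (x : Fin r → ℂ),
      eval x (aeval z P) = eval (fun j => eval x (z j)) P := by
    intro P x
    induction P using MvPolynomial.induction_on with
    | C a => simp
    | add p q hp hq => simp only [map_add, hp, hq]
    | mul_X p j hp => simp only [map_mul, hp, aeval_X, eval_X]
  have hdis : Disjoint (I : Set (MvPolynomial (Fin r) ℂ)) M := by
    rw [Set.disjoint_left]
    rintro _ hI ⟨P, hP, rfl⟩
    obtain ⟨x, hx, hne⟩ := hcon P (nonZeroDivisors.ne_zero hP)
    apply hne
    have h1 : I ≤ RingHom.ker (eval x) := by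
      rw [Ideal.span_le]
      rintro _ ⟨i, rfl⟩
      have := congrFun hx i
      simp only [SetLike.mem_coe, RingHom.mem_ker, u, g', map_sub, map_sum, map_mul, eval_C]
      rw [← this]
      exact sub_self _
    have := h1 hI
    rw [RingHom.mem_ker] at this
    rw [← hev]; exact this
  obtain ⟨p, hp, hIp, hpM⟩ := Ideal.exists_le_prime_disjoint I M hdis
  let D := MvPolynomial (Fin r) ℂ ⧸ p
  let mk : MvPolynomial (Fin r) ℂ →ₐ[ℂ] D := Ideal.Quotient.mkₐ ℂ p
  have hind : AlgebraicIndependent ℂ (fun j => mk (z j)) := by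
    rw [algebraicIndependent_iff]
    intro P hP
    by_contra hP0
    have h1 : mk (aeval z P) = 0 := by
      rw [← hP, ← AlgHom.comp_apply, comp_aeval]
    have h2 : aeval z P ∈ p := by
      exact Ideal.Quotient.eq_zero_iff_mem.1 h1
    exact Set.disjoint_left.1 hpM h2 ⟨P, mem_nonZeroDivisors_of_ne_zero hP0, rfl⟩
  let g : Fin s → D := fun j => mk (g' j)
  let A' := Algebra.adjoin ℂ (Set.range g)
  let A := Algebra.adjoin ℂ (Set.range F)
  have hmap : A ≤ A'.comap mk := by
    apply Algebra.adjoin_le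
    rintro _ ⟨i, rfl⟩
    show mk (F i) ∈ A'
    have h1 : mk (u i) = 0 := Ideal.Quotient.eq_zero_iff_mem.2 (hIp (Ideal.subset_span ⟨i, rfl⟩))
    have h2 : mk (F i) = ∑ j, algebraMap ℂ D (B i j) * g j := by
      rw [map_sub, sub_eq_zero] at h1
      rw [h1, map_sum]
      refine Finset.sum_congr rfl fun j _ => ?_
      rw [map_mul]
      congr 1
    rw [h2]
    exact Subalgebra.sum_mem _ fun j _ => Subalgebra.mul_mem _ (Subalgebra.algebraMap_mem _ _)
      (Algebra.subset_adjoin ⟨j, rfl⟩)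
  have hint := integral hq F hF hz
  let φ : A →+* A' := ((mk.comp A.val).codRestrict A' (fun a => hmap a.2)).toRingHom
  have halg : Algebra.IsAlgebraic A' D := by
    constructor
    intro d
    obtain ⟨a, rfl⟩ := Ideal.Quotient.mkₐ_surjective ℂ p d
    have : IsIntegral A a := hint.isIntegral a
    have := IsIntegral.map_of_comp_eq φ mk.toRingHom rfl this
    exact this.isAlgebraic
  have h1 : Algebra.trdeg ℂ D ≤ Cardinal.mk (Set.range g) := Algebra.IsAlgebraic.trdeg_le_cardinalMk ℂ (Set.range g)
  have h2 := hind.cardinalMk_le_trdeg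
  have h3 : Cardinal.mk (Set.range g) ≤ Cardinal.mk (Fin s) := Cardinal.mk_range_le
  have h4 := h2.trans (h1.trans h3)
  simp at h4
  omega

lemma exists_W {r q : ℕ} (hq : 1 ≤ q) (F : Fin r → MvPolynomial (Fin r) ℂ)
    (hF : ∀ i, (F i).IsHomogeneous q)
    (hz : ∀ x : Fin r → ℂ, (∀ i, eval x (F i) = 0) → x = 0)
    (L : Submodule ℂ (Fin r → ℂ)) :
    ∃ W : Submodule ℂ (Fin r → ℂ), IsCompl W L ∧
      ∀ x ∈ W, (fun i => eval x (F i)) ∈ L → x = 0 := by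
  classical
  obtain ⟨ρ, hρ⟩ := LinearMap.exists_leftInverse_of_injective L.subtype (Submodule.ker_subtype L)
  let s := Module.finrank ℂ L
  let b := Module.finBasis ℂ L
  let Cm : Matrix (Fin s) (Fin r) ℂ := LinearMap.toMatrix' (b.equivFun.toLinearMap ∘ₗ ρ)
  let B : Matrix (Fin r) (Fin s) ℂ := LinearMap.toMatrix' (L.subtype ∘ₗ b.equivFun.symm.toLinearMap)
  have hBC : ∀ v ∈ L, B.mulVec (Cm.mulVec v) = v := by
    intro v hv
    have h1 : ρ v = ⟨v, hv⟩ := by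
      have := LinearMap.congr_fun hρ ⟨v, hv⟩
      exact this
    simp only [B, Cm, LinearMap.toMatrix'_mulVec, LinearMap.comp_apply, h1]
    simp
  let Bad : (Fin r → ℂ) → Prop := fun x => (fun i => eval x (F i)) ∈ L ∨ x ∈ L
  have hcone : ∀ (c : ℂ) x, Bad x → Bad (c • x) := by
    rintro c x (hx | hx)
    · left
      have : (fun i => eval (c • x) (F i)) = c ^ q • fun i => eval x (F i) := by
        ext i; exact hom_eval_smul (hF i) c x
      rw [this]; exact L.smul_mem _ hx
    · right; exact L.smul_mem _ hx
  let Good : Set (Submodule ℂ (Fin r → ℂ)) := {W | ∀ x ∈ W, Bad x → x = 0}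
  have hne : Good.Nonempty := ⟨⊥, fun x hx _ => by simpa using hx⟩
  obtain ⟨W, hW, hmax⟩ := (wellFounded_gt (α := Submodule ℂ (Fin r → ℂ))).has_min Good hne
  have hdisj : Disjoint W L := by
    rw [Submodule.disjoint_def]
    intro x hx hxL
    exact hW x hx (Or.inr hxL)
  refine ⟨W, ?_, fun x hx h => hW x hx (Or.inl h)⟩
  have hle : Module.finrank ℂ W + Module.finrank ℂ L ≤ r := by
    have := Submodule.finrank_add_finrank_le_of_disjoint hdisj
    simpa using this
  by_cases hge : r ≤ Module.finrank ℂ W + Module.finrank ℂ L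
  · refine ⟨hdisj, ?_⟩
    rw [codisjoint_iff]
    exact Submodule.eq_top_of_disjoint W L (by simp; omega) hdisj
  exfalso
  let k := Module.finrank ℂ ((Fin r → ℂ) ⧸ W)
  have hk : k + Module.finrank ℂ W = r := by
    have := Submodule.finrank_quotient_add_finrank W
    simpa using this
  have hsk : s < k := by omega
  let ψ : (Fin r → ℂ) →ₗ[ℂ] (Fin k → ℂ) :=
    (Module.finBasis ℂ ((Fin r → ℂ) ⧸ W)).equivFun.toLinearMap ∘ₗ W.mkQ
  have hψs : Function.Surjective ψ :=
    (Module.finBasis ℂ ((Fin r → ℂ) ⧸ W)).equivFun.surjective.comp (Submodule.mkQ_surjective W)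
  have hψW : ∀ w ∈ W, ψ w = 0 := by
    intro w hw
    have : W.mkQ w = 0 := by simpa using hw
    simp only [ψ, LinearMap.comp_apply, this, map_zero]
  let z : Fin k → MvPolynomial (Fin r) ℂ := fun j => ∑ i, C (LinearMap.toMatrix' ψ j i) * X i
  have hzev : ∀ x, (fun j => eval x (z j)) = ψ x := by
    intro x
    rw [← LinearMap.toMatrix'_mulVec ψ x]
    ext j
    simp [z, Matrix.mulVec, dotProduct]
  obtain ⟨P₁, hP₁, h₁⟩ := exists_rel hq F hF hz B Cm hsk z
  obtain ⟨P₂, hP₂, h₂⟩ := exists_rel (le_refl 1) (X : Fin r → MvPolynomial (Fin r) ℂ)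
    (fun i => isHomogeneous_X _ i) (fun x hx => by ext i; simpa using hx i) B Cm hsk z
  have hvan : ∀ u, Bad u → eval (ψ u) (P₁ * P₂) = 0 := by
    rintro u (hu | hu)
    · have := h₁ u (hBC _ hu)
      rw [hzev] at this
      rw [map_mul, this, zero_mul]
    · have := h₂ u (by simpa using hBC _ hu)
      rw [hzev] at this
      rw [map_mul, this, mul_zero]
  apply mul_ne_zero hP₁ hP₂
  refine MvPolynomial.funext fun y => ?_
  rw [map_zero]
  obtain ⟨v, rfl⟩ := hψs y
  by_cases hv : v ∈ W
  · have := hvan 0 (Or.inr L.zero_mem)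
    rwa [map_zero, ← hψW v hv] at this
  have hlt : W < W ⊔ Submodule.span ℂ {v} := by
    refine lt_of_le_of_ne le_sup_left fun e => hv ?_
    rw [e]
    exact Submodule.mem_sup_right (Submodule.mem_span_singleton_self v)
  have hng : W ⊔ Submodule.span ℂ {v} ∉ Good := fun hg => hmax _ hg hlt
  have : ∃ x ∈ W ⊔ Submodule.span ℂ {v}, Bad x ∧ x ≠ 0 := by
    by_contra hcon
    push Not at hcon
    exact hng hcon
  obtain ⟨x, hx, hbad, hx0⟩ := this
  obtain ⟨w, hw, y, hy, rfl⟩ := Submodule.mem_sup.1 hx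
  obtain ⟨c, rfl⟩ := Submodule.mem_span_singleton.1 hy
  have hc : c ≠ 0 := by
    rintro rfl
    apply hx0
    exact hW _ (by simpa using hw) hbad
  have := hvan _ (hcone c⁻¹ _ hbad)
  rwa [map_smul, map_add, hψW w hw, zero_add, map_smul, smul_smul, inv_mul_cancel₀ hc, one_smul] at this

lemma gram {r : ℕ} (h : MvPolynomial (Fin r) ℂ) (hhom : h.IsHomogeneous 2) :
    ∃ H : Matrix (Fin r) (Fin r) ℂ, H.transpose = H ∧
      (∀ i, pderiv i h = ∑ j, C (H i j) * X j) ∧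
      h = C (1/2) * ∑ i, ∑ j, C (H i j) * X j * X i := by
  let H : Matrix (Fin r) (Fin r) ℂ := Matrix.of fun i j => coeff 0 (pderiv j (pderiv i h))
  have hd : ∀ i, pderiv i h = ∑ j, C (H i j) * X j := by
    intro i
    have h1 : (pderiv i h).IsHomogeneous 1 := hhom.pderiv
    have h2 := h1.sum_X_mul_pderiv
    rw [one_smul] at h2
    conv_lhs => rw [← h2]
    refine Finset.sum_congr rfl fun j _ => ?_
    have h3 : (pderiv j (pderiv i h)).IsHomogeneous 0 := h1.pderiv
    rw [← totalDegree_zero_iff_isHomogeneous, totalDegree_eq_zero_iff_eq_C] at h3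
    rw [h3, mul_comm]; rfl
  refine ⟨H, ?_, hd, ?_⟩
  · ext i j
    simp only [Matrix.transpose_apply, H, Matrix.of_apply, coeff_pderiv]
    by_cases hij : i = j
    · subst hij; rfl
    · simp [hij, Ne.symm hij, add_comm]
  · have := hhom.sum_X_mul_pderiv
    have e : h = C (1/2) * (2 • h) := by
      rw [nsmul_eq_mul, ← mul_assoc, show ((2:ℕ) : MvPolynomial (Fin r) ℂ) = C 2 from (map_natCast C 2).symm, ← C_mul]
      norm_num
    conv_lhs => rw [e, ← this]
    congr 1
    refine Finset.sum_congr rfl fun i _ => ?_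
    rw [hd, mul_comm, Finset.sum_mul]

lemma not_irr_mul {r : ℕ} (a b : MvPolynomial (Fin r) ℂ) (ha : eval 0 a = 0) (hb : eval 0 b = 0) :
    ¬ Irreducible (a * b) := by
  intro hirr
  rcases hirr.isUnit_or_isUnit rfl with h | h
  · exact (h.map (eval (0 : Fin r → ℂ))).ne_zero ha
  · exact (h.map (eval (0 : Fin r → ℂ))).ne_zero hb

lemma three_le {r : ℕ} (h : MvPolynomial (Fin r) ℂ) (hhom : h.IsHomogeneous 2)
    (hirr : Irreducible h) : 3 ≤ r := by
  obtain ⟨H, hHs, -, hh⟩ := gram h hhom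
  by_contra hr
  have : r = 0 ∨ r = 1 ∨ r = 2 := by omega
  rcases this with rfl | rfl | rfl
  · apply hirr.ne_zero; rw [hh]; simp
  · have e : h = (C (1/2) * C (H 0 0) * X 0) * X 0 := by
      rw [hh]; simp; ring
    rw [e] at hirr
    exact not_irr_mul _ _ (by simp) (by simp) hirr
  · have hs : H 1 0 = H 0 1 := congrFun (congrFun hHs 0) 1
    simp only [Fin.sum_univ_two, hs] at hh
    set a := H 0 0
    set b := H 0 1
    set c := H 1 1
    by_cases ha : a = 0
    · have e : h = X 1 * (C (1/2) * (2 * C b * X 0 + C c * X 1)) := by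
        rw [hh, ha, C_0]; ring
      rw [e] at hirr
      exact not_irr_mul _ _ (by simp) (by simp) hirr
    · obtain ⟨d, hd⟩ := IsAlgClosed.exists_pow_nat_eq (b^2 - a*c) (n := 2) (by norm_num)
      have e : h = (C (1/2) * C a⁻¹ * (C a * X 0 + C (b + d) * X 1)) * (C a * X 0 + C (b - d) * X 1) := by
        have h1 : (C a⁻¹ * C a : MvPolynomial (Fin 2) ℂ) = 1 := by
          rw [← C_mul, inv_mul_cancel₀ ha, C_1]
        have h2 : (C d ^ 2 : MvPolynomial (Fin 2) ℂ) = C b ^ 2 - C a * C c := by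
          rw [← C_pow, hd]; simp
        rw [hh]
        simp only [map_add, map_sub]
        linear_combination (-C (1/2) * (C a * X 0 ^ 2 + 2 * C b * X 0 * X 1 + C c * X 1 ^ 2)) * h1
          + (C (1/2) * C a⁻¹ * X 1 ^ 2) * h2
      rw [e] at hirr
      exact not_irr_mul _ _ (by simp) (by simp) hirr
lemma eval_substT {m n : ℕ} (z : Fin m → MvPolynomial (Fin n) ℂ) (P : MvPolynomial (Fin m) ℂ)
    (x : Fin n → ℂ) : eval x (aeval z P) = eval (fun j => eval x (z j)) P := by
  induction P using MvPolynomial.induction_on with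
  | C a => simp
  | add p q hp hq => simp only [map_add, hp, hq]
  | mul_X p j hp => simp only [map_mul, hp, aeval_X, eval_X]

/-- The tuple of linear forms of a linear map. -/
noncomputable def linForms {m n : ℕ} (e : (Fin n → ℂ) →ₗ[ℂ] (Fin m → ℂ)) :
    Fin m → MvPolynomial (Fin n) ℂ := fun i => ∑ j, C (LinearMap.toMatrix' e i j) * X j

lemma eval_linForms {m n : ℕ} (e : (Fin n → ℂ) →ₗ[ℂ] (Fin m → ℂ)) (y : Fin n → ℂ) :
    (fun i => eval y (linForms e i)) = e y := by
  rw [← LinearMap.toMatrix'_mulVec e y]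
  ext j
  simp [linForms, Matrix.mulVec, dotProduct]

lemma linForms_hom {m n : ℕ} (e : (Fin n → ℂ) →ₗ[ℂ] (Fin m → ℂ)) (i : Fin m) :
    (linForms e i).IsHomogeneous 1 :=
  IsHomogeneous.sum _ _ _ fun j _ => isHomogeneous_C_mul_X _ _

lemma pderiv_linForms {m n : ℕ} (e : (Fin n → ℂ) →ₗ[ℂ] (Fin m → ℂ)) (i : Fin m) (j : Fin n) :
    pderiv j (linForms e i) = C (LinearMap.toMatrix' e i j) := by
  classical
  simp [linForms, pderiv_X, Pi.single_apply]

/-- No irreducible quadric of `ℙⁿ`, `n ≥ 3`, is totally invariant. -/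
theorem quadric_not_totally_invariant (n : ℕ) (hn : 3 ≤ n)
    (h : MvPolynomial (Fin (n + 1)) ℂ) (hirr : Irreducible h) (hhom : h.IsHomogeneous 2) :
    ∀ q, 2 ≤ q → ∀ F : Fin (n + 1) → MvPolynomial (Fin (n + 1)) ℂ,
      IsEndo (n + 1) q F → ∀ lam : ℂ, lam ≠ 0 → aeval F h ≠ C lam * h ^ q := by
  intro q hq F hF lam hlam heq
  obtain ⟨hFh, hFz⟩ := hF
  obtain ⟨H, hHs, hHd, hHh⟩ := gram h hhom
  let L : Submodule ℂ (Fin (n+1) → ℂ) := LinearMap.ker (Matrix.mulVecLin H)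
  have hL : ∀ x, x ∈ L ↔ H.mulVec x = 0 := fun x => by simp [L]
  obtain ⟨W, hWL, hWF⟩ := exists_W (by omega) F hFh hFz L
  let r := Module.finrank ℂ W
  let b := Module.finBasis ℂ W
  let e : (Fin r → ℂ) →ₗ[ℂ] (Fin (n+1) → ℂ) := W.subtype ∘ₗ b.equivFun.symm.toLinearMap
  let π : (Fin (n+1) → ℂ) →ₗ[ℂ] (Fin r → ℂ) := b.equivFun.toLinearMap ∘ₗ W.projectionOnto L hWL
  have heW : ∀ y, e y ∈ W := fun y => (b.equivFun.symm y).2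
  have hπe : ∀ y, π (e y) = y := by
    intro y
    have h1 : W.projectionOnto L hWL (e y) = b.equivFun.symm y :=
      Submodule.projectionOnto_apply_left hWL (b.equivFun.symm y)
    change b.equivFun (W.projectionOnto L hWL (e y)) = y
    rw [h1, LinearEquiv.apply_symm_apply]
  have heπ : ∀ x, x - e (π x) ∈ L := by
    intro x
    have h1 : e (π x) = W.projectionOnto L hWL x := by simp [π, e]
    rw [h1, ← Submodule.projectionOnto_apply_eq_zero_iff hWL, map_sub,
      Submodule.projectionOnto_apply_left, sub_self]
  have hev : ∀ x, eval x h = 1/2 * (x ⬝ᵥ H.mulVec x) := by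
    intro x
    conv_lhs => rw [hHh]
    simp only [map_mul, map_sum, eval_C, eval_X, dotProduct, Matrix.mulVec, Finset.mul_sum]
    refine Finset.sum_congr rfl fun i _ => Finset.sum_congr rfl fun j _ => by ring
  have hsym : ∀ x y, x ⬝ᵥ H.mulVec y = H.mulVec x ⬝ᵥ y := by
    intro x y
    rw [Matrix.dotProduct_mulVec, ← Matrix.mulVec_transpose, hHs]
  have hinv : ∀ x, eval (e (π x)) h = eval x h := by
    intro x
    have h1 := (hL _).1 (heπ x)
    have h2 : H.mulVec x = H.mulVec (e (π x)) := by
      rwa [Matrix.mulVec_sub, sub_eq_zero] at h1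
    rw [hev, hev, hsym x x, h2, ← hsym _ x, h2]
  let E := linForms e
  let Pm := linForms π
  have hEev : ∀ p y, eval y (aeval E p) = eval (e y) p := by
    intro p y; rw [eval_substT, eval_linForms]
  have hPev : ∀ p x, eval x (aeval Pm p) = eval (π x) p := by
    intro p y; rw [eval_substT, eval_linForms]
  let hW := aeval E h
  have hWhom : hW.IsHomogeneous 2 := by
    have := hhom.aeval E (n := 1) (linForms_hom e)
    rwa [one_mul] at this
  have hback : aeval Pm hW = h := by
    refine MvPolynomial.funext fun x => ?_
    rw [hPev, hEev, hinv]
  have hEP : ∀ p, aeval E (aeval Pm p) = p := by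
    intro p
    refine MvPolynomial.funext fun x => ?_
    rw [hEev, hPev, hπe]
  have hWirr : Irreducible hW := by
    constructor
    · intro hu
      apply hirr.not_isUnit
      rw [← hback]
      exact hu.map (aeval Pm)
    · intro a c hac
      have : h = aeval Pm a * aeval Pm c := by rw [← hback, hac, map_mul]
      rcases hirr.isUnit_or_isUnit this with hu | hu
      · left; rw [← hEP a]; exact hu.map (aeval E)
      · right; rw [← hEP c]; exact hu.map (aeval E)
  have hr : 3 ≤ r := three_le hW hWhom hWirr
  obtain ⟨HW, -, hHWd, -⟩ := gram hW hWhom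
  have hdet : IsUnit HW.det := by
    rw [isUnit_iff_ne_zero]
    intro hdet
    obtain ⟨y, hy0, hy⟩ := Matrix.exists_mulVec_eq_zero_iff.2 hdet
    apply hy0
    have h1 : ∀ i, ∑ k, H.mulVec (e y) k * LinearMap.toMatrix' e k i = 0 := by
      intro i
      have h2 : eval y (pderiv i hW) = HW.mulVec y i := by
        rw [hHWd]; simp [Matrix.mulVec, dotProduct]
      rw [hy, chain_rule] at h2
      simp only [map_sum, map_mul] at h2
      rw [← show _ = (0:ℂ) from h2]
      refine Finset.sum_congr rfl fun k _ => ?_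
      rw [hEev, pderiv_linForms, eval_C, hHd]
      simp [Matrix.mulVec, dotProduct]
    have h3 : ∀ w, H.mulVec (e y) ⬝ᵥ e w = 0 := by
      intro w
      rw [← LinearMap.toMatrix'_mulVec e w, Matrix.dotProduct_mulVec]
      have : Matrix.vecMul (H.mulVec (e y)) (LinearMap.toMatrix' e) = 0 := by
        ext i; exact h1 i
      rw [this, zero_dotProduct]
    have h4 : ∀ x, H.mulVec (e y) ⬝ᵥ x = 0 := by
      intro x
      have h5 := (hL _).1 (heπ x)
      have h6 : H.mulVec (e y) ⬝ᵥ (x - e (π x)) = 0 := by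
        rw [← hsym, h5, dotProduct_zero]
      rwa [dotProduct_sub, h3, sub_zero] at h6
    have h7 : H.mulVec (e y) = 0 := by
      ext i
      have := h4 (Pi.single i 1)
      simpa using this
    have h8 : e y = 0 := (Submodule.disjoint_def.1 hWL.disjoint) _ (heW y) ((hL _).2 h7)
    rw [← hπe y, h8, map_zero]
  let F' : Fin (n+1) → MvPolynomial (Fin r) ℂ := fun i => aeval E (F i)
  let G : Fin r → MvPolynomial (Fin r) ℂ := fun j => aeval F' (Pm j)
  have hGev : ∀ y, (fun j => eval y (G j)) = π (fun i => eval (e y) (F i)) := by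
    intro y
    rw [← eval_linForms π]
    ext j
    rw [eval_substT]
    simp only [F', hEev]
    rfl
  have hF'h : ∀ i, (F' i).IsHomogeneous q := by
    intro i
    have := (hFh i).aeval E (n := 1) (linForms_hom e)
    rwa [one_mul] at this
  refine core hr hq hW hWirr hWhom HW hdet hHWd G ?_ ?_ lam hlam ?_
  · intro j
    have := (linForms_hom π j).aeval F' (n := q) hF'h
    rwa [mul_one] at this
  · intro y hy
    have h1 : π (fun i => eval (e y) (F i)) = 0 := by
      rw [← hGev]; ext j; exact hy j
    have h2 := heπ (fun i => eval (e y) (F i))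
    rw [h1, map_zero, sub_zero] at h2
    have h3 := hWF _ (heW y) h2
    rw [← hπe y, h3, map_zero]
  · refine MvPolynomial.funext fun y => ?_
    rw [eval_substT, hGev, hEev, hinv, ← eval_substT, heq]
    simp only [map_mul, map_pow, eval_C, hW, hEev]
end

section
/- For all natural numbers n and k with k ≤ n and every integer d, one has ∑_{i=0}^{k} ( ∑_{j=0}^{i} (−1)^j · binom(n+1, j) · d^{i−j} ) · binom(n−i, k−i) = (d − 1)^k. -/
def chA (d : ℤ) (n i : ℕ) : ℤ :=
  ∑ j ∈ Finset.range (i + 1), (-1 : ℤ) ^ j * ((n + 1).choose j) * d ^ (i - j)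

theorem chA_succ (d : ℤ) (n i : ℕ) : chA d (n + 1) (i + 1) = chA d n (i + 1) - chA d n i := by
  unfold chA
  rw [Finset.sum_range_succ' _ (i + 1), Finset.sum_range_succ' _ (i + 1), add_sub_right_comm,
    ← Finset.sum_sub_distrib]
  congr 1
  · apply Finset.sum_congr rfl
    intro j _
    rw [Nat.choose_succ_succ (n + 1) j, Nat.add_sub_add_right]
    push_cast
    ring

theorem chA_zero (d : ℤ) (n : ℕ) : chA d n 0 = 1 := by simp [chA]

theorem chF (d : ℤ) (k m : ℕ) :
    ∑ i ∈ Finset.range (k + 1 + 1), chA d (k + m) i * ((k + m - i).choose (k + 1 - i)) =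
      (d - 1) ^ (k + 1) := by
  induction m with
  | zero =>
    rw [Finset.sum_range_succ, Finset.sum_eq_zero]
    · simp only [add_zero, Nat.sub_self, Nat.choose_zero_right, Nat.cast_one, mul_one, zero_add]
      unfold chA
      rw [sub_eq_neg_add, add_pow]
      apply Finset.sum_congr rfl
      intro j _
      ring
    · intro i hi
      rw [Finset.mem_range] at hi
      rw [Nat.choose_eq_zero_of_lt (by omega)]
      simp
  | succ m ih =>
    rw [← ih, ← add_assoc, Finset.sum_range_succ']
    simp only [chA_succ, sub_mul, Finset.sum_sub_distrib, Nat.add_sub_add_right]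
    have h := Finset.sum_range_succ'
      (fun i => chA d (k + m) i * (((k + m + 1 - i).choose (k + 1 - i) : ℕ) : ℤ)) (k + 1)
    simp only [Nat.add_sub_add_right, chA_zero] at h
    rw [chA_zero, sub_add_eq_add_sub, ← h, Finset.sum_range_succ, Finset.sum_range_succ _ (k + 1),
      add_sub_right_comm, ← Finset.sum_sub_distrib]
    congr 1
    · apply Finset.sum_congr rfl
      intro i hi
      rw [Finset.mem_range] at hi
      rw [show k + m + 1 - i = (k + m - i) + 1 by omega, show k + 1 - i = (k - i) + 1 by omega,
        Nat.choose_succ_succ]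
      push_cast
      ring
    · simp


/-- The `k`-th Chern class computation: for any integer `d`,
`∑_{i=0}^{k} (∑_{j=0}^{i} (-1)^j binom(n+1,j) d^{i-j}) binom(n-i,k-i) = (d-1)^k`. -/
theorem chern_class_identity (n k : ℕ) (hkn : k ≤ n) (d : ℤ) :
    ∑ i ∈ Finset.range (k + 1),
      (∑ j ∈ Finset.range (i + 1), (-1 : ℤ) ^ j * ((n + 1).choose j) * d ^ (i - j)) *
        ((n - i).choose (k - i)) = (d - 1) ^ k := by
  cases k with
  | zero => simp
  | succ k =>
    obtain ⟨m, rfl⟩ : ∃ m, n = k + m := ⟨n - k, by omega⟩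
    exact chF d k m
end
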